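/- arXiv:math/0106089 — 2 statements merged into one kernel-verified Lean document; each statement's English description precedes it below -/
import Mathlib

section
/- Let q = 2^m with m odd, and let A, B ∈ F_q with λ := B + A² + A + 1 ≠ 0. Then (q − 11 − 2√(2q) − 8·⌊2√q⌋)/24 ≤ N(A,B) ≤ (q + 1 + 2√(2q) + 8·⌊2√q⌋)/24. -/
set_option linter.unusedSectionVars false

section Character

open Polynomial

variable {F : Type*} [Field F] [Algebra (ZMod 2) F]

/-- The canonical additive character of a finite field of characteristic two, with values `±1`. -/
noncomputable def traceSign (x : F) : ℤ :=
  if Algebra.trace (ZMod 2) F x = 0 then 1 else -1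

lemma traceSign_eq_one_or (x : F) : traceSign x = 1 ∨ traceSign x = -1 := by
  unfold traceSign; split_ifs <;> simp

lemma traceSign_eq_one_iff_trace {x : F} :
    traceSign x = 1 ↔ Algebra.trace (ZMod 2) F x = 0 := by
  unfold traceSign; split_ifs with h <;> simp [h]

@[simp] lemma traceSign_zero : traceSign (0 : F) = 1 := by simp [traceSign]

lemma traceSign_mul_self (x : F) : traceSign x * traceSign x = 1 := by
  rcases traceSign_eq_one_or x with h | h <;> simp [h]

lemma traceSign_add (x y : F) : traceSign (x + y) = traceSign x * traceSign y := by
  unfold traceSign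
  rw [map_add]
  generalize Algebra.trace (ZMod 2) F x = a
  generalize Algebra.trace (ZMod 2) F y = b
  revert a b; decide

lemma traceSign_sq [Finite F] (x : F) : traceSign (x ^ 2) = traceSign x := by
  have h := Algebra.trace_eq_of_algEquiv (FiniteField.frobeniusAlgEquivOfAlgebraic (ZMod 2) F) x
  have h2 : (FiniteField.frobeniusAlgEquivOfAlgebraic (ZMod 2) F) x = x ^ 2 := by
    simp
  rw [h2] at h
  simp [traceSign, h]

lemma traceSign_sq_add_self [Finite F] (x : F) : traceSign (x ^ 2 + x) = 1 := by
  rw [traceSign_add, traceSign_sq, traceSign_mul_self]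

lemma exists_traceSign_eq_neg_one [Finite F] : ∃ b : F, traceSign b = -1 := by
  obtain ⟨b, hb⟩ := Algebra.trace_surjective (ZMod 2) F 1
  exact ⟨b, by simp [traceSign, hb]⟩

lemma sum_traceSign_mul [Fintype F] {c : F} (hc : c ≠ 0) : ∑ x : F, traceSign (c * x) = 0 := by
  obtain ⟨b, hb⟩ := exists_traceSign_eq_neg_one (F := F)
  have h : ∑ x : F, traceSign (c * x) = ∑ x : F, traceSign (c * (x + b / c)) :=
    (Equiv.sum_comp (Equiv.addRight (b / c)) fun x ↦ traceSign (c * x)).symm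
  have h2 : ∀ x : F, traceSign (c * (x + b / c)) = -traceSign (c * x) := fun x ↦ by
    rw [mul_add, mul_div_cancel₀ _ hc, traceSign_add, hb, mul_neg_one]
  simp only [h2, Finset.sum_neg_distrib] at h
  linarith

lemma traceSign_one [Finite F] (h : Odd (Module.finrank (ZMod 2) F)) :
    traceSign (1 : F) = -1 := by
  have : Algebra.trace (ZMod 2) F 1 = 1 := by
    have := Algebra.trace_algebraMap (S := F) (1 : ZMod 2)
    rw [map_one] at this
    rw [this]
    simpa using (ZMod.natCast_eq_one_iff_odd).2 h
  simp [traceSign, this]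

lemma exists_sq_add_self_eq [Finite F] [CharP F 2] {x : F} (hx : traceSign x = 1) :
    ∃ y : F, y ^ 2 + y = x := by
  let φ : F →ₗ[ZMod 2] F :=
    (AddMonoidHom.mk' (fun y : F ↦ y ^ 2 + y)
      (fun a b ↦ by rw [CharTwo.add_sq]; ring)).toZModLinearMap 2
  have hφ (y : F) : φ y = y ^ 2 + y := rfl
  have hle : LinearMap.range φ ≤ LinearMap.ker (Algebra.trace (ZMod 2) F) := by
    rintro _ ⟨y, rfl⟩
    exact traceSign_eq_one_iff_trace.1 (traceSign_sq_add_self y)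
  have h1 := LinearMap.finrank_range_add_finrank_ker φ
  have h2 := LinearMap.finrank_range_add_finrank_ker (Algebra.trace (ZMod 2) F)
  have h3 : Module.finrank (ZMod 2) (LinearMap.range (Algebra.trace (ZMod 2) F)) = 1 := by
    rw [LinearMap.range_eq_top.2 (Algebra.trace_surjective _ _), finrank_top]; simp
  have h4 : Module.finrank (ZMod 2) (LinearMap.ker φ) ≤ 1 := by
    rw [finrank_le_one_iff]
    refine ⟨⟨1, ?_⟩, ?_⟩
    · rw [LinearMap.mem_ker, hφ]; simp [CharTwo.add_self_eq_zero]
    · rintro ⟨w, hw⟩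
      rw [LinearMap.mem_ker, hφ] at hw
      have : w * (w + 1) = 0 := by rw [← hw]; ring
      rcases mul_eq_zero.1 this with h | h
      · exact ⟨0, by ext; simp [h]⟩
      · exact ⟨1, by ext; simp [CharTwo.add_eq_zero.1 h]⟩
  have := Submodule.eq_of_le_of_finrank_le hle (by omega)
  have hx' : x ∈ LinearMap.ker (Algebra.trace (ZMod 2) F) := traceSign_eq_one_iff_trace.1 hx
  rw [← this] at hx'
  exact hx'

lemma traceSign_eq_one_iff [Finite F] [CharP F 2] {x : F} :
    traceSign x = 1 ↔ ∃ y : F, y ^ 2 + y = x :=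
  ⟨exists_sq_add_self_eq, fun ⟨y, hy⟩ ↦ hy ▸ traceSign_sq_add_self y⟩

/-- The number of solutions of an Artin–Schreier equation. -/
lemma card_sq_add_self_eq [Fintype F] [DecidableEq F] [CharP F 2] (x : F) :
    ((Finset.univ.filter fun y : F ↦ y ^ 2 + y = x).card : ℤ) = 1 + traceSign x := by
  by_cases h : ∃ y : F, y ^ 2 + y = x
  · rw [traceSign_eq_one_iff.2 h]
    obtain ⟨y, rfl⟩ := h
    have : (Finset.univ.filter fun z : F ↦ z ^ 2 + z = y ^ 2 + y) = {y, y + 1} := by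
      ext z
      simp only [Finset.mem_filter, Finset.mem_univ, true_and, Finset.mem_insert,
        Finset.mem_singleton]
      have h2 : (2 : F) = 0 := CharTwo.two_eq_zero
      constructor
      · intro hz
        have : (z - y) * (z - (y + 1)) = 0 := by
          linear_combination hz - z * h2 + y * h2 - z * y * h2 + y ^ 2 * h2
        rcases mul_eq_zero.1 this with h | h
        · exact Or.inl (sub_eq_zero.1 h)
        · exact Or.inr (sub_eq_zero.1 h)
      · rintro (rfl | rfl)
        · rfl
        · linear_combination (y + 1) * h2
    rw [this, Finset.card_pair (by simp)]
    norm_num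
  · rw [(traceSign_eq_one_or x).resolve_left (fun h' ↦ h (traceSign_eq_one_iff.1 h'))]
    push Not at h
    simp [h]

/-- The number of roots of a quadratic polynomial with non-zero linear coefficient. -/
lemma card_quadratic_roots [Fintype F] [DecidableEq F] [CharP F 2] {d : F} (hd : d ≠ 0) (p : F) :
    ((Finset.univ.filter fun y : F ↦ y ^ 2 + d * y + p = 0).card : ℤ) =
      1 + traceSign (p / d ^ 2) := by
  rw [← card_sq_add_self_eq]
  congr 1
  refine Finset.card_bij (fun y _ ↦ y / d) ?_ ?_ ?_
  · intro y hy
    simp only [Finset.mem_filter, Finset.mem_univ, true_and] at hy ⊢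
    field_simp
    linear_combination hy - p * (CharTwo.two_eq_zero (R := F))
  · intro a _ b _ h
    exact (div_left_inj' hd).1 h
  · intro y hy
    simp only [Finset.mem_filter, Finset.mem_univ, true_and] at hy ⊢
    refine ⟨d * y, ?_, by field_simp⟩
    field_simp at hy
    linear_combination hy + p * (CharTwo.two_eq_zero (R := F))

lemma bijective_cube [Finite F] (h : Odd (Module.finrank (ZMod 2) F)) :
    Function.Bijective fun x : F ↦ x ^ 3 := by
  have := Fintype.ofFinite F
  refine (Finite.injective_iff_bijective).1 fun x y hxy ↦ ?_
  have hc : Nat.card F = 2 ^ Module.finrank (ZMod 2) F := by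
    rw [Module.natCard_eq_pow_finrank (K := ZMod 2)]; simp
  have hcop : Nat.Coprime 3 (Nat.card F - 1) := by
    rw [hc]
    obtain ⟨k, hk⟩ := h
    rw [hk, (Nat.prime_three.coprime_iff_not_dvd)]
    have : 2 ^ (2 * k + 1) % 3 = 2 := by
      rw [pow_succ, pow_mul, Nat.mul_mod, Nat.pow_mod]; norm_num
    have h1 : 1 ≤ 2 ^ (2 * k + 1) := Nat.one_le_two_pow
    generalize 2 ^ (2 * k + 1) = N at *
    omega
  replace hxy : x ^ 3 = y ^ 3 := hxy
  by_cases hx : x = 0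
  · subst hx
    have : y ^ 3 = 0 := by rw [← hxy]; ring
    exact (pow_eq_zero_iff (by norm_num)).1 this |>.symm
  by_cases hy : y = 0
  · subst hy
    exact (pow_eq_zero_iff (n := 3) (by norm_num)).1 (by rw [hxy]; ring)
  have h3 : (x / y) ^ 3 = 1 := by rw [div_pow, hxy, div_self (pow_ne_zero _ hy)]
  have h4 : (x / y) ^ (Nat.card F - 1) = 1 := by
    rw [Nat.card_eq_fintype_card]; exact FiniteField.pow_card_sub_one_eq_one _ (div_ne_zero hx hy)
  have h5 := pow_gcd_eq_one.2 ⟨h3, h4⟩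
  rw [hcop] at h5
  rw [pow_one] at h5
  exact (div_eq_one_iff_eq hy).1 h5

end Character

section QuarticFamily

open Polynomial

variable {F : Type*} [Field F] [Algebra (ZMod 2) F] [CharP F 2]

/-- The linear coefficient of the resolvent cubic. -/
def resolventCoeff (a s : F) : F := s ^ 2 + s + a ^ 2

/-- The constant coefficient of a quadratic factor `T ^ 2 + d * T + c` of the quartic. -/
def quadraticConst (a s d : F) : F := s + (a + s + (d ^ 2 + d)) * d

lemma quartic_eq (a l s t d : F) :
    (t ^ 2 + t + a) * (t ^ 2 + s) + l =
      (t ^ 2 + d * t + quadraticConst a s d) *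
        (t ^ 2 + (d + 1) * t + quadraticConst a s (d + 1)) +
      ((d ^ 2 + d) ^ 3 + resolventCoeff a s * (d ^ 2 + d) + l) := by
  have h2 : (2 : F) = 0 := CharTwo.two_eq_zero
  unfold quadraticConst resolventCoeff
  grind

variable [Fintype F] [DecidableEq F]

/-- The roots of the quartic polynomial `(T ^ 2 + T + a) * (T ^ 2 + s) + l`. -/
def quarticRoots (a l s : F) : Finset F :=
  Finset.univ.filter fun t ↦ (t ^ 2 + t + a) * (t ^ 2 + s) + l = 0

/-- The roots of the resolvent cubic. -/
def resolventRoots (a l s : F) : Finset F :=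
  Finset.univ.filter fun z ↦ z ^ 3 + resolventCoeff a s * z + l = 0

lemma traceSign_resolvent {a l s z : F} (hl : l ≠ 0) (hz : z ∈ resolventRoots a l s) :
    traceSign (l / z ^ 3) = traceSign (1 + resolventCoeff a s ^ 3 / l ^ 2) := by
  simp only [resolventRoots, Finset.mem_filter, Finset.mem_univ, true_and] at hz
  have h2 : (2 : F) = 0 := CharTwo.two_eq_zero
  have hz0 : z ≠ 0 := by rintro rfl; simp [hl] at hz
  have hp : resolventCoeff a s = z ^ 2 + l / z := by
    field_simp
    linear_combination hz - (z ^ 3 + l) * h2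
  have h : 1 + resolventCoeff a s ^ 3 / l ^ 2 =
      ((z ^ 3 / l) ^ 2 + z ^ 3 / l) + l / z ^ 3 := by
    rw [hp]
    field_simp
    linear_combination (2 * z ^ 3 * l ^ 2 + z ^ 6 * l) * h2
  rw [h, traceSign_add, traceSign_sq_add_self, one_mul]

lemma card_resolventRoots {a l s z : F} (hl : l ≠ 0) (hz : z ∈ resolventRoots a l s) :
    ((resolventRoots a l s).card : ℤ) =
      2 + traceSign (1 + resolventCoeff a s ^ 3 / l ^ 2) := by
  have hz' := hz
  simp only [resolventRoots, Finset.mem_filter, Finset.mem_univ, true_and] at hz'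
  have h2 : (2 : F) = 0 := CharTwo.two_eq_zero
  have hz0 : z ≠ 0 := by rintro rfl; simp [hl] at hz'
  have hp : resolventCoeff a s = z ^ 2 + l / z := by
    field_simp
    linear_combination hz' - (z ^ 3 + l) * h2
  have : resolventRoots a l s =
      insert z (Finset.univ.filter fun y : F ↦ y ^ 2 + z * y + l / z = 0) := by
    ext y
    simp only [resolventRoots, Finset.mem_filter, Finset.mem_univ, true_and, Finset.mem_insert]
    have : y ^ 3 + resolventCoeff a s * y + l = (y - z) * (y ^ 2 + z * y + l / z) := by
      rw [hp]
      field_simp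
      linear_combination (z ^ 3 * y + z * l) * h2
    rw [this, mul_eq_zero, sub_eq_zero]
  rw [this, Finset.card_insert_of_notMem]
  · have h3 := card_quadratic_roots hz0 (l / z)
    rw [div_div, ← pow_succ', traceSign_resolvent hl hz] at h3
    push_cast
    rw [h3]; ring
  · simp only [Finset.mem_filter, Finset.mem_univ, true_and]
    intro h
    apply div_ne_zero hl hz0
    linear_combination h - z ^ 2 * h2

lemma traceSign_eq_one_of_resolventRoots_eq_empty (hodd : Odd (Module.finrank (ZMod 2) F))
    {a l s : F} (hl : l ≠ 0) (h : resolventRoots a l s = ∅) :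
    traceSign (1 + resolventCoeff a s ^ 3 / l ^ 2) = 1 := by
  by_contra hne
  have h2 : (2 : F) = 0 := CharTwo.two_eq_zero
  have h1 : traceSign (resolventCoeff a s ^ 3 / l ^ 2) = 1 := by
    rw [traceSign_add, traceSign_one hodd] at hne
    rcases traceSign_eq_one_or (resolventCoeff a s ^ 3 / l ^ 2) with h | h
    · exact h
    · simp [h] at hne
  obtain ⟨y, hy⟩ := exists_sq_add_self_eq h1
  have hy' : l ^ 2 * y ^ 2 + l ^ 2 * y = resolventCoeff a s ^ 3 := by
    field_simp at hy; linear_combination hy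
  -- we may assume that `y` is non-zero
  wlog hy0 : y ≠ 0 generalizing y
  · rw [not_not] at hy0
    subst hy0
    exact this 1 (by simpa [CharTwo.add_self_eq_zero] using hy)
      (by rw [← hy']; linear_combination l ^ 2 * h2) one_ne_zero
  obtain ⟨u, hu⟩ := (bijective_cube hodd).2 (l * y)
  replace hu : u ^ 3 = l * y := hu
  have hu0 : u ≠ 0 := by
    rintro rfl
    exact mul_ne_zero hl hy0 (by rw [← hu]; ring)
  have : u + resolventCoeff a s / u ∈ resolventRoots a l s := by
    simp only [resolventRoots, Finset.mem_filter, Finset.mem_univ, true_and]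
    generalize resolventCoeff a s = p at *
    field_simp
    linear_combination (u ^ 3 + l * y + l) * hu - hy' + (2 * p * u ^ 4 + 2 * p ^ 2 * u ^ 2 +
      l ^ 2 * y + l ^ 2 * y ^ 2) * h2
  simp [h] at this

lemma mem_quarticRoots_pair_iff {a l s t d : F} (hl : l ≠ 0) :
    (t ∈ quarticRoots a l s ∧ t + d ∈ quarticRoots a l s ∧ d ≠ 0) ↔
      (d ^ 2 + d ∈ resolventRoots a l s ∧ t ^ 2 + d * t + quadraticConst a s d = 0) := by
  have h2 : (2 : F) = 0 := CharTwo.two_eq_zero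
  simp only [quarticRoots, resolventRoots, Finset.mem_filter, Finset.mem_univ, true_and]
  rw [quartic_eq a l s t d, quartic_eq a l s (t + d) d]
  have h3 : (t + d) ^ 2 + d * (t + d) + quadraticConst a s d =
      t ^ 2 + d * t + quadraticConst a s d := by
    linear_combination (d * t + d ^ 2) * h2
  have h4 : (t + d) ^ 2 + (d + 1) * (t + d) + quadraticConst a s (d + 1) =
      t ^ 2 + (d + 1) * t + quadraticConst a s (d + 1) + d := by
    linear_combination (d * t + d ^ 2) * h2
  rw [h3, h4]
  generalize t ^ 2 + d * t + quadraticConst a s d = w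
  generalize t ^ 2 + (d + 1) * t + quadraticConst a s (d + 1) = v
  constructor
  · rintro ⟨h5, h6, hd⟩
    have : w * d = 0 := by linear_combination h6 - h5
    obtain rfl : w = 0 := (mul_eq_zero.1 this).resolve_right hd
    exact ⟨by linear_combination h5, rfl⟩
  · rintro ⟨h5, rfl⟩
    refine ⟨by linear_combination h5, by linear_combination h5, ?_⟩
    rintro rfl
    exact hl (by linear_combination h5)

lemma ne_zero_of_mem_resolventRoots {a l s z : F} (hl : l ≠ 0) (hz : z ∈ resolventRoots a l s) :
    z ≠ 0 := by
  rintro rfl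
  simp [resolventRoots, hl] at hz

/-- Ordered pairs of distinct roots of the quartic, counted by their difference. -/
lemma card_quarticRoots_mul {a l s : F} (hl : l ≠ 0) :
    ((quarticRoots a l s).card : ℤ) * ((quarticRoots a l s).card - 1) =
      ∑ d with d ^ 2 + d ∈ resolventRoots a l s,
        (1 + traceSign (quadraticConst a s d / d ^ 2)) := by
  have h1 : ((quarticRoots a l s).card : ℤ) * ((quarticRoots a l s).card - 1) =
      ((quarticRoots a l s).offDiag.card : ℤ) := by
    rw [Finset.offDiag_card, Nat.cast_sub (Nat.le_mul_self _)]
    push_cast; ring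
  have h0 : ∀ x y : F, x + (x + y) = y := fun x y ↦ by
    rw [← add_assoc, CharTwo.add_self_eq_zero, zero_add]
  rw [h1, Finset.card_eq_sum_card_fiberwise (f := fun x ↦ x.1 + x.2)
    (t := Finset.univ.filter fun d ↦ d ^ 2 + d ∈ resolventRoots a l s), Nat.cast_sum]
  · refine Finset.sum_congr rfl fun d hd ↦ ?_
    rw [Finset.mem_filter_univ] at hd
    have hd0 : d ≠ 0 := by
      rintro rfl
      exact ne_zero_of_mem_resolventRoots hl hd (by ring)
    rw [← card_quadratic_roots hd0]
    congr 1
    refine Finset.card_bij (fun x _ ↦ x.1) ?_ ?_ ?_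
    · rintro ⟨x, y⟩ hx
      simp only [Finset.mem_filter, Finset.mem_offDiag] at hx
      obtain ⟨⟨h3, h4, -⟩, rfl⟩ := hx
      rw [Finset.mem_filter_univ]
      exact ((mem_quarticRoots_pair_iff hl).1 ⟨h3, by rwa [h0], hd0⟩).2
    · rintro ⟨x, y⟩ hx ⟨x', y'⟩ hx' (rfl : x = x')
      simp only [Finset.mem_filter] at hx hx'
      simpa using hx.2.trans hx'.2.symm
    · intro t ht
      rw [Finset.mem_filter_univ] at ht
      obtain ⟨h3, h4, -⟩ := (mem_quarticRoots_pair_iff hl).2 ⟨hd, ht⟩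
      refine ⟨(t, t + d), ?_, rfl⟩
      simp only [Finset.mem_filter, Finset.mem_offDiag]
      exact ⟨⟨h3, h4, by simpa using hd0⟩, h0 t d⟩
  · rintro ⟨x, y⟩ hx
    simp only [SetLike.mem_coe, Finset.mem_offDiag] at hx
    simp only [Finset.coe_filter, Finset.mem_univ, true_and, Set.mem_ofPred_eq]
    refine ((mem_quarticRoots_pair_iff hl (t := x)).1 ⟨hx.1, by rw [h0]; exact hx.2.1, ?_⟩).1
    intro h
    exact hx.2.2 (CharTwo.add_eq_zero.1 h)

lemma sum_resolvent_eq (a l s : F) (f : F → ℤ) :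
    ∑ d with d ^ 2 + d ∈ resolventRoots a l s, f d =
      ∑ z ∈ resolventRoots a l s, ∑ d with d ^ 2 + d = z, f d := by
  rw [← Finset.sum_fiberwise_of_maps_to (g := fun d ↦ d ^ 2 + d) (t := resolventRoots a l s)]
  · refine Finset.sum_congr rfl fun z hz ↦ Finset.sum_congr ?_ fun _ _ ↦ rfl
    ext d
    simp only [Finset.mem_filter, Finset.mem_univ, true_and]
    exact ⟨fun h ↦ h.2, fun h ↦ ⟨h ▸ hz, h⟩⟩
  · intro d hd
    simpa using hd

lemma filter_sq_add_self (d : F) :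
    (Finset.univ.filter fun y : F ↦ y ^ 2 + y = d ^ 2 + d) = {d, d + 1} := by
  ext z
  have h2 : (2 : F) = 0 := CharTwo.two_eq_zero
  simp only [Finset.mem_filter, Finset.mem_univ, true_and, Finset.mem_insert,
    Finset.mem_singleton]
  have : z ^ 2 + z = d ^ 2 + d ↔ (z - d) * (z - (d + 1)) = 0 := by
    rw [← sub_eq_zero]
    have : z ^ 2 + z - (d ^ 2 + d) = (z - d) * (z - (d + 1)) := by
      linear_combination (z * d + z - d ^ 2 - d) * h2
    rw [this]
  rw [this, mul_eq_zero, sub_eq_zero, sub_eq_zero]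

lemma sum_traceSign_quadraticConst_eq_zero {a l s z : F} (hl : l ≠ 0)
    (hz : z ∈ resolventRoots a l s)
    (hs : traceSign (1 + resolventCoeff a s ^ 3 / l ^ 2) = -1) :
    ∑ d with d ^ 2 + d = z, traceSign (quadraticConst a s d / d ^ 2) = 0 := by
  have h2 : (2 : F) = 0 := CharTwo.two_eq_zero
  have hz0 := ne_zero_of_mem_resolventRoots hl hz
  by_cases h : ∃ d : F, d ^ 2 + d = z
  · obtain ⟨d, rfl⟩ := h
    have hd0 : d ≠ 0 := by rintro rfl; simp at hz0
    have hd1 : d + 1 ≠ 0 := by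
      intro h; apply hz0; linear_combination d * h
    rw [filter_sq_add_self, Finset.sum_pair (by simp)]
    rw [← traceSign_resolvent hl hz] at hs
    have key : quadraticConst a s d / d ^ 2 + quadraticConst a s (d + 1) / (d + 1) ^ 2 =
        (((a + s) / (d ^ 2 + d)) ^ 2 + (a + s) / (d ^ 2 + d)) + l / (d ^ 2 + d) ^ 3 := by
      simp only [resolventRoots, Finset.mem_filter_univ] at hz
      have : l = - ((d ^ 2 + d) ^ 3 + resolventCoeff a s * (d ^ 2 + d)) := by
        linear_combination hz
      have hdd : d ^ 2 + d = d * (d + 1) := by ring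
      rw [this]
      unfold quadraticConst resolventCoeff
      rw [hdd]
      field_simp
      grind
    have h3 := congr_arg traceSign key
    rw [traceSign_add, traceSign_add, traceSign_sq_add_self, hs] at h3
    rcases traceSign_eq_one_or (quadraticConst a s d / d ^ 2) with h4 | h4 <;>
      rw [h4] at h3 ⊢ <;> linarith
  · rw [Finset.filter_false_of_mem, Finset.sum_empty]
    intro d _ hd
    exact h ⟨d, hd⟩

lemma resolventRoots_sum {a l s z z' : F} (hz : z ∈ resolventRoots a l s)
    (hz' : z' ∈ resolventRoots a l s) (h : z ≠ z') :
    z ^ 2 + z * z' + z' ^ 2 + resolventCoeff a s = 0 := by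
  simp only [resolventRoots, Finset.mem_filter_univ] at hz hz'
  have : (z - z') * (z ^ 2 + z * z' + z' ^ 2 + resolventCoeff a s) = 0 := by
    linear_combination hz - hz'
  exact (mul_eq_zero.1 this).resolve_left (sub_ne_zero.2 h)

lemma sum_traceSign_quadraticConst {a l s z z' : F} (hl : l ≠ 0)
    (hz : z ∈ resolventRoots a l s) (hz' : z' ∈ resolventRoots a l s) (h : z ≠ z') :
    ∑ d with d ^ 2 + d = z, traceSign (quadraticConst a s d / d ^ 2) =
      (1 + traceSign z) * traceSign z' := by
  have h2 : (2 : F) = 0 := CharTwo.two_eq_zero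
  have hz0 := ne_zero_of_mem_resolventRoots hl hz
  have h3 := resolventRoots_sum hz hz' h
  rw [← card_sq_add_self_eq, ← nsmul_eq_mul, Finset.sum_congr rfl, Finset.sum_const]
  intro d hd
  rw [Finset.mem_filter_univ] at hd
  have hd0 : d ≠ 0 := by rintro rfl; simp [hz0.symm] at hd
  have key : quadraticConst a s d / d ^ 2 =
      (((z' + a + s + z) / d) ^ 2 + (z' + a + s + z) / d) + z' := by
    subst hd
    unfold quadraticConst
    unfold resolventCoeff at h3
    field_simp
    grind
  rw [key, traceSign_add, traceSign_sq_add_self, one_mul]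

lemma card_quarticRoots_eq_four (hodd : Odd (Module.finrank (ZMod 2) F)) {a l s : F}
    (hl : l ≠ 0) :
    24 * (if (quarticRoots a l s).card = 4 then 1 else 0 : ℤ) =
      3 * ∑ d with d ^ 2 + d ∈ resolventRoots a l s, traceSign (quadraticConst a s d / d ^ 2) +
      2 * (resolventRoots a l s).card - 1 + traceSign (1 + resolventCoeff a s ^ 3 / l ^ 2) := by
  have hmul := card_quarticRoots_mul (a := a) (s := s) hl
  rw [Finset.sum_add_distrib, sum_resolvent_eq, sum_resolvent_eq] at hmul
  rw [sum_resolvent_eq]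
  have hone : ∀ z : F, ∑ d with d ^ 2 + d = z, (1 : ℤ) = 1 + traceSign z := fun z ↦ by
    rw [← card_sq_add_self_eq, Finset.card_eq_sum_ones]; simp
  simp only [hone] at hmul
  generalize (quarticRoots a l s).card = n at hmul ⊢
  have h24 : n * (n - 1 : ℤ) = 12 → n = 4 := fun h ↦ by
    have : ((n : ℤ) - 4) * (n + 3) = 0 := by linear_combination h
    rcases mul_eq_zero.1 this with h | h <;> omega
  rcases (resolventRoots a l s).eq_empty_or_nonempty with he | ⟨z, hz⟩
  · rw [traceSign_eq_one_of_resolventRoots_eq_empty hodd hl he]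
    rw [he] at hmul ⊢
    rw [if_neg]
    · simp
    · rintro rfl
      simp at hmul
  have hc := card_resolventRoots hl hz
  rcases traceSign_eq_one_or (1 + resolventCoeff a s ^ 3 / l ^ 2) with hs | hs
  · rw [hs] at hc ⊢
    obtain ⟨z₀, z₁, z₂, h01, h02, h12, hZ⟩ := Finset.card_eq_three.1
      (show (resolventRoots a l s).card = 3 by omega)
    have m0 : z₀ ∈ resolventRoots a l s := by simp [hZ]
    have m1 : z₁ ∈ resolventRoots a l s := by simp [hZ]
    have m2 : z₂ ∈ resolventRoots a l s := by simp [hZ]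
    have hsum : z₀ + z₁ + z₂ = 0 := by
      have e1 := resolventRoots_sum m0 m1 h01
      have e2 := resolventRoots_sum m0 m2 h02
      have : (z₁ - z₂) * (z₀ + z₁ + z₂) = 0 := by linear_combination e1 - e2
      exact (mul_eq_zero.1 this).resolve_left (sub_ne_zero.2 h12)
    have hprod := congr_arg traceSign hsum
    rw [traceSign_add, traceSign_add, traceSign_zero] at hprod
    rw [hc]
    rw [hZ, Finset.sum_insert (by simp [h01, h02]), Finset.sum_pair h12] at hmul ⊢
    rw [Finset.sum_insert (by simp [h01, h02]), Finset.sum_pair h12] at hmul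
    rw [sum_traceSign_quadraticConst hl m0 m1 h01, sum_traceSign_quadraticConst hl m1 m0 h01.symm,
      sum_traceSign_quadraticConst hl m2 m0 h02.symm] at hmul ⊢
    rcases traceSign_eq_one_or z₀ with e0 | e0 <;> rcases traceSign_eq_one_or z₁ with e1 | e1 <;>
      rcases traceSign_eq_one_or z₂ with e2 | e2 <;> rw [e0, e1, e2] at hprod hmul <;>
      rw [e0, e1, e2] <;> norm_num at hprod <;> norm_num at hmul ⊢
    · exact h24 hmul
    all_goals
      rintro rfl
      norm_num at hmul
  · rw [hs] at hc ⊢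
    have hsum : ∑ z ∈ resolventRoots a l s, ∑ d with d ^ 2 + d = z,
        traceSign (quadraticConst a s d / d ^ 2) = 0 :=
      Finset.sum_eq_zero fun z hz ↦ sum_traceSign_quadraticConst_eq_zero hl hz hs
    rw [hsum] at hmul ⊢
    rw [hc, if_neg]
    · norm_num
    · rintro rfl
      obtain ⟨z₀, hZ⟩ := Finset.card_eq_one.1 (show (resolventRoots a l s).card = 1 by omega)
      rw [hZ] at hmul
      rcases traceSign_eq_one_or z₀ with e0 | e0 <;> simp [e0] at hmul

lemma mem_resolventRoots_iff {a l s z : F} (hz : z ≠ 0) :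
    z ∈ resolventRoots a l s ↔ s ^ 2 + s = a ^ 2 + z ^ 2 + l / z := by
  have h2 : (2 : F) = 0 := CharTwo.two_eq_zero
  rw [resolventRoots, Finset.mem_filter_univ]
  unfold resolventCoeff
  field_simp
  constructor <;> intro h
  · linear_combination h - (z ^ 3 + a ^ 2 * z + l) * h2
  · linear_combination h + (z ^ 3 + a ^ 2 * z + l) * h2

lemma card_filter_mem_resolventRoots {a l z : F} (hz : z ≠ 0) :
    ((Finset.univ.filter fun s ↦ z ∈ resolventRoots a l s).card : ℤ) =
      1 + traceSign a * traceSign (z + l / z) := by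
  simp only [mem_resolventRoots_iff hz]
  rw [card_sq_add_self_eq, traceSign_add, traceSign_add, traceSign_add, traceSign_sq,
    traceSign_sq, mul_assoc]

lemma sum_card_resolventRoots (a : F) {l : F} (hl : l ≠ 0) :
    ∑ s, ((resolventRoots a l s).card : ℤ) =
      Fintype.card F - 1 + traceSign a * ∑ z with z ≠ 0, traceSign (z + l / z) := by
  have h : ∀ s, ((resolventRoots a l s).card : ℤ) =
      ∑ z with z ≠ 0, if z ∈ resolventRoots a l s then 1 else 0 := fun s ↦ by
    rw [Finset.sum_ite, Finset.sum_const_zero, add_zero, Finset.sum_const, nsmul_one]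
    congr 2
    ext z
    simp only [Finset.mem_filter, Finset.mem_univ, true_and]
    exact ⟨fun h ↦ ⟨ne_zero_of_mem_resolventRoots hl h, h⟩, fun h ↦ h.2⟩
  simp only [h]
  rw [Finset.sum_comm, Finset.mul_sum]
  have h3 : (Fintype.card F : ℤ) - 1 = ∑ z : F with z ≠ 0, 1 := by
    rw [Finset.sum_const, nsmul_one, Finset.filter_ne',
      Finset.card_erase_of_mem (Finset.mem_univ _), Finset.card_univ,
      Nat.cast_sub Fintype.card_pos, Nat.cast_one]
  rw [h3]
  rw [← Finset.sum_add_distrib]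
  refine Finset.sum_congr rfl fun z hz ↦ ?_
  rw [← card_filter_mem_resolventRoots (by simpa using hz), Finset.sum_boole]

lemma sum_traceSign_resolvent (hodd : Odd (Module.finrank (ZMod 2) F)) (a : F) {l : F}
    (hl : l ≠ 0) :
    ∑ s, traceSign (1 + resolventCoeff a s ^ 3 / l ^ 2) =
      - traceSign a * ∑ u, traceSign (l * (u ^ 3 + u)) := by
  have h2 : (2 : F) = 0 := CharTwo.two_eq_zero
  rw [← Finset.sum_fiberwise (s := Finset.univ) (g := fun s ↦ resolventCoeff a s)]
  have h : ∀ p : F, ∑ s with resolventCoeff a s = p,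
      traceSign (1 + resolventCoeff a s ^ 3 / l ^ 2) =
      - traceSign ((l ^ 2)⁻¹ * p ^ 3) - traceSign a * traceSign (p + p ^ 3 / l ^ 2) := fun p ↦ by
    rw [Finset.sum_congr rfl (g := fun _ ↦ - traceSign (p ^ 3 / l ^ 2)), Finset.sum_const,
      nsmul_eq_mul]
    · have : ∀ s, resolventCoeff a s = p ↔ s ^ 2 + s = p + a ^ 2 := fun s ↦ by
        unfold resolventCoeff
        constructor <;> intro h
        · linear_combination h - a ^ 2 * h2
        · linear_combination h + a ^ 2 * h2
      simp only [this]
      rw [card_sq_add_self_eq, traceSign_add, traceSign_add, traceSign_sq, div_eq_inv_mul]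
      ring
    · intro s hs
      rw [Finset.mem_filter_univ] at hs
      rw [hs, traceSign_add, traceSign_one hodd, neg_one_mul]
  simp only [h]
  rw [Finset.sum_sub_distrib, Finset.sum_neg_distrib,
    (bijective_cube hodd).sum_comp fun x ↦ traceSign ((l ^ 2)⁻¹ * x),
    sum_traceSign_mul (by positivity), ← Finset.mul_sum,
    ← (mulLeft_bijective₀ l hl).sum_comp fun p ↦ traceSign (p + p ^ 3 / l ^ 2)]
  rw [neg_zero, zero_sub, neg_mul]
  congr 2
  refine Finset.sum_congr rfl fun u _ ↦ ?_
  congr 1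
  field_simp
  ring

lemma sum_quadraticConst (a : F) {l : F} (hl : l ≠ 0) :
    ∑ s, ∑ d with d ^ 2 + d ∈ resolventRoots a l s, traceSign (quadraticConst a s d / d ^ 2) =
      ∑ v with v ≠ 0, traceSign (l * (v ^ 3 + v⁻¹)) - 1 +
        traceSign a * (∑ v, traceSign (l * (v ^ 3 + v)) - 2) := by
  have h2 : (2 : F) = 0 := CharTwo.two_eq_zero
  have key : ∀ s d : F, d ≠ 0 ∧ d ≠ 1 → d ^ 2 + d ∈ resolventRoots a l s →
      traceSign (quadraticConst a s d / d ^ 2) = traceSign (l / (d ^ 2 * (d ^ 2 + d))) := by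
    rintro s d ⟨hd0, hd1⟩ hm
    have hz := ne_zero_of_mem_resolventRoots hl hm
    have hz' : d * (d + 1) ≠ 0 := by convert hz using 1; ring
    have hd1' : d + 1 ≠ 0 := (mul_ne_zero_iff.1 hz').2
    rw [mem_resolventRoots_iff hz] at hm
    have : quadraticConst a s d / d ^ 2 = ((s + a + (d ^ 2 + d)) / d) ^ 2 +
        (s + a + (d ^ 2 + d)) / d + l / (d ^ 2 * (d ^ 2 + d)) := by
      have h3 : l / (d ^ 2 * (d ^ 2 + d)) = (s ^ 2 + s - a ^ 2 - (d ^ 2 + d) ^ 2) / d ^ 2 := by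
        rw [hm]
        field_simp
        ring
      rw [h3]
      unfold quadraticConst
      field_simp
      grind
    rw [this, traceSign_add, traceSign_sq_add_self, one_mul]
  have hsplit : ∀ s, ∑ d with d ^ 2 + d ∈ resolventRoots a l s,
      traceSign (quadraticConst a s d / d ^ 2) = ∑ d with d ≠ 0 ∧ d ≠ 1,
        if d ^ 2 + d ∈ resolventRoots a l s then
          traceSign (l / (d ^ 2 * (d ^ 2 + d))) else 0 := fun s ↦ by
    rw [Finset.sum_ite, Finset.sum_const_zero, add_zero]
    refine Finset.sum_congr ?_ fun d hd ↦ ?_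
    · ext d
      simp only [Finset.mem_filter, Finset.mem_univ, true_and]
      refine ⟨fun h ↦ ⟨⟨?_, ?_⟩, h⟩, fun h ↦ h.2⟩
      · rintro rfl
        exact ne_zero_of_mem_resolventRoots hl h (by ring)
      · rintro rfl
        exact ne_zero_of_mem_resolventRoots hl h (by linear_combination h2)
    · simp only [Finset.mem_filter, Finset.mem_univ, true_and] at hd
      exact key s d hd.1 hd.2
  simp only [hsplit]
  rw [Finset.sum_comm]
  have hinner : ∀ d ∈ Finset.univ.filter fun d : F ↦ d ≠ 0 ∧ d ≠ 1,
      (∑ s, if d ^ 2 + d ∈ resolventRoots a l s then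
          traceSign (l / (d ^ 2 * (d ^ 2 + d))) else 0) =
        traceSign (l * ((1 + d⁻¹) ^ 3 + (1 + d⁻¹)⁻¹)) +
          traceSign a * traceSign (l * ((1 + d⁻¹) ^ 3 + (1 + d⁻¹))) := by
    intro d hd
    simp only [Finset.mem_filter, Finset.mem_univ, true_and] at hd
    obtain ⟨hd0, hd1⟩ := hd
    have hd1' : d + 1 ≠ 0 := fun h ↦ hd1 (CharTwo.add_eq_zero.1 h)
    have hd1'' : 1 + d⁻¹ ≠ 0 := by
      intro h
      apply hd1'
      field_simp at h
      simpa using h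
    have hz : d ^ 2 + d ≠ 0 := by
      have := mul_ne_zero hd0 hd1'
      convert this using 1; ring
    rw [← Finset.sum_filter, Finset.sum_const, nsmul_eq_mul, card_filter_mem_resolventRoots hz,
      traceSign_add, traceSign_sq_add_self, one_mul, add_mul, one_mul, mul_assoc, ← traceSign_add]
    congr 2
    · have : d ^ 2 + d = d * (d + 1) := by ring
      rw [this]
      field_simp
      grind
    · congr 1
      have : d ^ 2 + d = d * (d + 1) := by ring
      rw [this]
      field_simp
      grind
  rw [Finset.sum_congr rfl hinner]
  have hbij : ∀ f : F → ℤ, ∑ d with d ≠ 0 ∧ d ≠ 1, f (1 + d⁻¹) = ∑ v with v ≠ 0 ∧ v ≠ 1, f v := by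
    intro f
    have hmem : ∀ d : F, d ≠ 0 ∧ d ≠ 1 → 1 + d⁻¹ ≠ 0 ∧ 1 + d⁻¹ ≠ 1 := by
      rintro d ⟨hd0, hd1⟩
      refine ⟨fun h ↦ hd1 ?_, by simpa using hd0⟩
      rw [CharTwo.add_eq_zero] at h
      exact inv_eq_one.1 h.symm
    have hmem' : ∀ d : F, d ≠ 0 ∧ d ≠ 1 → (1 + d)⁻¹ ≠ 0 ∧ (1 + d)⁻¹ ≠ 1 := by
      rintro d ⟨hd0, hd1⟩
      refine ⟨inv_ne_zero fun h ↦ hd1 (CharTwo.add_eq_zero.1 h).symm, fun h ↦ hd0 ?_⟩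
      simpa using inv_eq_one.1 h
    refine Finset.sum_bij' (fun d _ ↦ 1 + d⁻¹) (fun v _ ↦ (1 + v)⁻¹) ?_ ?_ ?_ ?_ ?_
    · intro d hd
      simp only [Finset.mem_filter, Finset.mem_univ, true_and] at hd ⊢
      exact hmem d hd
    · intro d hd
      simp only [Finset.mem_filter, Finset.mem_univ, true_and] at hd ⊢
      exact hmem' d hd
    · intro d _
      rw [← add_assoc, CharTwo.add_self_eq_zero, zero_add, inv_inv]
    · intro d _
      rw [inv_inv, ← add_assoc, CharTwo.add_self_eq_zero, zero_add]
    · intro d _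
      rfl
  rw [hbij fun v ↦ traceSign (l * (v ^ 3 + v⁻¹)) + traceSign a * traceSign (l * (v ^ 3 + v)),
    Finset.sum_add_distrib, ← Finset.mul_sum]
  have e1 : ∀ f : F → ℤ, ∑ v with v ≠ 0, f v = ∑ v with v ≠ 0 ∧ v ≠ 1, f v + f 1 := by
    intro f
    rw [← Finset.sum_filter_add_sum_filter_not _ (fun v ↦ v ≠ 1), Finset.filter_filter,
      Finset.filter_filter]
    congr 1
    rw [Finset.sum_eq_single 1] <;> simp +contextual
  have e0 : ∀ f : F → ℤ, ∑ v, f v = ∑ v with v ≠ 0, f v + f 0 := by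
    intro f
    rw [← Finset.sum_filter_add_sum_filter_not _ (fun v ↦ v ≠ 0)]
    congr 1
    rw [Finset.sum_eq_single 0] <;> simp +contextual
  rw [e0 fun v ↦ traceSign (l * (v ^ 3 + v)), e1, e1]
  simp only [one_pow, inv_one, CharTwo.add_self_eq_zero, mul_zero, traceSign_zero, ne_eq,
    OfNat.ofNat_ne_zero, not_false_eq_true, zero_pow]
  ring

/-- The number of members of the quartic family with four rational roots. -/
theorem card_quarticRoots_formula (hodd : Odd (Module.finrank (ZMod 2) F)) (a : F) {l : F}
    (hl : l ≠ 0) :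
    24 * ((Finset.univ.filter fun s ↦ (quarticRoots a l s).card = 4).card : ℤ) =
      Fintype.card F - 5 - 6 * traceSign a +
        3 * ∑ v with v ≠ 0, traceSign (l * (v ^ 3 + v⁻¹)) +
        2 * traceSign a * ∑ z with z ≠ 0, traceSign (z + l / z) +
        2 * traceSign a * ∑ u, traceSign (l * (u ^ 3 + u)) := by
  have h1 := Finset.sum_congr rfl fun s (_ : s ∈ Finset.univ) ↦
    card_quarticRoots_eq_four (a := a) (s := s) hodd hl
  rw [← Finset.mul_sum, Finset.sum_boole, Finset.sum_add_distrib, Finset.sum_sub_distrib,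
    Finset.sum_add_distrib, ← Finset.mul_sum, ← Finset.mul_sum, sum_quadraticConst a hl,
    sum_card_resolventRoots a hl, sum_traceSign_resolvent hodd a hl] at h1
  simp only [Finset.sum_const, Finset.card_univ, nsmul_eq_mul, mul_one] at h1
  linear_combination h1

lemma exists_eq_insert_of_card_eq_four {α : Type*} [DecidableEq α] {S : Finset α}
    (h : S.card = 4) : ∃ x₁ x₂ x₃ x₄, x₁ ≠ x₂ ∧ x₁ ≠ x₃ ∧ x₁ ≠ x₄ ∧ x₂ ≠ x₃ ∧ x₂ ≠ x₄ ∧ x₃ ≠ x₄ ∧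
      S = {x₁, x₂, x₃, x₄} := by
  obtain ⟨x₁, T, h1, rfl, hT⟩ := Finset.card_eq_succ.1 h
  obtain ⟨x₂, x₃, x₄, h23, h24, h34, rfl⟩ := Finset.card_eq_three.1 hT
  simp only [Finset.mem_insert, Finset.mem_singleton, not_or] at h1
  exact ⟨x₁, x₂, x₃, x₄, h1.1, h1.2.1, h1.2.2, h23, h24, h34, rfl⟩

lemma sum_insert_four {α : Type*} [DecidableEq α] {x₁ x₂ x₃ x₄ : α} (h12 : x₁ ≠ x₂) (h13 : x₁ ≠ x₃)
    (h14 : x₁ ≠ x₄) (h23 : x₂ ≠ x₃) (h24 : x₂ ≠ x₄) (h34 : x₃ ≠ x₄) (f : α → F) :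
    ∑ x ∈ {x₁, x₂, x₃, x₄}, f x = f x₁ + f x₂ + f x₃ + f x₄ := by
  rw [Finset.sum_insert (by simp [h12, h13, h14]), Finset.sum_insert (by simp [h23, h24]),
    Finset.sum_pair h34]
  ring

lemma powerSum_quarticRoots {a l s : F} (h : (quarticRoots a l s).card = 4) :
    ∑ x ∈ quarticRoots a l s, x = 1 ∧ ∑ x ∈ quarticRoots a l s, x ^ 3 = a + 1 ∧
      ∑ x ∈ quarticRoots a l s, x ^ 5 = l + a ^ 2 + a + 1 := by
  have h2 : (2 : F) = 0 := CharTwo.two_eq_zero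
  obtain ⟨x, y, z, w, hxy, hxz, hxw, hyz, hyw, hzw, hS⟩ := exists_eq_insert_of_card_eq_four h
  have hmem : ∀ t ∈ quarticRoots a l s, (t ^ 2 + t + a) * (t ^ 2 + s) + l = 0 := fun t ht ↦ by
    simpa [quarticRoots] using ht
  have qx := hmem x (by simp [hS])
  have qy := hmem y (by simp [hS])
  have qz := hmem z (by simp [hS])
  have qw := hmem w (by simp [hS])
  rw [hS]
  rw [sum_insert_four hxy hxz hxw hyz hyw hzw, sum_insert_four hxy hxz hxw hyz hyw hzw,
    sum_insert_four hxy hxz hxw hyz hyw hzw]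
  have d1 : ∀ {x y : F}, x ≠ y → (x ^ 2 + x + a) * (x ^ 2 + s) + l = 0 →
      (y ^ 2 + y + a) * (y ^ 2 + s) + l = 0 →
      x ^ 3 + x ^ 2 * y + x * y ^ 2 + y ^ 3 + (x ^ 2 + x * y + y ^ 2) + (a + s) * (x + y) + s = 0 :=
    fun {x y} hxy hx hy ↦ mul_left_cancel₀ (sub_ne_zero.2 hxy) (by linear_combination hx - hy)
  have e2 : ∀ {z : F}, y ≠ z → x ≠ z → (z ^ 2 + z + a) * (z ^ 2 + s) + l = 0 →
      x ^ 2 + y ^ 2 + z ^ 2 + x * y + x * z + y * z + (x + y + z) + (a + s) = 0 :=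
    fun hyz hxz hz ↦ mul_left_cancel₀ (sub_ne_zero.2 hyz) (by
      linear_combination d1 hxy qx qy - d1 hxz qx hz)
  have e1 : x + y + z + w + 1 = 0 := mul_left_cancel₀ (sub_ne_zero.2 hzw) (by
    linear_combination e2 hyz hxz qz - e2 hyw hxw qw)
  have hw : w = x + y + z + 1 := by linear_combination e1 - (x + y + z + 1) * h2
  have hs := e2 hyz hxz qz
  have hs' : s = a + (x ^ 2 + y ^ 2 + z ^ 2 + x * y + x * z + y * z + (x + y + z)) := by
    linear_combination hs - (x ^ 2 + y ^ 2 + z ^ 2 + x * y + x * z + y * z + (x + y + z) + a) * h2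
  have h3 := d1 hxy qx qy
  rw [hw]
  have hl : l = (x ^ 2 + x + a) * (x ^ 2 + s) := by
    linear_combination qx - (x ^ 2 + x + a) * (x ^ 2 + s) * h2
  rw [hl]
  clear qx qy qz qw e1 e2 d1 hmem hl hs
  subst hs'
  refine ⟨by linear_combination (x + y + z) * h2, by grind, by grind⟩

lemma eq_quarticRoots {A B : F} {S : Finset F} (hS : S.card = 4) (h1 : ∑ x ∈ S, x = 1)
    (h3 : ∑ x ∈ S, x ^ 3 = A) (h5 : ∑ x ∈ S, x ^ 5 = B) :
    ∃ s, S = quarticRoots (A + 1) (B + A ^ 2 + A + 1) s := by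
  have h2 : (2 : F) = 0 := CharTwo.two_eq_zero
  obtain ⟨x, y, z, w, hxy, hxz, hxw, hyz, hyw, hzw, rfl⟩ := exists_eq_insert_of_card_eq_four hS
  rw [sum_insert_four hxy hxz hxw hyz hyw hzw] at h1 h3 h5
  refine ⟨x * y + x * z + x * w + y * z + y * w + z * w + (A + 1), ?_⟩
  ext t
  have key : (t ^ 2 + t + (A + 1)) * (t ^ 2 + (x * y + x * z + x * w + y * z + y * w + z * w +
      (A + 1))) + (B + A ^ 2 + A + 1) = (t - x) * ((t - y) * ((t - z) * (t - w))) := by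
    have hw : w = x + y + z + 1 := by linear_combination h1 - (x + y + z) * h2
    subst hw
    subst h3 h5
    clear hxy hxz hxw hyz hyw hzw hS h1
    grind
  rw [quarticRoots, Finset.mem_filter_univ, key]
  simp [sub_eq_zero]

theorem ncard_powerSum_eq (A B : F) (hl : B + A ^ 2 + A + 1 ≠ 0) :
    Set.ncard {S : Finset F | S.card = 4 ∧ (∑ x ∈ S, x) = 1 ∧ (∑ x ∈ S, x ^ 3) = A ∧
        (∑ x ∈ S, x ^ 5) = B} =
      (Finset.univ.filter fun s : F ↦
        (quarticRoots (A + 1) (B + A ^ 2 + A + 1) s).card = 4).card := by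
  have h2 : (2 : F) = 0 := CharTwo.two_eq_zero
  rw [← Set.ncard_coe_finset]
  symm
  refine Set.ncard_congr (fun s _ ↦ quarticRoots (A + 1) (B + A ^ 2 + A + 1) s) ?_ ?_ ?_
  · intro s hs
    have hs' : (quarticRoots (A + 1) (B + A ^ 2 + A + 1) s).card = 4 := by simpa using hs
    obtain ⟨p1, p3, p5⟩ := powerSum_quarticRoots hs'
    refine ⟨hs', p1, ?_, ?_⟩
    · rw [p3]; linear_combination h2
    · rw [p5]; linear_combination (A ^ 2 + 2 * A + 2) * h2
  · intro s s' hs hs' h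
    have hs1 : (quarticRoots (A + 1) (B + A ^ 2 + A + 1) s).card = 4 := by simpa using hs
    obtain ⟨t, ht⟩ := Finset.card_pos.1 (hs1.symm ▸ Nat.succ_pos 3 :
      0 < (quarticRoots (A + 1) (B + A ^ 2 + A + 1) s).card)
    have ht' : t ∈ quarticRoots (A + 1) (B + A ^ 2 + A + 1) s' := by rwa [h] at ht
    rw [quarticRoots, Finset.mem_filter_univ] at ht ht'
    have h3 : (t ^ 2 + t + (A + 1)) * (s - s') = 0 := by linear_combination ht - ht'
    rcases mul_eq_zero.1 h3 with h4 | h4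
    · rw [h4, zero_mul, zero_add] at ht
      exact absurd ht hl
    · exact sub_eq_zero.1 h4
  · rintro S ⟨hS, h1, h3, h5⟩
    obtain ⟨s, rfl⟩ := eq_quarticRoots hS h1 h3 h5
    exact ⟨s, by simpa using hS, rfl⟩

end QuarticFamily

section CubicSum

open Polynomial

variable {F : Type*} [Field F] [Algebra (ZMod 2) F]

lemma traceSign_le_one (x : F) : traceSign x ≤ 1 := by
  rcases traceSign_eq_one_or x with h | h <;> simp [h]

lemma sq_sum_traceSign_cubic_le [Fintype F] [CharP F 2]
    (hodd : Odd (Module.finrank (ZMod 2) F)) {l : F} (hl : l ≠ 0) :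
    (∑ u : F, traceSign (l * (u ^ 3 + u))) ^ 2 ≤ 2 * Fintype.card F := by
  classical
  have h2 : (2 : F) = 0 := CharTwo.two_eq_zero
  have hinner (d : F) : ∑ w : F, traceSign (l * d * w ^ 2 + l * d ^ 2 * w) =
      if l * d = (l * d ^ 2) ^ 2 then (Fintype.card F : ℤ) else 0 := by
    obtain ⟨e, he⟩ := (Finite.injective_iff_surjective.1 (frobenius_inj F 2)) (l * d)
    rw [frobenius_def] at he
    have h (w : F) : traceSign (l * d * w ^ 2 + l * d ^ 2 * w) =
        traceSign ((e + l * d ^ 2) * w) := by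
      rw [← he, ← mul_pow, traceSign_add, traceSign_sq, ← traceSign_add, add_mul]
    simp only [h]
    split_ifs with hd
    · have : e = l * d ^ 2 := frobenius_inj F 2 (by rw [frobenius_def, frobenius_def, he, hd])
      simp [this, CharTwo.add_self_eq_zero]
    · apply sum_traceSign_mul
      intro h0
      rw [CharTwo.add_eq_zero] at h0
      exact hd (by rw [← h0, he])
  have key : (∑ u : F, traceSign (l * (u ^ 3 + u))) ^ 2 =
      ∑ d : F, if l * d = (l * d ^ 2) ^ 2 then
        traceSign (l * (d ^ 3 + d)) * (Fintype.card F : ℤ) else 0 := by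
    calc (∑ u : F, traceSign (l * (u ^ 3 + u))) ^ 2
        = ∑ w : F, ∑ d : F, traceSign (l * (w ^ 3 + w)) *
            traceSign (l * ((w + d) ^ 3 + (w + d))) := by
          rw [sq, Finset.sum_mul_sum]
          refine Finset.sum_congr rfl fun w _ ↦ ?_
          exact (Equiv.sum_comp (Equiv.addLeft w)
            fun d ↦ traceSign (l * (w ^ 3 + w)) * traceSign (l * (d ^ 3 + d))).symm
      _ = ∑ d : F, ∑ w : F, traceSign (l * (d ^ 3 + d)) *
            traceSign (l * d * w ^ 2 + l * d ^ 2 * w) := by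
          rw [Finset.sum_comm]
          refine Finset.sum_congr rfl fun d _ ↦ Finset.sum_congr rfl fun w _ ↦ ?_
          rw [← traceSign_add, ← traceSign_add]
          congr 1
          linear_combination (l * w ^ 3 + l * w + l * w ^ 2 * d + l * w * d ^ 2) * h2
      _ = _ := by
          refine Finset.sum_congr rfl fun d _ ↦ ?_
          rw [← Finset.mul_sum, hinner]
          split_ifs <;> simp
  rw [key, ← Finset.sum_filter]
  have hcard : (Finset.univ.filter fun d : F ↦ l * d = (l * d ^ 2) ^ 2).card ≤ 2 := by
    obtain ⟨t, ht⟩ := (bijective_cube hodd).2 l⁻¹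
    refine (Finset.card_le_card (t := {0, t}) fun d hd ↦ ?_).trans Finset.card_le_two
    simp only [Finset.mem_filter, Finset.mem_univ, true_and] at hd
    by_cases h0 : d = 0
    · simp [h0]
    · have : d ^ 3 = l⁻¹ := by
        apply eq_inv_of_mul_eq_one_left
        apply mul_left_cancel₀ (mul_ne_zero hl h0)
        linear_combination -hd
      have := (bijective_cube hodd).1 (this.trans ht.symm)
      simp [this]
  calc _ ≤ ∑ d ∈ Finset.univ.filter fun d : F ↦ l * d = (l * d ^ 2) ^ 2,
        (Fintype.card F : ℤ) := by
        refine Finset.sum_le_sum fun d _ ↦ ?_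
        have := traceSign_le_one (l * (d ^ 3 + d))
        nlinarith [Int.natCast_nonneg (Fintype.card F)]
    _ ≤ _ := by
        rw [Finset.sum_const, nsmul_eq_mul]
        have : ((Finset.univ.filter fun d : F ↦ l * d = (l * d ^ 2) ^ 2).card : ℤ) ≤ 2 := by
          exact_mod_cast hcard
        exact mul_le_mul_of_nonneg_right this (Int.natCast_nonneg _)

end CubicSum

section PointCount

open Polynomial

variable {k : Type*} [Field k]

/-- A polynomial supported in degrees of the form `i + j * m` with `i < I` and `j < J`. -/
noncomputable def gapPoly (m : ℕ) {I J : ℕ} (c : Fin I → Fin J → k) : k[X] :=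
  ∑ i : Fin I, ∑ j : Fin J, monomial ((i : ℕ) + j * m) (c i j)

lemma coeff_gapPoly (m : ℕ) {I J : ℕ} (c : Fin I → Fin J → k) (n : ℕ) :
    (gapPoly m c).coeff n = ∑ i : Fin I, ∑ j : Fin J, if (i : ℕ) + j * m = n then c i j else 0 := by
  simp [gapPoly, finsetSum_coeff, coeff_monomial]

lemma exists_natDegree_gapPoly {m I J : ℕ} {c : Fin I → Fin J → k} (h : gapPoly m c ≠ 0) :
    ∃ i < I, ∃ j < J, (gapPoly m c).natDegree = i + j * m := by
  have h1 : (gapPoly m c).coeff (gapPoly m c).natDegree ≠ 0 := by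
    rwa [coeff_natDegree, leadingCoeff_ne_zero]
  rw [coeff_gapPoly] at h1
  obtain ⟨i, -, hi⟩ := Finset.exists_ne_zero_of_sum_ne_zero h1
  obtain ⟨j, -, hj⟩ := Finset.exists_ne_zero_of_sum_ne_zero hi
  exact ⟨i, i.2, j, j.2, by
    by_contra hne
    exact hj (if_neg fun h ↦ hne h.symm)⟩

lemma eq_zero_of_gapPoly_eq_zero {m I J : ℕ} (hI : I ≤ m) {c : Fin I → Fin J → k}
    (h : gapPoly m c = 0) : c = 0 := by
  funext i j
  have h1 := coeff_gapPoly m c (i + j * m)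
  rw [h, coeff_zero, Finset.sum_eq_single i, Finset.sum_eq_single j, if_pos rfl] at h1
  · exact h1.symm
  · intro j' _ hj
    rw [if_neg]
    intro h2
    have hm : 0 < m := lt_of_lt_of_le i.pos hI
    exact hj (Fin.ext (Nat.eq_of_mul_eq_mul_right hm (by omega)))
  · simp
  · intro i' _ hi
    refine Finset.sum_eq_zero fun j' _ ↦ if_neg fun h2 ↦ hi (Fin.ext ?_)
    have h3 := congr_arg (· % m) h2
    simp only [Nat.add_mul_mod_self_right] at h3
    rwa [Nat.mod_eq_of_lt (i'.2.trans_le hI), Nat.mod_eq_of_lt (i.2.trans_le hI)] at h3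
  · simp

open QuadraticAlgebra

lemma natDegree_norm {h : k[X]} {d : ℕ} (hd : h.natDegree = 2 * d + 1) (hd0 : 0 < d)
    {z : QuadraticAlgebra k[X] h X} (hz : z ≠ 0) :
    norm z ≠ 0 ∧ ((z.re ≠ 0 ∧ (norm z).natDegree = 2 * z.re.natDegree) ∨
      (z.im ≠ 0 ∧ (norm z).natDegree = 2 * z.im.natDegree + (2 * d + 1))) := by
  have hh0 : h ≠ 0 := by rintro rfl; simp at hd
  rw [norm_def]
  have hz' : z.re ≠ 0 ∨ z.im ≠ 0 := by
    by_contra! h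
    exact hz (QuadraticAlgebra.ext h.1 h.2)
  generalize z.re = x at *
  generalize z.im = y at *
  by_cases hy : y = 0
  · have hx : x ≠ 0 := by simpa [hy] using hz'
    subst hy
    simp only [mul_zero, add_zero, sub_zero]
    exact ⟨mul_ne_zero hx hx, Or.inl ⟨hx, by rw [natDegree_mul hx hx]; ring⟩⟩
  have e3 : (h * y * y).natDegree = 2 * y.natDegree + (2 * d + 1) := by
    rw [natDegree_mul (mul_ne_zero hh0 hy) hy, natDegree_mul hh0 hy, hd]; ring
  by_cases hx : x = 0
  · subst hx
    simp only [mul_zero, zero_mul, add_zero, zero_sub, natDegree_neg, neg_ne_zero]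
    exact ⟨mul_ne_zero (mul_ne_zero hh0 hy) hy, Or.inr ⟨hy, e3⟩⟩
  have e1 : (x * x).natDegree = 2 * x.natDegree := by rw [natDegree_mul hx hx]; ring
  have e2 : (X * x * y).natDegree = 1 + x.natDegree + y.natDegree := by
    rw [natDegree_mul (mul_ne_zero X_ne_zero hx) hy, natDegree_mul X_ne_zero hx, natDegree_X]
  have hne : ∀ p : k[X], 0 < p.natDegree → p ≠ 0 := by rintro p hp rfl; simp at hp
  rcases lt_or_ge (y.natDegree + d) x.natDegree with hlt | hge
  · have e4 : (x * x + X * x * y).natDegree = 2 * x.natDegree := by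
      rw [natDegree_add_eq_left_of_natDegree_lt (by omega), e1]
    have e5 : (x * x + X * x * y - h * y * y).natDegree = 2 * x.natDegree := by
      rw [natDegree_sub_eq_left_of_natDegree_lt (by omega), e4]
    exact ⟨hne _ (by omega), Or.inl ⟨hx, e5⟩⟩
  · have e4 : (x * x + X * x * y).natDegree < 2 * y.natDegree + (2 * d + 1) :=
      lt_of_le_of_lt (natDegree_add_le _ _) (by omega)
    have e5 : (x * x + X * x * y - h * y * y).natDegree = 2 * y.natDegree + (2 * d + 1) := by
      rw [natDegree_sub_eq_right_of_natDegree_lt (by omega), e3]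
    exact ⟨hne _ (by omega), Or.inr ⟨hy, e5⟩⟩

lemma natDegree_norm_gapPoly {h : k[X]} {d : ℕ} (hd : h.natDegree = 2 * d + 1) (hd0 : 0 < d)
    {m I J : ℕ} (hI : 2 * I + 2 * d ≤ m) {c c' : Fin I → Fin J → k}
    (hz : (⟨gapPoly m c, gapPoly m c'⟩ : QuadraticAlgebra k[X] h X) ≠ 0) :
    norm (⟨gapPoly m c, gapPoly m c'⟩ : QuadraticAlgebra k[X] h X) ≠ 0 ∧
      ∃ t, ∃ s < m,
        (norm (⟨gapPoly m c, gapPoly m c'⟩ : QuadraticAlgebra k[X] h X)).natDegree =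
          2 * m * t + s := by
  obtain ⟨h1, h2⟩ := natDegree_norm hd hd0 hz
  refine ⟨h1, ?_⟩
  rcases h2 with ⟨h2, h3⟩ | ⟨h2, h3⟩
  · obtain ⟨i, hi, j, -, hij⟩ := exists_natDegree_gapPoly h2
    exact ⟨j, 2 * i, by omega, by rw [h3, hij]; ring⟩
  · obtain ⟨i, hi, j, -, hij⟩ := exists_natDegree_gapPoly h2
    exact ⟨j, 2 * i + (2 * d + 1), by omega, by rw [h3, hij]; ring⟩

/-- The elements of the quadratic algebra built from gap polynomials are linearly independent. -/
lemma eq_zero_of_gapPoly_add_eq_zero {h : k[X]} {d : ℕ} (hd : h.natDegree = 2 * d + 1)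
    (hd0 : 0 < d) {m I J : ℕ} (hI : 2 * I + 2 * d ≤ m) {c : Fin 2 → Fin 2 → Fin I → Fin J → k}
    (hz : (⟨gapPoly m (c 0 0), gapPoly m (c 1 0)⟩ : QuadraticAlgebra k[X] h X) +
      ⟨gapPoly m (c 0 1), gapPoly m (c 1 1)⟩ * ω ^ m = 0) : c = 0 := by
  have hIm : I ≤ m := by omega
  have h1 : (⟨gapPoly m (c 0 1), gapPoly m (c 1 1)⟩ : QuadraticAlgebra k[X] h X) = 0 := by
    by_contra hr
    obtain ⟨hr0, t, s, hs, hrd⟩ := natDegree_norm_gapPoly hd hd0 hI hr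
    have hh0 : h ≠ 0 := by rintro rfl; simp at hd
    have hω : norm (ω : QuadraticAlgebra k[X] h X) = -h := by simp [norm_def]
    have h2 := congr_arg QuadraticAlgebra.norm (eq_neg_of_add_eq_zero_left hz)
    rw [QuadraticAlgebra.norm_neg, map_mul, map_pow, hω] at h2
    have hω0 : (-h) ^ m ≠ 0 := pow_ne_zero _ (neg_ne_zero.2 hh0)
    have hp : (⟨gapPoly m (c 0 0), gapPoly m (c 1 0)⟩ : QuadraticAlgebra k[X] h X) ≠ 0 := by
      intro hp
      rw [hp, QuadraticAlgebra.norm_zero] at h2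
      exact mul_ne_zero hr0 hω0 h2.symm
    obtain ⟨-, t', s', hs', hpd⟩ := natDegree_norm_gapPoly hd hd0 hI hp
    rw [h2, natDegree_mul hr0 hω0, natDegree_pow, natDegree_neg, hd, hrd] at hpd
    have h3 : (s' : ℤ) - s = m * (2 * (t + d - t') + 1) := by
      zify at hpd
      linear_combination -hpd
    have h4 : |(s' : ℤ) - s| < m := by rw [abs_lt]; omega
    rw [h3, abs_mul] at h4
    have h5 : 1 ≤ |2 * ((t : ℤ) + d - t') + 1| := Int.one_le_abs (by omega)
    have h6 : (m : ℤ) ≤ |(m : ℤ)| := le_abs_self _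
    nlinarith [abs_nonneg (m : ℤ)]
  have h2 : (⟨gapPoly m (c 0 0), gapPoly m (c 1 0)⟩ : QuadraticAlgebra k[X] h X) = 0 := by
    rwa [h1, zero_mul, add_zero] at hz
  funext ε δ
  have e00 := eq_zero_of_gapPoly_eq_zero hIm (congr_arg QuadraticAlgebra.re h2)
  have e10 := eq_zero_of_gapPoly_eq_zero hIm (congr_arg QuadraticAlgebra.im h2)
  have e01 := eq_zero_of_gapPoly_eq_zero hIm (congr_arg QuadraticAlgebra.re h1)
  have e11 := eq_zero_of_gapPoly_eq_zero hIm (congr_arg QuadraticAlgebra.im h1)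
  fin_cases ε <;> fin_cases δ <;> assumption

variable [CharP k 2]

lemma omega_pow_two_pow {h : k[X]} {d : ℕ} (hd : h.natDegree = 2 * d + 1)
    (hd0 : 0 < d) (μ : ℕ) :
    ∃ A : k[X], 2 * A.natDegree ≤ (2 * d + 1) * 2 ^ μ ∧
      (ω : QuadraticAlgebra k[X] h X) ^ 2 ^ μ = ⟨A, X ^ (2 ^ μ - 1)⟩ := by
  induction μ with
  | zero => exact ⟨0, by simp, by simp; rfl⟩
  | succ μ ih =>
    obtain ⟨A, hA, hω⟩ := ih
    have h1 : 1 ≤ 2 ^ μ := Nat.one_le_two_pow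
    refine ⟨A ^ 2 + h * X ^ (2 * (2 ^ μ - 1)), ?_, ?_⟩
    · have h2 : (h * X ^ (2 * (2 ^ μ - 1))).natDegree ≤ 2 * d + 1 + 2 * (2 ^ μ - 1) := by
        refine natDegree_mul_le.trans ?_
        rw [hd, natDegree_X_pow]
      have h3 : (A ^ 2).natDegree ≤ 2 * A.natDegree := natDegree_pow_le
      have h4 := natDegree_add_le (A ^ 2) (h * X ^ (2 * (2 ^ μ - 1)))
      obtain ⟨w, hw⟩ := Nat.exists_eq_add_of_le h1
      obtain ⟨e, rfl⟩ := Nat.exists_eq_add_of_le (Nat.succ_le_of_lt hd0)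
      rw [pow_succ (2 : ℕ) μ]
      rw [hw] at hA h2 h4 ⊢
      simp only [Nat.add_sub_cancel_left] at h2 h4 ⊢
      rcases le_max_iff.1 h4 with h4 | h4 <;> nlinarith [Nat.zero_le (e * w)]
    · rw [pow_succ, pow_mul, hω, sq]
      have h2 : (2 : k[X]) = 0 := CharTwo.two_eq_zero
      ext1
      · rw [re_mul]
        simp only
        ring
      · rw [im_mul]
        simp only
        rw [show 2 ^ μ * 2 - 1 = 1 + (2 ^ μ - 1) + (2 ^ μ - 1) by omega]
        linear_combination A * X ^ (2 ^ μ - 1) * h2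

lemma natDegree_omega_pow {h : k[X]} {d : ℕ} (hd : h.natDegree = 2 * d + 1) (hd0 : 0 < d) (μ : ℕ)
    (ε δ : Fin 2) :
    ((ω : QuadraticAlgebra k[X] h X) ^ ((ε : ℕ) * 2 ^ (μ + 1) + δ)).re.natDegree ≤
        (2 * d + 1) * (2 ^ μ + 1) ∧
      ((ω : QuadraticAlgebra k[X] h X) ^ ((ε : ℕ) * 2 ^ (μ + 1) + δ)).im.natDegree ≤
        (2 * d + 1) * (2 ^ μ + 1) := by
  obtain ⟨A, hA, hω⟩ := omega_pow_two_pow hd hd0 (μ + 1)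
  have h1 : 1 ≤ 2 ^ μ := Nat.one_le_two_pow
  obtain ⟨w, hw⟩ := Nat.exists_eq_add_of_le h1
  obtain ⟨e, rfl⟩ := Nat.exists_eq_add_of_le (Nat.succ_le_of_lt hd0)
  rw [pow_succ (2 : ℕ) μ] at hA hω ⊢
  rw [hw] at hA hω ⊢
  rw [show (1 + w) * 2 - 1 = 1 + 2 * w by omega] at hω
  have hw0 := Nat.zero_le (e * w)
  fin_cases ε <;> fin_cases δ <;>
    simp only [zero_mul, zero_add, add_zero,
      one_mul, pow_zero, pow_one, pow_succ _ ((1 + w) * 2), hω, omega_re, omega_im, re_mul, im_mul,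
      re_one, im_one, natDegree_zero, natDegree_one, mul_zero, mul_one]
  · simp
  · simp
  · refine ⟨by nlinarith, ?_⟩
    rw [natDegree_X_pow]
    nlinarith
  · constructor
    · refine natDegree_mul_le.trans ?_
      rw [hd, natDegree_X_pow]
      nlinarith
    · refine (natDegree_add_le _ _).trans (max_le (by nlinarith) ?_)
      rw [← pow_succ', natDegree_X_pow]
      nlinarith

/-- Evaluation at a point of the curve `y ^ 2 = h x + x * y`. -/
noncomputable def evalPoint (h : k[X]) (v y : k) (hy : y ^ 2 = h.eval v + v * y) :
    QuadraticAlgebra k[X] h X →+* k where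
  toFun z := z.re.eval v + z.im.eval v * y
  map_one' := by simp
  map_mul' z w := by
    simp only [re_mul, im_mul, eval_add, eval_mul, eval_X]
    linear_combination (-eval v z.im * eval v w.im) * hy
  map_zero' := by simp
  map_add' z w := by
    simp only [re_add, im_add, eval_add]
    ring

lemma evalPoint_omega (h : k[X]) (v y : k) (hy : y ^ 2 = h.eval v + v * y) :
    evalPoint h v y hy ω = y := by
  simp [evalPoint]

lemma evalPoint_smul (h : k[X]) (v y : k) (hy : y ^ 2 = h.eval v + v * y) (p : k[X])
    (z : QuadraticAlgebra k[X] h X) :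
    evalPoint h v y hy (p • z) = p.eval v * evalPoint h v y hy z := by
  simp [evalPoint]
  ring

lemma natDegree_gapPoly_le (m : ℕ) {I J : ℕ} (c : Fin I → Fin J → k) :
    (gapPoly m c).natDegree ≤ (I - 1) + (J - 1) * m := by
  by_cases h : gapPoly m c = 0
  · simp [h]
  · obtain ⟨i, hi, j, hj, h⟩ := exists_natDegree_gapPoly h
    rw [h]
    exact Nat.add_le_add (by omega) (Nat.mul_le_mul_right _ (by omega))

lemma gapPoly_add (m : ℕ) {I J : ℕ} (c c' : Fin I → Fin J → k) :
    gapPoly m (c + c') = gapPoly m c + gapPoly m c' := by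
  simp [gapPoly, Finset.sum_add_distrib]

lemma gapPoly_smul (m : ℕ) {I J : ℕ} (r : k) (c : Fin I → Fin J → k) :
    gapPoly m (r • c) = r • gapPoly m c := by
  simp [gapPoly, Finset.smul_sum, smul_monomial]

lemma eval_gapPoly (m : ℕ) {I J : ℕ} (c : Fin I → Fin J → k) (v : k) :
    (gapPoly m c).eval v = ∑ i : Fin I, ∑ j : Fin J, c i j * v ^ ((i : ℕ) + j * m) := by
  simp [gapPoly, eval_finsetSum]

/-- A combination of the elements `X ^ (j + i * m) * ω ^ (ε * m + δ)`. -/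
noncomputable def frobeniusCombination (h : k[X]) (m : ℕ) {I J : ℕ}
    (c : Fin 2 → Fin 2 → Fin I → Fin J → k) : QuadraticAlgebra k[X] h X :=
  ∑ ε : Fin 2, ∑ δ : Fin 2,
    gapPoly m (fun j i ↦ c ε δ i j) • ω ^ ((ε : ℕ) * m + δ)

/-- The coefficients of the two components of `frobeniusCombination`. -/
noncomputable def frobeniusCoeffs (h : k[X]) (m I J n : ℕ) :
    (Fin 2 → Fin 2 → Fin I → Fin J → k) →ₗ[k] (Fin n → k) × (Fin n → k) where
  toFun c := (fun t ↦ (frobeniusCombination h m c).re.coeff t,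
    fun t ↦ (frobeniusCombination h m c).im.coeff t)
  map_add' c c' := by
    have : frobeniusCombination h m (c + c') =
        frobeniusCombination h m c + frobeniusCombination h m c' := by
      simp only [frobeniusCombination, ← Finset.sum_add_distrib, ← add_smul, ← gapPoly_add]
      rfl
    rw [this]
    ext <;> simp
  map_smul' r c := by
    have : frobeniusCombination h m (r • c) = r • frobeniusCombination h m c := by
      simp only [frobeniusCombination, Finset.smul_sum, ← smul_assoc, ← gapPoly_smul]
      rfl
    rw [this]
    ext <;> simp

lemma natDegree_smul_omega_le {h p : k[X]} {z : QuadraticAlgebra k[X] h X} {a b : ℕ}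
    (hp : p.natDegree ≤ a) (hz : z.re.natDegree ≤ b ∧ z.im.natDegree ≤ b) :
    (p • z).re.natDegree ≤ a + b ∧ (p • z).im.natDegree ≤ a + b := by
  rw [re_smul, im_smul, smul_eq_mul, smul_eq_mul]
  exact ⟨natDegree_mul_le.trans (Nat.add_le_add hp hz.1),
    natDegree_mul_le.trans (Nat.add_le_add hp hz.2)⟩

lemma natDegree_sum_sum_le {h : k[X]} {f : Fin 2 → Fin 2 → QuadraticAlgebra k[X] h X} {n : ℕ}
    (hf : ∀ ε δ, (f ε δ).re.natDegree ≤ n ∧ (f ε δ).im.natDegree ≤ n) :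
    (∑ ε, ∑ δ, f ε δ).re.natDegree ≤ n ∧ (∑ ε, ∑ δ, f ε δ).im.natDegree ≤ n := by
  simp only [Fin.sum_univ_two, re_add, im_add]
  constructor <;> refine (natDegree_add_le _ _).trans (max_le ((natDegree_add_le _ _).trans
    (max_le ?_ ?_)) ((natDegree_add_le _ _).trans (max_le ?_ ?_)))
  exacts [(hf 0 0).1, (hf 0 1).1, (hf 1 0).1, (hf 1 1).1, (hf 0 0).2, (hf 0 1).2, (hf 1 0).2,
    (hf 1 1).2]

lemma exists_frobeniusCombination_eq_zero {h : k[X]} {d : ℕ} (hd : h.natDegree = 2 * d + 1)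
    (hd0 : 0 < d) {a b : ℕ} (hab : a ≤ b) (ha : 2 * d + 1 < 2 ^ a) :
    ∃ c : Fin 2 → Fin 2 → Fin (2 ^ b - d) → Fin (2 ^ a + (2 * d + 1)) → k, c ≠ 0 ∧
      frobeniusCombination h (2 ^ (a + 1)) c = 0 := by
  obtain ⟨n, hn⟩ : ∃ n, n = (2 ^ a + (2 * d + 1) - 1 + (2 ^ b - d - 1) * 2 ^ (a + 1)) +
    (2 * d + 1) * (2 ^ a + 1) + 1 := ⟨_, rfl⟩
  have hker := LinearMap.ker_ne_bot_of_finrank_lt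
    (f := frobeniusCoeffs h (2 ^ (a + 1)) (2 ^ b - d) (2 ^ a + (2 * d + 1)) n) (by
      simp only [Module.finrank_prod, Module.finrank_pi_fintype, Module.finrank_self,
        Finset.sum_const, Finset.card_univ, Fintype.card_fin, smul_eq_mul, mul_one]
      have hab' : 2 ^ a ≤ 2 ^ b := Nat.pow_le_pow_right (by norm_num) hab
      obtain ⟨I, hI⟩ := Nat.exists_eq_add_of_le (show d + 1 ≤ 2 ^ b by omega)
      obtain ⟨w, hw⟩ := Nat.exists_eq_add_of_lt ha
      rw [hn, pow_succ (2 : ℕ) a, show 2 ^ b - d = I + 1 by omega]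
      rw [show 2 ^ a + (2 * d + 1) - 1 = 2 ^ a + 2 * d by omega, Nat.add_sub_cancel]
      have hwI : d + 1 + w + 1 ≤ I + 1 := by omega
      rw [hw]
      obtain ⟨I', rfl⟩ := Nat.exists_eq_add_of_le (show d + 1 + w ≤ I by omega)
      ring_nf
      nlinarith [Nat.zero_le (I' * d), Nat.zero_le (w * d)])
  obtain ⟨c, hc, hc0⟩ := Submodule.exists_mem_ne_zero_of_ne_bot hker
  refine ⟨c, hc0, ?_⟩
  have hdeg : (frobeniusCombination h (2 ^ (a + 1)) c).re.natDegree < n ∧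
      (frobeniusCombination h (2 ^ (a + 1)) c).im.natDegree < n := by
    rw [hn, Nat.lt_succ_iff, Nat.lt_succ_iff]
    exact natDegree_sum_sum_le fun ε δ ↦ natDegree_smul_omega_le (natDegree_gapPoly_le _ _)
      (natDegree_omega_pow hd hd0 a ε δ)
  have hz : ∀ p : k[X], p.natDegree < n → (∀ t : Fin n, p.coeff t = 0) → p = 0 := by
    intro p hp h0
    ext t
    by_cases ht : t < n
    · exact h0 ⟨t, ht⟩
    · rw [coeff_eq_zero_of_natDegree_lt (by omega), coeff_zero]
  have hc' : frobeniusCoeffs h (2 ^ (a + 1)) _ _ n c = 0 := hc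
  ext1
  · exact hz _ hdeg.1 fun t ↦ congr_fun (congr_arg Prod.fst hc') t
  · exact hz _ hdeg.2 fun t ↦ congr_fun (congr_arg Prod.snd hc') t

/-- Stepanov's bound for the number of points of a hyperelliptic curve in characteristic two. -/
theorem card_points_le [Fintype k] [DecidableEq k] {h : k[X]} {d : ℕ}
    (hd : h.natDegree = 2 * d + 1) (hd0 : 0 < d) {a b : ℕ} (hab : a ≤ b) (ha : 2 * d + 1 < 2 ^ a)
    (hcard : Fintype.card k = 2 ^ (a + 1) * 2 ^ (b + 1)) :
    (Finset.univ.filter fun v : k ↦ v ≠ 0 ∧ ∃ y, y ^ 2 = h.eval v + v * y).card ≤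
      2 * 2 ^ a * 2 ^ b + (8 * d + 3) * 2 ^ b := by
  have h2 : (2 : k) = 0 := CharTwo.two_eq_zero
  obtain ⟨c, hc0, hc⟩ := exists_frobeniusCombination_eq_zero hd hd0 hab ha
  have hab' : 2 ^ a ≤ 2 ^ b := Nat.pow_le_pow_right (by norm_num) hab
  let e : Fin 2 → Fin 2 → Fin (2 ^ b - d) → Fin (2 ^ a + (2 * d + 1)) → k :=
    fun ε δ i j ↦ c ε δ i j ^ 2 ^ (b + 1)
  let G : QuadraticAlgebra k[X] h X := ∑ ε : Fin 2, ∑ δ : Fin 2,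
    gapPoly (2 ^ (b + 1)) (e δ ε) • ω ^ ((ε : ℕ) * 2 ^ (b + 1) + δ)
  have hG0 : G ≠ 0 := by
    intro hG
    apply hc0
    have he : e = 0 := by
      refine eq_zero_of_gapPoly_add_eq_zero (m := 2 ^ (b + 1)) hd hd0 (by rw [pow_succ]; omega) ?_
      rw [← hG]
      simp only [G, Fin.sum_univ_two, Fin.val_zero, Fin.val_one, zero_mul, zero_add, add_zero,
        one_mul, pow_zero, pow_succ ω, mk_eq_add_smul_omega]
      simp only [Algebra.algebraMap_eq_smul_one, add_mul, smul_mul_assoc, one_mul]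
      rw [mul_comm ω]
    funext ε δ i j
    have := congr_fun (congr_fun (congr_fun (congr_fun he ε) δ) i) j
    exact eq_zero_of_pow_eq_zero this
  have hev : ∀ v y (hy : y ^ 2 = h.eval v + v * y), evalPoint h v y hy G = 0 := by
    intro v y hy
    have h1 : evalPoint h v y hy G ^ 2 ^ (a + 1) =
        evalPoint h v y hy (frobeniusCombination h (2 ^ (a + 1)) c) := by
      simp only [G, frobeniusCombination, map_sum, evalPoint_smul, map_pow, evalPoint_omega,
        eval_gapPoly]
      have hQ : ∀ x : k, (x ^ 2 ^ (b + 1)) ^ 2 ^ (a + 1) = x := fun x ↦ by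
        rw [← pow_mul, mul_comm, ← hcard, FiniteField.pow_card]
      have hQ' : ∀ (x : k) (i j : ℕ), (x ^ (i + j * 2 ^ (b + 1))) ^ 2 ^ (a + 1) =
          x ^ (j + i * 2 ^ (a + 1)) := fun x i j ↦ by
        rw [pow_add x i, mul_pow, pow_mul x j, hQ, ← pow_mul, ← pow_add, add_comm _ j]
      simp only [sum_pow_char_pow, mul_pow]
      rw [Finset.sum_comm]
      refine Finset.sum_congr rfl fun ε _ ↦ Finset.sum_congr rfl fun δ _ ↦ ?_
      rw [add_comm ((δ : ℕ) * 2 ^ (b + 1)), hQ', add_comm (δ : ℕ), Finset.sum_comm]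
      congr 1
      refine Finset.sum_congr rfl fun j _ ↦ Finset.sum_congr rfl fun i _ ↦ ?_
      rw [hQ', hQ]
    rw [hc, map_zero] at h1
    exact eq_zero_of_pow_eq_zero h1
  have hroot : ∀ v ≠ 0, (∃ y, y ^ 2 = h.eval v + v * y) → G.re.eval v = 0 ∧ G.im.eval v = 0 := by
    rintro v hv ⟨y, hy⟩
    have h3 := hev v y hy
    have h4 := hev v (y + v) (by linear_combination hy + v * y * h2)
    simp only [evalPoint, RingHom.coe_mk, MonoidHom.coe_mk, OneHom.coe_mk] at h3 h4
    have h5 : G.im.eval v * v = 0 := by linear_combination h4 - h3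
    have h6 := (mul_eq_zero.1 h5).resolve_right hv
    rw [h6, zero_mul, add_zero] at h3
    exact ⟨h3, h6⟩
  have hdeg : G.re.natDegree ≤ 2 * 2 ^ a * 2 ^ b + (8 * d + 3) * 2 ^ b ∧
      G.im.natDegree ≤ 2 * 2 ^ a * 2 ^ b + (8 * d + 3) * 2 ^ b := by
    have h3 := natDegree_sum_sum_le (f := fun ε δ ↦ gapPoly (2 ^ (b + 1)) (e δ ε) •
      (ω : QuadraticAlgebra k[X] h X) ^ ((ε : ℕ) * 2 ^ (b + 1) + δ)) fun ε δ ↦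
        natDegree_smul_omega_le (natDegree_gapPoly_le (2 ^ (b + 1)) (e δ ε))
          (natDegree_omega_pow hd hd0 b ε δ)
    have h4 : (2 ^ b - d - 1) + (2 ^ a + (2 * d + 1) - 1) * 2 ^ (b + 1) +
        (2 * d + 1) * (2 ^ b + 1) ≤ 2 * 2 ^ a * 2 ^ b + (8 * d + 3) * 2 ^ b := by
      rw [show 2 ^ a + (2 * d + 1) - 1 = 2 ^ a + 2 * d by omega, pow_succ (2 : ℕ) b]
      have h5 : 2 ^ b - d - 1 ≤ 2 ^ b := by omega
      have h6 : 1 ≤ 2 ^ b := Nat.one_le_two_pow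
      nlinarith
    exact ⟨h3.1.trans h4, h3.2.trans h4⟩
  have hle : ∀ p : k[X], p ≠ 0 → p.natDegree ≤ 2 * 2 ^ a * 2 ^ b + (8 * d + 3) * 2 ^ b →
      (∀ v ≠ 0, (∃ y, y ^ 2 = h.eval v + v * y) → p.eval v = 0) →
      (Finset.univ.filter fun v : k ↦ v ≠ 0 ∧ ∃ y, y ^ 2 = h.eval v + v * y).card ≤
      2 * 2 ^ a * 2 ^ b + (8 * d + 3) * 2 ^ b := by
    intro p hp0 hpd hp
    refine (card_le_degree_of_subset_roots fun v hv ↦ ?_).trans hpd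
    rw [mem_roots hp0]
    have hv' := (Finset.mem_filter.1 (show v ∈ Finset.univ.filter _ from hv)).2
    exact hp v hv'.1 hv'.2
  by_cases hre : G.re = 0
  · refine hle G.im (fun him ↦ hG0 (QuadraticAlgebra.ext hre him)) hdeg.2 fun v hv hy ↦
      (hroot v hv hy).2
  · exact hle G.re hre hdeg.1 fun v hv hy ↦ (hroot v hv hy).1

end PointCount

section WeilBound

open Polynomial

variable {k : Type*} [Field k] [Algebra (ZMod 2) k] [Fintype k] [DecidableEq k]

/-- The character sum of the Laurent polynomial `μ * (v ^ e + v⁻¹)`. -/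
noncomputable def laurentSum (μ : k) (e : ℕ) : ℤ :=
  ∑ v : k with v ≠ 0, traceSign (μ * (v ^ e + v⁻¹))

lemma abs_laurentSum_le_card (μ : k) (e : ℕ) : |laurentSum μ e| ≤ Fintype.card k := by
  refine (Finset.abs_sum_le_sum_abs _ _).trans ?_
  refine (Finset.sum_le_card_nsmul _ _ 1 fun v _ ↦ ?_).trans ?_
  · rcases traceSign_eq_one_or (μ * (v ^ e + v⁻¹)) with h | h <;> simp [h]
  · simp only [nsmul_eq_mul, mul_one, Nat.cast_le]
    exact Finset.card_filter_le _ _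

variable [CharP k 2]

lemma exists_point_iff {μ c v : k} (hv : v ≠ 0) (e : ℕ) :
    (∃ y, y ^ 2 = (C μ * (X ^ (e + 2) + X) + C c * X ^ 2).eval v + v * y) ↔
      traceSign (μ * (v ^ e + v⁻¹) + c) = 1 := by
  have h2 : (2 : k) = 0 := CharTwo.two_eq_zero
  rw [traceSign_eq_one_iff]
  simp only [eval_add, eval_mul, eval_C, eval_pow, eval_X]
  constructor
  · rintro ⟨y, hy⟩
    refine ⟨y / v, ?_⟩
    field_simp
    linear_combination hy + v * y * h2
  · rintro ⟨w, hw⟩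
    refine ⟨w * v, ?_⟩
    have h3 : μ * (v ^ e + v⁻¹) * v ^ 2 = μ * (v ^ (e + 2) + v) := by
      field_simp
      ring
    linear_combination v ^ 2 * hw + h3 - v ^ 2 * w * h2

lemma laurentSum_add_card_le {μ c : k} (hμ : μ ≠ 0) {t a b : ℕ} (hab : a ≤ b)
    (ha : 2 * (t + 1) + 1 < 2 ^ a) (hcard : Fintype.card k = 2 ^ (a + 1) * 2 ^ (b + 1)) :
    traceSign c * laurentSum μ (2 * t + 1) ≤ 2 * (8 * (t + 1) + 3) * 2 ^ b + 1 := by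
  have hdeg : (C μ * (X ^ (2 * t + 1 + 2) + X) + C c * X ^ 2).natDegree = 2 * (t + 1) + 1 := by
    compute_degree!
    · simp [hμ, mul_add]
    · omega
  have h1 := card_points_le hdeg (by omega) hab ha hcard
  have h3 : ∑ v : k with v ≠ 0, (1 + traceSign (μ * (v ^ (2 * t + 1) + v⁻¹) + c)) =
      2 * ((Finset.univ.filter fun v : k ↦ v ≠ 0 ∧ ∃ y, y ^ 2 =
        (C μ * (X ^ (2 * t + 1 + 2) + X) + C c * X ^ 2).eval v + v * y).card : ℤ) := by
    rw [← Finset.filter_filter, Finset.card_filter, Nat.cast_sum, Finset.mul_sum]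
    refine Finset.sum_congr rfl fun v hv ↦ ?_
    simp only [exists_point_iff (Finset.mem_filter.1 hv).2]
    rcases traceSign_eq_one_or (μ * (v ^ (2 * t + 1) + v⁻¹) + c) with h | h <;> simp [h]
  have h4 : ((Finset.univ.filter fun v : k ↦ v ≠ 0).card : ℤ) = Fintype.card k - 1 := by
    rw [Finset.filter_ne', Finset.card_erase_of_mem (Finset.mem_univ _), Finset.card_univ,
      Nat.cast_sub Fintype.card_pos, Nat.cast_one]
  have h5 : ∑ v : k with v ≠ 0, (1 + traceSign (μ * (v ^ (2 * t + 1) + v⁻¹) + c)) =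
      Fintype.card k - 1 + traceSign c * laurentSum μ (2 * t + 1) := by
    rw [Finset.sum_add_distrib, Finset.sum_const, nsmul_eq_mul, mul_one, h4, laurentSum,
      Finset.mul_sum]
    congr 1
    exact Finset.sum_congr rfl fun v _ ↦ by rw [traceSign_add, mul_comm]
  rw [hcard, h3] at h5
  push_cast [pow_succ 2 a, pow_succ 2 b] at h5
  zify at h1
  linarith

/-- A weak form of Weil's bound, with a square-root saving. -/
theorem laurentSum_sq_le {μ : k} (hμ : μ ≠ 0) {t : ℕ} (ht : t ≤ 1) :
    laurentSum μ (2 * t + 1) ^ 2 ≤ 1521 * Fintype.card k := by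
  obtain ⟨n, -, hn⟩ := FiniteField.card k 2
  rcases lt_or_ge (n : ℕ) 9 with h9 | h9
  · have h1 := abs_laurentSum_le_card μ (2 * t + 1)
    have h2 : (Fintype.card k : ℤ) ≤ 256 := by
      rw [hn]
      exact_mod_cast Nat.pow_le_pow_right (n := 2) (by norm_num) (show (n : ℕ) ≤ 8 by omega)
    rw [← sq_abs]
    nlinarith [abs_nonneg (laurentSum μ (2 * t + 1))]
  · obtain ⟨a, b, hab, hba, hab'⟩ : ∃ a b : ℕ, a ≤ b ∧ b ≤ a + 1 ∧ (n : ℕ) = a + 1 + (b + 1) :=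
      ⟨(n - 2) / 2, n - 2 - (n - 2) / 2, by omega, by omega, by omega⟩
    have ha : 2 * (t + 1) + 1 < 2 ^ a :=
      lt_of_lt_of_le (by omega : _ < 2 ^ 3) (Nat.pow_le_pow_right (by norm_num) (by omega))
    have hcard : Fintype.card k = 2 ^ (a + 1) * 2 ^ (b + 1) := by rw [hn, hab', pow_add]
    obtain ⟨c, hc⟩ := exists_traceSign_eq_neg_one (F := k)
    have h1 := laurentSum_add_card_le (c := 0) hμ hab ha hcard
    have h2 := laurentSum_add_card_le (c := c) hμ hab ha hcard
    rw [traceSign_zero, one_mul] at h1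
    rw [hc] at h2
    have hb1 : (1 : ℤ) ≤ 2 ^ b := one_le_pow₀ (by norm_num)
    have ht' : (t : ℤ) ≤ 1 := by exact_mod_cast ht
    have h3 : |laurentSum μ (2 * t + 1)| ≤ 39 * 2 ^ b := by
      rw [abs_le]
      constructor <;> nlinarith
    have h4 : ((2 : ℤ) ^ b) ^ 2 ≤ Fintype.card k := by
      rw [hcard, ← pow_add, ← pow_mul]
      push_cast
      exact pow_le_pow_right₀ (by norm_num) (by omega)
    rw [← sq_abs]
    nlinarith [abs_nonneg (laurentSum μ (2 * t + 1))]

end WeilBound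

section ConjPoly

open Polynomial

variable (K : Type*) {L : Type*} [Field K] [Field L] [Algebra K L] [FiniteDimensional K L]
  [IsGalois K L]

lemma exists_map_eq_prod_conj (v : L) :
    ∃ f : K[X], f.map (algebraMap K L) = ∏ g : Gal(L/K), (X - C (g v)) := by
  obtain ⟨f, hf⟩ := Algebra.IsInvariant.charpoly_mem_lifts K L Gal(L/K) v
  exact ⟨f, hf⟩

/-- The characteristic polynomial of an element of a finite Galois extension. -/
noncomputable def conjPoly (v : L) : K[X] := (exists_map_eq_prod_conj K v).choose

lemma map_conjPoly (v : L) :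
    (conjPoly K v).map (algebraMap K L) = ∏ g : Gal(L/K), (X - C (g v)) :=
  (exists_map_eq_prod_conj K v).choose_spec

lemma monic_conjPoly (v : L) : (conjPoly K v).Monic := by
  refine monic_of_injective (algebraMap K L).injective ?_
  rw [map_conjPoly]
  exact monic_prod_of_monic _ _ fun g _ ↦ monic_X_sub_C _

lemma natDegree_conjPoly (v : L) : (conjPoly K v).natDegree = Module.finrank K L := by
  rw [← natDegree_map (algebraMap K L), map_conjPoly,
    natDegree_prod_of_monic _ _ fun g _ ↦ monic_X_sub_C _]
  simp [← IsGalois.card_aut_eq_finrank K L, Nat.card_eq_fintype_card]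

lemma exists_conjPoly_eq_pow (v : L) :
    ∃ s, conjPoly K v = minpoly K v ^ s ∧ s * (minpoly K v).natDegree = Module.finrank K L := by
  have hint : IsIntegral K v := Algebra.IsIntegral.isIntegral v
  have hdvd : conjPoly K v ∣ minpoly K v ^ (Finset.univ : Finset Gal(L/K)).card := by
    rw [← map_dvd_map' (algebraMap K L), map_conjPoly, Polynomial.map_pow, ← Finset.prod_const]
    refine Finset.prod_dvd_prod_of_dvd _ _ fun g _ ↦ ?_
    rw [dvd_iff_isRoot, IsRoot, eval_map_algebraMap, ← minpoly.algEquiv_eq g v]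
    exact minpoly.aeval K (g v)
  obtain ⟨s, -, hs⟩ := (dvd_prime_pow (minpoly.prime hint) _).1 hdvd
  have hs' := eq_of_monic_of_associated (monic_conjPoly K v) ((minpoly.monic hint).pow s) hs
  refine ⟨s, hs', ?_⟩
  rw [← natDegree_conjPoly K v, hs', natDegree_pow]

variable {K}

lemma conjPoly_dvd_mul_and_not_dvd_iff {P g : K[X]} (hP : Irreducible P) (hPm : P.Monic)
    (hg : g ≠ 0) (v : L) :
    (conjPoly K v ∣ P * g ∧ ¬ conjPoly K v ∣ g) ↔
      minpoly K v = P ∧ Module.finrank K L = (multiplicity P g + 1) * P.natDegree := by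
  have hint : IsIntegral K v := Algebra.IsIntegral.isIntegral v
  have hfin : FiniteMultiplicity P g := FiniteMultiplicity.of_not_isUnit hP.not_isUnit hg
  obtain ⟨s, hs, hd⟩ := exists_conjPoly_eq_pow K v
  rw [hs]
  constructor
  · rintro ⟨h1, h2⟩
    have hQ : minpoly K v = P := by
      by_contra hne
      refine h2 ((IsCoprime.pow_left ?_).dvd_of_dvd_mul_left h1)
      rw [(minpoly.irreducible hint).coprime_iff_not_dvd]
      intro h
      exact hne (eq_of_monic_of_associated (minpoly.monic hint) hPm
        ((minpoly.irreducible hint).associated_of_dvd hP h))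
    refine ⟨hQ, ?_⟩
    rw [hQ] at h1 h2 hd
    rw [← hd]
    congr 1
    obtain ⟨t, rfl⟩ : ∃ t, s = t + 1 := Nat.exists_eq_succ_of_ne_zero (by
      rintro rfl
      simp at h2)
    rw [pow_succ', mul_dvd_mul_iff_left hP.ne_zero, hfin.pow_dvd_iff_le_multiplicity] at h1
    rw [hfin.pow_dvd_iff_le_multiplicity] at h2
    omega
  · rintro ⟨rfl, h⟩
    have : s = multiplicity (minpoly K v) g + 1 := by
      rw [h] at hd
      exact Nat.eq_of_mul_eq_mul_right hP.natDegree_pos hd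
    rw [this]
    refine ⟨?_, hfin.not_pow_dvd_of_multiplicity_lt (Nat.lt_succ_self _)⟩
    rw [pow_succ']
    exact mul_dvd_mul_left _ (pow_multiplicity_dvd _ _)

end ConjPoly

section Extension

open Polynomial

variable {K : Type*} [Field K] [Finite K] (p : ℕ) [Fact p.Prime] [CharP K p]

open FiniteField

noncomputable instance (n : ℕ) : Fintype (Extension K p n) := Fintype.ofFinite _

open Classical in
lemma card_minpoly_eq {P : K[X]} (hP : Irreducible P) (hPm : P.Monic) (n : ℕ) [NeZero n]
    (hn : P.natDegree ∣ n) :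
    (Finset.univ.filter fun v : Extension K p n ↦ minpoly K v = P).card = P.natDegree := by
  have hsplit : (P.map (algebraMap K (Extension K p n))).Splits := by
    have hdvd := map_dvd (mapRingHom (algebraMap K (Extension K p n)))
      (hP.natDegree_dvd_iff_dvd_X_pow_card_pow_sub_X.1 hn)
    refine Splits.of_dvd ?_ ?_ hdvd
    · exact IsSplittingField.splits _ _
    · exact Polynomial.map_ne_zero
        (X_pow_card_pow_sub_X_ne_zero _ (NeZero.ne n) Finite.one_lt_card)
  have hsep : P.Separable := PerfectField.separable_of_irreducible hP
  rw [← card_rootSet_eq_natDegree hsep hsplit, ← Set.toFinset_card]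
  congr 1
  ext v
  rw [Finset.mem_filter, Set.mem_toFinset, mem_rootSet]
  constructor
  · rintro ⟨-, rfl⟩
    exact ⟨hP.ne_zero, minpoly.aeval K v⟩
  · rintro ⟨-, h⟩
    exact ⟨Finset.mem_univ _, (minpoly.eq_of_irreducible_of_monic hP h hPm).symm⟩

open Classical in
/-- A monic polynomial of degree `n` over a finite field is divisible by the characteristic
polynomials of exactly `n` elements of extensions. -/
theorem sum_card_conjPoly_dvd (N : ℕ) (g : K[X]) (hg : g.Monic) (hN : g.natDegree ≤ N) :
    ∑ j ∈ Finset.range N, (Finset.univ.filter fun v : Extension K p (j + 1) ↦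
      conjPoly K v ∣ g).card = g.natDegree := by
  obtain ⟨n, hn⟩ : ∃ n, n = g.natDegree := ⟨_, rfl⟩
  induction n using Nat.strong_induction_on generalizing g with
  | _ n ih =>
  subst hn
  rcases Nat.eq_zero_or_pos g.natDegree with h0 | h0
  · rw [h0]
    refine Finset.sum_eq_zero fun j _ ↦ ?_
    rw [Finset.card_eq_zero, Finset.filter_eq_empty_iff]
    intro v _ hv
    have h1 := natDegree_le_of_dvd hv hg.ne_zero
    rw [natDegree_conjPoly, finrank_extension, h0] at h1
    omega
  · obtain ⟨P, hPm, hP, h, rfl⟩ := exists_monic_irreducible_factor g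
      (not_isUnit_of_natDegree_pos g h0)
    have hh : h.Monic := hPm.of_mul_monic_left hg
    have hdeg : (P * h).natDegree = P.natDegree + h.natDegree := hPm.natDegree_mul hh
    have hPpos := hP.natDegree_pos
    rw [hdeg, add_comm, ← ih h.natDegree (by omega) h hh (by omega) rfl]
    have hpow : (multiplicity P h + 1) * P.natDegree ≤ N := by
      rw [← natDegree_pow]
      refine (natDegree_le_of_dvd ?_ hg.ne_zero).trans hN
      rw [pow_succ']
      exact mul_dvd_mul_left _ (pow_multiplicity_dvd _ _)
    have hkey : ∀ j, (Finset.univ.filter fun v : Extension K p (j + 1) ↦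
        conjPoly K v ∣ P * h).card = (Finset.univ.filter fun v : Extension K p (j + 1) ↦
        conjPoly K v ∣ h).card + if j + 1 = (multiplicity P h + 1) * P.natDegree
          then P.natDegree else 0 := by
      intro j
      have h1 := Finset.card_filter_add_card_filter_not (s := Finset.univ.filter
        fun v : Extension K p (j + 1) ↦ conjPoly K v ∣ P * h) (fun v ↦ conjPoly K v ∣ h)
      rw [← h1, Finset.filter_filter, Finset.filter_filter]
      congr 2
      · ext v
        simpa using fun h2 ↦ h2.mul_left P
      · simp only [conjPoly_dvd_mul_and_not_dvd_iff hP hPm hh.ne_zero, finrank_extension]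
        split_ifs with h2
        · simp only [h2, and_true]
          simpa only [h2] using card_minpoly_eq p hP hPm (j + 1)
            (by rw [h2]; exact dvd_mul_left _ _)
        · simp [h2]
    simp only [hkey, Finset.sum_add_distrib]
    congr 1
    rw [Finset.sum_eq_single ((multiplicity P h + 1) * P.natDegree - 1)]
    · rw [if_pos]
      have : 0 < (multiplicity P h + 1) * P.natDegree := by positivity
      omega
    · intro j _ hj
      rw [if_neg]
      omega
    · intro hj
      have : 0 < (multiplicity P h + 1) * P.natDegree := by positivity
      rw [Finset.mem_range] at hj
      omega

end Extension

section Newton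

open Polynomial

variable {K : Type*} [Field K] [Fintype K]

/-- The monic polynomial with given non-leading coefficients. -/
noncomputable def monicOfCoeffs (n : ℕ) (c : Fin n → K) : K[X] :=
  X ^ n + ∑ i : Fin n, C (c i) * X ^ (i : ℕ)

lemma coeff_monicOfCoeffs (n : ℕ) (c : Fin n → K) (j : ℕ) :
    (monicOfCoeffs n c).coeff j =
      (if j = n then 1 else 0) + if h : j < n then c ⟨j, h⟩ else 0 := by
  simp only [monicOfCoeffs, coeff_add, coeff_X_pow, finsetSum_coeff, coeff_C_mul_X_pow]
  congr 1
  split_ifs with h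
  · rw [Finset.sum_eq_single ⟨j, h⟩ (fun i _ hi ↦ if_neg fun h1 ↦ hi (Fin.ext h1.symm))
      (by simp), if_pos rfl]
  · exact Finset.sum_eq_zero fun i _ ↦ if_neg (by omega)

lemma degree_sum_lt (n : ℕ) (c : Fin n → K) :
    (∑ i : Fin n, C (c i) * X ^ (i : ℕ)).degree < (n : WithBot ℕ) := by
  rw [degree_lt_iff_coeff_zero]
  intro j hj
  simp only [finsetSum_coeff, coeff_C_mul_X_pow]
  exact Finset.sum_eq_zero fun i _ ↦ if_neg (by omega)

lemma monic_monicOfCoeffs (n : ℕ) (c : Fin n → K) : (monicOfCoeffs n c).Monic :=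
  monic_X_pow_add (degree_sum_lt n c)

lemma natDegree_monicOfCoeffs (n : ℕ) (c : Fin n → K) : (monicOfCoeffs n c).natDegree = n := by
  refine natDegree_eq_of_degree_eq_some ?_
  rw [monicOfCoeffs, degree_add_eq_left_of_degree_lt, degree_X_pow]
  rw [degree_X_pow]
  exact degree_sum_lt n c

lemma monicOfCoeffs_coeff {n : ℕ} {f : K[X]} (hf : f.Monic) (hn : f.natDegree = n) :
    monicOfCoeffs n (fun i ↦ f.coeff i) = f := by
  ext j
  rw [coeff_monicOfCoeffs]
  rcases lt_trichotomy j n with h | rfl | h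
  · simp [h, h.ne]
  · simp [← hn, hf.coeff_natDegree]
  · rw [if_neg h.ne', dif_neg (by omega), coeff_eq_zero_of_natDegree_lt (by omega), add_zero]

lemma monicOfCoeffs_injective (n : ℕ) :
    Function.Injective (monicOfCoeffs n : (Fin n → K) → K[X]) := by
  intro c d h
  funext i
  have := congr_arg (fun f ↦ f.coeff i) h
  simpa [coeff_monicOfCoeffs, i.2.ne] using this

/-- The sum of a function over the monic polynomials of degree `n`. -/
noncomputable def monicSum (ψ : K[X] → ℤ) (n : ℕ) : ℤ := ∑ c : Fin n → K, ψ (monicOfCoeffs n c)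

lemma monicSum_zero {ψ : K[X] → ℤ} (h1 : ψ 1 = 1) : monicSum ψ 0 = 1 := by
  simp [monicSum, monicOfCoeffs, h1]

open Classical in
lemma sum_filter_dvd {ψ : K[X] → ℤ} (hψ : ∀ f g, f.Monic → g.Monic → ψ (f * g) = ψ f * ψ g)
    {f : K[X]} (hf : f.Monic) {j n : ℕ} (hj : f.natDegree = j) (hn : j ≤ n) :
    ∑ c : Fin n → K with f ∣ monicOfCoeffs n c, ψ (monicOfCoeffs n c) =
      ψ f * monicSum ψ (n - j) := by
  rw [monicSum, Finset.mul_sum]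
  have hdeg : ∀ d : Fin (n - j) → K, (f * monicOfCoeffs (n - j) d).natDegree = n := fun d ↦ by
    rw [hf.natDegree_mul (monic_monicOfCoeffs _ _), natDegree_monicOfCoeffs, hj]
    omega
  have hm : ∀ d : Fin (n - j) → K, monicOfCoeffs n
      (fun i ↦ (f * monicOfCoeffs (n - j) d).coeff i) = f * monicOfCoeffs (n - j) d := fun d ↦
    monicOfCoeffs_coeff (hf.mul (monic_monicOfCoeffs _ _)) (hdeg d)
  symm
  refine Finset.sum_bij (fun d _ i ↦ (f * monicOfCoeffs (n - j) d).coeff i) ?_ ?_ ?_ ?_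
  · intro d _
    rw [Finset.mem_filter, hm]
    exact ⟨Finset.mem_univ _, dvd_mul_right _ _⟩
  · intro d _ d' _ h
    have h1 := congr_arg (monicOfCoeffs n) h
    rw [hm, hm] at h1
    exact monicOfCoeffs_injective _ (mul_left_cancel₀ hf.ne_zero h1)
  · intro c hc
    obtain ⟨-, g, hg⟩ := Finset.mem_filter.1 hc
    have hgm : g.Monic := hf.of_mul_monic_left (hg ▸ monic_monicOfCoeffs n c)
    have hgd : g.natDegree = n - j := by
      have := congr_arg natDegree hg
      rw [natDegree_monicOfCoeffs, hf.natDegree_mul hgm, hj] at this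
      omega
    refine ⟨fun i ↦ g.coeff i, Finset.mem_univ _, monicOfCoeffs_injective n ?_⟩
    rw [hm, monicOfCoeffs_coeff hgm hgd, hg]
  · intro d _
    rw [hm, hψ _ _ hf (monic_monicOfCoeffs _ _)]

variable (p : ℕ) [Fact p.Prime] [CharP K p]

/-- Newton's identities for the `L`-function of a multiplicative function on monic polynomials. -/
theorem mul_monicSum {ψ : K[X] → ℤ} (hψ : ∀ f g, f.Monic → g.Monic → ψ (f * g) = ψ f * ψ g)
    (n : ℕ) : n * monicSum ψ n = ∑ j ∈ Finset.range n,
      (∑ v : FiniteField.Extension K p (j + 1), ψ (conjPoly K v)) * monicSum ψ (n - (j + 1)) := by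
  classical
  have h1 : ∀ c : Fin n → K, (n : ℤ) = ∑ j ∈ Finset.range n,
      ∑ v : FiniteField.Extension K p (j + 1),
        if conjPoly K v ∣ monicOfCoeffs n c then 1 else 0 := fun c ↦ by
    have h2 := sum_card_conjPoly_dvd p n (monicOfCoeffs n c) (monic_monicOfCoeffs n c)
      (natDegree_monicOfCoeffs n c).le
    rw [natDegree_monicOfCoeffs] at h2
    rw [← Nat.cast_inj (R := ℤ)] at h2
    push_cast [Finset.card_filter] at h2
    exact h2.symm
  calc n * monicSum ψ n = ∑ c : Fin n → K, (∑ j ∈ Finset.range n,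
      ∑ v : FiniteField.Extension K p (j + 1),
        if conjPoly K v ∣ monicOfCoeffs n c then 1 else 0) * ψ (monicOfCoeffs n c) := by
        rw [monicSum, Finset.mul_sum]
        exact Finset.sum_congr rfl fun c _ ↦ by rw [← h1 c]
    _ = ∑ j ∈ Finset.range n, ∑ v : FiniteField.Extension K p (j + 1),
        ∑ c : Fin n → K with conjPoly K v ∣ monicOfCoeffs n c, ψ (monicOfCoeffs n c) := by
        simp only [Finset.sum_mul, ite_mul, one_mul, zero_mul, Finset.sum_filter]
        rw [Finset.sum_comm]
        exact Finset.sum_congr rfl fun j _ ↦ Finset.sum_comm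
    _ = _ := by
        refine Finset.sum_congr rfl fun j hj ↦ ?_
        rw [Finset.sum_mul]
        refine Finset.sum_congr rfl fun v _ ↦ ?_
        refine sum_filter_dvd hψ (monic_conjPoly K v) ?_ (Finset.mem_range.1 hj)
        rw [natDegree_conjPoly, FiniteField.finrank_extension]

end Newton

section PowerSum

open Polynomial

variable {K : Type*} [Field K]

/-- The power sum of exponent `2 * t + 1` (for `t ≤ 1`) of the roots of a monic polynomial over a
field of characteristic two, in terms of its coefficients. -/
noncomputable def rootPowerSum (t : ℕ) (f : K[X]) : K :=
  if t = 0 then f.reverse.coeff 1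
  else f.reverse.coeff 1 ^ 3 + f.reverse.coeff 1 * f.reverse.coeff 2 + f.reverse.coeff 3

/-- The sum of `r ^ (2 * t + 1) + r⁻¹` over the roots `r` of a polynomial. -/
noncomputable def rootLaurentSum (t : ℕ) (f : K[X]) : K :=
  rootPowerSum t f + f.coeff 1 / f.coeff 0

lemma rootLaurentSum_one (t : ℕ) : rootLaurentSum t (1 : K[X]) = 0 := by
  have : (1 : K[X]).reverse = 1 := by rw [← C_1, reverse_C]
  simp [rootLaurentSum, rootPowerSum, this, coeff_one]

lemma rootLaurentSum_map {L : Type*} [Field L] (φ : K →+* L) (t : ℕ) (f : K[X]) :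
    rootLaurentSum t (f.map φ) = φ (rootLaurentSum t f) := by
  have h : ∀ i, (f.map φ).reverse.coeff i = φ (f.reverse.coeff i) := fun i ↦ by
    simp only [coeff_reverse, natDegree_map, coeff_map]
  simp only [rootLaurentSum, rootPowerSum, h, coeff_map]
  split_ifs <;> simp

variable [CharP K 2]

lemma rootLaurentSum_mul (t : ℕ) {f g : K[X]} (hf : f.Monic) (hg : g.Monic) (hf0 : f.coeff 0 ≠ 0)
    (hg0 : g.coeff 0 ≠ 0) :
    rootLaurentSum t (f * g) = rootLaurentSum t f + rootLaurentSum t g := by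
  have h2 : (2 : K) = 0 := CharTwo.two_eq_zero
  have h1 : (f * g).coeff 1 / (f * g).coeff 0 =
      f.coeff 1 / f.coeff 0 + g.coeff 1 / g.coeff 0 := by
    rw [mul_coeff_one, mul_coeff_zero]
    field_simp
    ring
  have h3 : rootPowerSum t (f * g) = rootPowerSum t f + rootPowerSum t g := by
    have c1 : (f * g).reverse.coeff 1 = f.reverse.coeff 1 + g.reverse.coeff 1 := by
      simp [reverse_mul_of_domain, coeff_mul, Finset.Nat.antidiagonal_succ, hf.leadingCoeff,
        hg.leadingCoeff, add_comm]
    have c2 : (f * g).reverse.coeff 2 = f.reverse.coeff 2 + f.reverse.coeff 1 * g.reverse.coeff 1 +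
        g.reverse.coeff 2 := by
      simp only [reverse_mul_of_domain, coeff_mul]
      simp [Finset.Nat.antidiagonal_succ, hf.leadingCoeff, hg.leadingCoeff, -coeff_one_reverse]
      ring
    have c3 : (f * g).reverse.coeff 3 = f.reverse.coeff 3 + f.reverse.coeff 2 * g.reverse.coeff 1 +
        f.reverse.coeff 1 * g.reverse.coeff 2 + g.reverse.coeff 3 := by
      simp only [reverse_mul_of_domain, coeff_mul]
      simp [Finset.Nat.antidiagonal_succ, hf.leadingCoeff, hg.leadingCoeff, -coeff_one_reverse]
      ring
    simp only [rootPowerSum, c1, c2, c3]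
    split_ifs
    · rfl
    · generalize f.reverse.coeff 1 = f1
      generalize f.reverse.coeff 2 = f2
      generalize g.reverse.coeff 1 = g1
      generalize g.reverse.coeff 2 = g2
      linear_combination (2 * f1 ^ 2 * g1 + 2 * f1 * g1 ^ 2 + f1 * g2 + f2 * g1) * h2
  rw [rootLaurentSum, h1, h3, rootLaurentSum, rootLaurentSum]
  ring

lemma rootLaurentSum_X_sub_C {t : ℕ} (ht : t ≤ 1) {r : K} :
    rootLaurentSum t (X - C r) = r ^ (2 * t + 1) + r⁻¹ := by
  have h : ∀ i, (X - C r).reverse.coeff (i + 2) = 0 := fun i ↦ by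
    refine coeff_eq_zero_of_natDegree_lt ((reverse_natDegree_le _).trans_lt ?_)
    rw [natDegree_X_sub_C]
    omega
  have h1 : (X - C r).reverse.coeff 1 = r := by
    rw [coeff_reverse, natDegree_X_sub_C, revAt_le le_rfl]
    simp [CharTwo.neg_eq]
  interval_cases t <;>
    simp [rootLaurentSum, rootPowerSum, h1, h 0, h 1, CharTwo.neg_eq]

lemma rootLaurentSum_prod {ι : Type*} (s : Finset ι) {t : ℕ} (ht : t ≤ 1) (r : ι → K)
    (hr : ∀ i ∈ s, r i ≠ 0) :
    rootLaurentSum t (∏ i ∈ s, (X - C (r i))) = ∑ i ∈ s, (r i ^ (2 * t + 1) + (r i)⁻¹) := by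
  classical
  induction s using Finset.induction_on with
  | empty => simpa using rootLaurentSum_one t
  | insert i s hi ih =>
    rw [Finset.prod_insert hi, Finset.sum_insert hi, rootLaurentSum_mul t (monic_X_sub_C _)
      (monic_prod_of_monic _ _ fun j _ ↦ monic_X_sub_C _), ih fun j hj ↦
      hr j (Finset.mem_insert_of_mem hj), rootLaurentSum_X_sub_C ht]
    · simpa using hr i (Finset.mem_insert_self _ _)
    · simp only [coeff_zero_prod, coeff_sub, coeff_X_zero, coeff_C_zero, zero_sub]
      exact Finset.prod_ne_zero_iff.2 fun j hj ↦ neg_ne_zero.2 (hr j (Finset.mem_insert_of_mem hj))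

end PowerSum

section Multiplicative

open Polynomial

variable {K : Type*} [Field K] [Algebra (ZMod 2) K]

open Classical in
/-- The multiplicative function on monic polynomials attached to the character sums
`laurentSum`. -/
noncomputable def polySign (μ : K) (t : ℕ) (f : K[X]) : ℤ :=
  if f.coeff 0 = 0 then 0 else traceSign (μ * rootLaurentSum t f)

lemma polySign_one (μ : K) (t : ℕ) : polySign μ t 1 = 1 := by
  simp [polySign, rootLaurentSum_one]

variable [CharP K 2]

lemma polySign_mul (μ : K) (t : ℕ) (f g : K[X]) (hf : f.Monic) (hg : g.Monic) :
    polySign μ t (f * g) = polySign μ t f * polySign μ t g := by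
  by_cases hf0 : f.coeff 0 = 0
  · simp [polySign, hf0]
  by_cases hg0 : g.coeff 0 = 0
  · simp [polySign, hg0]
  have hfg : (f * g).coeff 0 ≠ 0 := by
    rw [mul_coeff_zero]
    exact mul_ne_zero hf0 hg0
  rw [polySign, if_neg hfg, polySign, if_neg hf0, polySign, if_neg hg0,
    rootLaurentSum_mul t hf hg hf0 hg0, mul_add, traceSign_add]

variable {L : Type*} [Field L] [Algebra K L] [FiniteDimensional K L] [IsGalois K L]
  [Algebra (ZMod 2) L] [IsScalarTower (ZMod 2) K L] [CharP L 2] [Finite K]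

lemma polySign_conjPoly (μ : K) {t : ℕ} (ht : t ≤ 1) {v : L} (hv : v ≠ 0) :
    polySign μ t (conjPoly K v) = traceSign (algebraMap K L μ * (v ^ (2 * t + 1) + v⁻¹)) := by
  have h0 : (conjPoly K v).coeff 0 ≠ 0 := by
    intro h
    have h1 := congr_arg (algebraMap K L) h
    rw [← coeff_map, map_conjPoly, map_zero, coeff_zero_prod] at h1
    obtain ⟨g, -, hg⟩ := Finset.prod_eq_zero_iff.1 h1
    exact hv (by simpa using hg)
  have h2 : rootLaurentSum t (conjPoly K v) = Algebra.trace K L (v ^ (2 * t + 1) + v⁻¹) := by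
    apply (algebraMap K L).injective
    rw [← rootLaurentSum_map, map_conjPoly, trace_eq_sum_automorphisms,
      rootLaurentSum_prod _ ht _ fun g _ ↦ by simpa using hv]
    simp
  have : Finite L := Module.finite_of_finite K
  rw [polySign, if_neg h0, h2, ← smul_eq_mul μ, ← map_smul, Algebra.smul_def]
  unfold traceSign
  rw [Algebra.trace_trace]

lemma polySign_conjPoly_zero (μ : K) (t : ℕ) : polySign μ t (conjPoly K (0 : L)) = 0 := by
  rw [polySign, if_pos]
  apply (algebraMap K L).injective
  rw [← coeff_map, map_conjPoly, map_zero, coeff_zero_prod]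
  exact Finset.prod_eq_zero (Finset.mem_univ 1) (by simp)

end Multiplicative

section LFunction

open Polynomial

variable {K : Type*} [Field K] [Fintype K] [Algebra (ZMod 2) K] [CharP K 2]

instance (n : ℕ) : CharP (FiniteField.Extension K 2 n) 2 :=
  charP_of_injective_algebraMap (algebraMap (ZMod 2) _).injective 2

open Classical in
lemma sum_polySign_conjPoly (μ : K) {t : ℕ} (ht : t ≤ 1) (n : ℕ) [NeZero n] :
    ∑ v : FiniteField.Extension K 2 n, polySign μ t (conjPoly K v) =
      laurentSum (algebraMap K (FiniteField.Extension K 2 n) μ) (2 * t + 1) := by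
  rw [laurentSum, Finset.sum_filter]
  refine Finset.sum_congr rfl fun v _ ↦ ?_
  split_ifs with h
  · exact polySign_conjPoly μ ht h
  · rw [not_not.1 h, polySign_conjPoly_zero]

end LFunction

section Coefficients

open Polynomial

variable {K : Type*} [Field K] [Fintype K] [Algebra (ZMod 2) K] [CharP K 2]

lemma sum_vecCons {M : Type*} [AddCommMonoid M] (n : ℕ) (f : (Fin (n + 1) → K) → M) :
    ∑ c, f c = ∑ a : K, ∑ c : Fin n → K, f (Matrix.vecCons a c) := by
  rw [← Fintype.sum_prod_type']
  exact ((Fin.consEquiv fun _ ↦ K).sum_comp f).symm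

lemma coeff_reverse_monicOfCoeffs {n i : ℕ} (c : Fin n → K) (hi : 0 < i) (hn : i ≤ n) :
    (monicOfCoeffs n c).reverse.coeff i = c ⟨n - i, by omega⟩ := by
  rw [coeff_reverse, natDegree_monicOfCoeffs, revAt_le hn, coeff_monicOfCoeffs, if_neg (by omega),
    dif_pos (by omega), zero_add]

lemma monicSum_polySign_one [DecidableEq K] (μ : K) {t : ℕ} (ht : t ≤ 1) :
    monicSum (polySign μ t) 1 = laurentSum μ (2 * t + 1) := by
  rw [monicSum, laurentSum, Finset.sum_filter, sum_vecCons]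
  refine Finset.sum_congr rfl fun a _ ↦ ?_
  rw [Fintype.sum_unique]
  have h : monicOfCoeffs 1 (Matrix.vecCons a default) = X - C a := by
    simp [monicOfCoeffs, CharTwo.sub_eq_add]
  rw [h, polySign, rootLaurentSum_X_sub_C ht]
  simp

lemma monicSum_polySign_eq_zero {μ : K} (hμ : μ ≠ 0) {t : ℕ} (ht : t ≤ 1) {n : ℕ}
    (hn : 2 * t + 3 ≤ n) : monicSum (polySign μ t) n = 0 := by
  obtain ⟨b, hb⟩ := exists_traceSign_eq_neg_one (F := K)
  let i : Fin n := ⟨n - (2 * t + 1), by omega⟩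
  have h1 : monicSum (polySign μ t) n =
      ∑ c : Fin n → K, polySign μ t (monicOfCoeffs n (c + Pi.single i (b / μ))) :=
    (Equiv.sum_comp (Equiv.addRight (Pi.single i (b / μ) : Fin n → K))
      fun c ↦ polySign μ t (monicOfCoeffs n c)).symm
  have h2 : ∀ c : Fin n → K, polySign μ t (monicOfCoeffs n (c + Pi.single i (b / μ))) =
      -polySign μ t (monicOfCoeffs n c) := by
    intro c
    have hc : ∀ j (hj : j < n), j ≠ n - (2 * t + 1) →
        (c + Pi.single i (b / μ) : Fin n → K) ⟨j, hj⟩ = c ⟨j, hj⟩ := fun j hj h ↦ by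
      rw [Pi.add_apply, Pi.single_eq_of_ne, add_zero]
      exact fun h' ↦ h (congr_arg Fin.val h')
    have hi : (c + Pi.single i (b / μ) : Fin n → K) ⟨n - (2 * t + 1), by omega⟩ =
        c ⟨n - (2 * t + 1), by omega⟩ + b / μ := by
      rw [Pi.add_apply]
      congr 1
      exact Pi.single_eq_same i _
    have h3 : rootLaurentSum t (monicOfCoeffs n (c + Pi.single i (b / μ))) =
        rootLaurentSum t (monicOfCoeffs n c) + b / μ := by
      have h0 : ∀ j < 2, (monicOfCoeffs n (c + Pi.single i (b / μ))).coeff j =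
          (monicOfCoeffs n c).coeff j := fun j hj ↦ by
        rw [coeff_monicOfCoeffs, coeff_monicOfCoeffs, dif_pos (by omega), dif_pos (by omega),
          hc _ _ (by omega)]
      rw [rootLaurentSum, rootLaurentSum, h0 0 (by norm_num), h0 1 (by norm_num), rootPowerSum,
        rootPowerSum]
      clear_value i
      interval_cases t
      · simp only [if_true, coeff_reverse_monicOfCoeffs _ one_pos (show 1 ≤ n by omega)]
        simp only [mul_zero, zero_add] at hi
        rw [hi]
        ring
      · simp only [if_neg one_ne_zero,
          coeff_reverse_monicOfCoeffs _ one_pos (show 1 ≤ n by omega),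
          coeff_reverse_monicOfCoeffs _ two_pos (show 2 ≤ n by omega),
          coeff_reverse_monicOfCoeffs _ three_pos (show 3 ≤ n by omega)]
        simp only [mul_one, Nat.reduceAdd] at hi hc
        rw [hi, hc _ _ (by omega), hc _ _ (by omega)]
        ring
    have h0 : (monicOfCoeffs n (c + Pi.single i (b / μ))).coeff 0 =
        (monicOfCoeffs n c).coeff 0 := by
      rw [coeff_monicOfCoeffs, coeff_monicOfCoeffs, dif_pos (by omega), dif_pos (by omega),
        hc _ _ (by omega)]
    rw [polySign, polySign, h0, h3, mul_add, mul_div_cancel₀ _ hμ, traceSign_add, hb]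
    split_ifs <;> simp
  simp only [h2, Finset.sum_neg_distrib] at h1
  rw [monicSum] at h1 ⊢
  omega

lemma sum_traceSign_linear [DecidableEq K] {μ : K} (hμ : μ ≠ 0) (a b : K) :
    ∑ x : K, traceSign (μ * (a * x + b)) =
      if a = 0 then Fintype.card K * traceSign (μ * b) else 0 := by
  split_ifs with h
  · simp [h]
  · simp only [mul_add, traceSign_add, ← Finset.sum_mul, ← mul_assoc]
    rw [sum_traceSign_mul (mul_ne_zero hμ h), zero_mul]

lemma one_add_inv_eq_zero_iff {a : K} : 1 + a⁻¹ = 0 ↔ a = 1 := by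
  rw [CharTwo.add_eq_zero, eq_comm, inv_eq_one]

open Classical in
lemma monicSum_polySign_zero_two {μ : K} (hμ : μ ≠ 0) :
    monicSum (polySign μ 0) 2 = Fintype.card K := by
  rw [monicSum]
  simp only [sum_vecCons, Fintype.sum_unique]
  have h : ∀ a b : K, polySign μ 0 (monicOfCoeffs 2
      (Matrix.vecCons a (Matrix.vecCons b default))) =
      if a = 0 then 0 else traceSign (μ * ((1 + a⁻¹) * b + 0)) := fun a b ↦ by
    rw [polySign, rootLaurentSum, rootPowerSum, if_pos rfl,
      coeff_reverse_monicOfCoeffs _ one_pos (by norm_num)]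
    simp only [coeff_monicOfCoeffs]
    simp
    split_ifs
    · rfl
    · congr 1
      ring
  simp only [h]
  have h1 : ∀ a : K, ∑ b : K, (if a = 0 then 0 else traceSign (μ * ((1 + a⁻¹) * b + 0))) =
      if a = 1 then (Fintype.card K : ℤ) else 0 := fun a ↦ by
    by_cases ha : a = 0
    · simp [ha]
    · simp only [ha, if_false, sum_traceSign_linear hμ, one_add_inv_eq_zero_iff]
      simp
  simp only [h1]
  simp

open Classical in
lemma monicSum_polySign_one_three {μ : K} (hμ : μ ≠ 0) :
    monicSum (polySign μ 1) 3 = Fintype.card K * laurentSum μ 3 := by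
  rw [monicSum]
  simp only [sum_vecCons, Fintype.sum_unique]
  have h : ∀ a b c : K, polySign μ 1 (monicOfCoeffs 3
      (Matrix.vecCons a (Matrix.vecCons b (Matrix.vecCons c default)))) =
      if a = 0 then 0 else traceSign (μ * ((c + a⁻¹) * b + (c ^ 3 + a))) := fun a b c ↦ by
    rw [polySign, rootLaurentSum, rootPowerSum, if_neg one_ne_zero,
      coeff_reverse_monicOfCoeffs _ one_pos (by norm_num),
      coeff_reverse_monicOfCoeffs _ two_pos (by norm_num),
      coeff_reverse_monicOfCoeffs _ three_pos (by norm_num)]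
    simp only [coeff_monicOfCoeffs]
    simp
    split_ifs
    · rfl
    · congr 1
      ring
  simp only [h]
  have h1 : ∀ a : K, ∑ b : K, ∑ c : K,
      (if a = 0 then 0 else traceSign (μ * ((c + a⁻¹) * b + (c ^ 3 + a)))) =
      if a = 0 then 0 else Fintype.card K * traceSign (μ * (a⁻¹ ^ 3 + a)) := fun a ↦ by
    by_cases ha : a = 0
    · simp [ha]
    · rw [Finset.sum_comm]
      simp only [ha, if_false, sum_traceSign_linear hμ, CharTwo.add_eq_zero]
      simp
  simp only [h1]
  rw [laurentSum, Finset.sum_filter, Finset.mul_sum, ← Equiv.sum_comp (Equiv.inv K)]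
  refine Finset.sum_congr rfl fun a _ ↦ ?_
  by_cases ha : a = 0 <;> simp [ha]

open Classical in
lemma monicSum_polySign_one_four {μ : K} (hμ : μ ≠ 0) :
    monicSum (polySign μ 1) 4 = (Fintype.card K : ℤ) ^ 2 := by
  rw [monicSum]
  simp only [sum_vecCons, Fintype.sum_unique]
  have h : ∀ a b c d : K, polySign μ 1 (monicOfCoeffs 4
      (Matrix.vecCons a (Matrix.vecCons b (Matrix.vecCons c (Matrix.vecCons d default))))) =
      if a = 0 then 0 else traceSign (μ * ((1 + a⁻¹) * b + (d ^ 3 + d * c))) := fun a b c d ↦ by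
    rw [polySign, rootLaurentSum, rootPowerSum, if_neg one_ne_zero,
      coeff_reverse_monicOfCoeffs _ one_pos (by norm_num),
      coeff_reverse_monicOfCoeffs _ two_pos (by norm_num),
      coeff_reverse_monicOfCoeffs _ three_pos (by norm_num)]
    simp only [coeff_monicOfCoeffs]
    simp
    split_ifs
    · rfl
    · congr 1
      ring
  simp only [h]
  have h1 : ∀ a : K, ∑ b : K, ∑ c : K, ∑ d : K,
      (if a = 0 then 0 else traceSign (μ * ((1 + a⁻¹) * b + (d ^ 3 + d * c)))) =
      if a = 1 then (Fintype.card K : ℤ) ^ 2 else 0 := fun a ↦ by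
    by_cases ha : a = 0
    · simp [ha]
    · rw [Finset.sum_comm, Finset.sum_congr rfl fun c _ ↦ Finset.sum_comm]
      simp only [ha, if_false, sum_traceSign_linear hμ, one_add_inv_eq_zero_iff]
      by_cases ha1 : a = 1
      · simp only [ha1, if_true, ← Finset.mul_sum]
        rw [Finset.sum_comm]
        simp only [add_comm (_ ^ 3), sum_traceSign_linear hμ]
        simp [sq]
      · simp [ha1]
  simp only [h1]
  simp

end Coefficients

section Analysis

open Polynomial

lemma hasSum_eval (p : ℂ[X]) (T : ℂ) : HasSum (fun n ↦ p.coeff n * T ^ n) (p.eval T) := by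
  rw [eval_eq_sum_range]
  refine hasSum_sum_of_ne_finset_zero fun n hn ↦ ?_
  rw [coeff_eq_zero_of_natDegree_lt (by simpa using hn), zero_mul]

lemma summable_norm_coeff_mul_pow (p : ℂ[X]) (T : ℂ) : Summable fun n ↦ ‖p.coeff n * T ^ n‖ :=
  (hasSum_eval p T).summable.norm

/-- If the logarithmic derivative of a polynomial is bounded on a disc, as a power series, then the
polynomial has no zero there. -/
theorem eval_ne_zero_of_newton {p : ℂ[X]} (h0 : p.coeff 0 = 1) {S : ℕ → ℂ}
    (hN : ∀ n : ℕ, n * p.coeff n = ∑ j ∈ Finset.range n, S j * p.coeff (n - (j + 1)))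
    {M r : ℝ} (hr : 0 ≤ r) (hS : ∀ j, ‖S j‖ ≤ M * r ^ (j + 1)) {T : ℂ} (hT : ‖T‖ * r < 1) :
    p.eval T ≠ 0 := by
  intro hz
  have hM : 0 ≤ M * r := by simpa using (norm_nonneg _).trans (hS 0)
  have hgeo := hasSum_geometric_of_lt_one (mul_nonneg (norm_nonneg T) hr) hT
  have hS' : ∀ z : ℂ, ‖z‖ ≤ ‖T‖ → ∀ j, ‖S j * z ^ j‖ ≤ M * r * (‖T‖ * r) ^ j := by
    intro z hz j
    rw [norm_mul, norm_pow]
    calc ‖S j‖ * ‖z‖ ^ j ≤ (M * r ^ (j + 1)) * ‖T‖ ^ j :=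
          mul_le_mul (hS j) (pow_le_pow_left₀ (norm_nonneg _) hz j) (by positivity)
            ((norm_nonneg _).trans (hS j))
      _ = _ := by ring
  have hsum : ∀ z : ℂ, ‖z‖ ≤ ‖T‖ → Summable fun j ↦ ‖S j * z ^ j‖ := fun z hz ↦
    Summable.of_nonneg_of_le (fun _ ↦ norm_nonneg _) (hS' z hz) (hgeo.summable.mul_left _)
  have hder : ∀ z : ℂ, ‖z‖ ≤ ‖T‖ →
      p.derivative.eval z = (∑' j, S j * z ^ j) * p.eval z := by
    intro z hz
    rw [← (hasSum_eval p z).tsum_eq, tsum_mul_tsum_eq_tsum_sum_antidiagonal_of_summable_norm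
      (hsum z hz) (summable_norm_coeff_mul_pow p z), ← (hasSum_eval _ z).tsum_eq]
    refine tsum_congr fun n ↦ ?_
    have h1 := hN (n + 1)
    rw [coeff_derivative, mul_comm (p.coeff _), ← Nat.cast_succ, h1, Finset.sum_mul,
      Finset.Nat.sum_antidiagonal_eq_sum_range_succ_mk]
    refine Finset.sum_congr rfl fun j hj ↦ ?_
    have hj' : j ≤ n := Nat.lt_succ_iff.1 (Finset.mem_range.1 hj)
    rw [Nat.add_sub_add_right]
    have h2 : z ^ n = z ^ j * z ^ (n - j) := by rw [← pow_add, Nat.add_sub_cancel' hj']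
    rw [h2]
    ring
  have hbound : ∀ z : ℂ, ‖z‖ ≤ ‖T‖ →
      ‖p.derivative.eval z‖ ≤ (M * r * (1 - ‖T‖ * r)⁻¹) * ‖p.eval z‖ := by
    intro z hz
    rw [hder z hz, norm_mul]
    refine mul_le_mul_of_nonneg_right ?_ (norm_nonneg _)
    exact tsum_of_norm_bounded (hgeo.mul_left _) (hS' z hz)
  have hf : ∀ s : ℝ, HasDerivAt (fun s : ℝ ↦ p.eval ((1 - s : ℂ) * T))
      (p.derivative.eval ((1 - s : ℂ) * T) * (-1 * T)) s := by
    intro s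
    have h1 : HasDerivAt (fun s : ℝ ↦ (1 - s : ℂ) * T) (-1 * T) s :=
      ((Complex.ofRealCLM.hasDerivAt (x := s)).const_sub 1).mul_const T
    exact (p.hasDerivAt _).comp s h1
  have h1 := eq_zero_of_abs_deriv_le_mul_abs_self_of_eq_zero_right (a := 0) (b := 1)
    (K := (M * r * (1 - ‖T‖ * r)⁻¹) * ‖T‖)
    (fun s _ ↦ (hf s).continuousAt.continuousWithinAt) (fun s _ ↦ (hf s).hasDerivWithinAt)
    (by simpa using hz) (fun s hs ↦ by
      have hs' : ‖(1 - s : ℂ) * T‖ ≤ ‖T‖ := by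
        rw [norm_mul, ← Complex.ofReal_one, ← Complex.ofReal_sub, Complex.norm_real,
          Real.norm_of_nonneg (by linarith [hs.2])]
        nlinarith [norm_nonneg T, hs.1]
      have h2 := mul_le_mul_of_nonneg_right (hbound _ hs') (norm_nonneg T)
      rw [norm_mul, neg_one_mul, norm_neg]
      linarith) 1 (by simp)
  simp [← coeff_zero_eq_eval_zero, h0] at h1

/-- A reciprocal quadratic polynomial has a root inside the unit disc, unless its middle coefficient
is real of absolute value at most two. -/
lemma exists_root_norm_lt_one (w : ℂ) :
    (∃ u : ℂ, ‖u‖ < 1 ∧ u ^ 2 - w * u + 1 = 0) ∨ ∃ x : ℝ, |x| ≤ 2 ∧ w = x := by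
  obtain ⟨δ, hδ⟩ := IsAlgClosed.exists_pow_nat_eq (w ^ 2 - 4) two_pos
  obtain ⟨u, hu⟩ : ∃ u, u = (w + δ) / 2 := ⟨_, rfl⟩
  have hu1 : u ^ 2 - w * u + 1 = 0 := by
    rw [hu]
    linear_combination hδ / 4
  have hu0 : u ≠ 0 := by
    rintro rfl
    simp at hu1
  rcases lt_trichotomy ‖u‖ 1 with h | h | h
  · exact Or.inl ⟨u, h, hu1⟩
  · right
    have h2 : w = u + (starRingEnd ℂ) u := by
      rw [← Complex.inv_eq_conj h]
      field_simp
      linear_combination -hu1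
    refine ⟨2 * u.re, ?_, ?_⟩
    · rw [abs_mul, abs_two]
      linarith [Complex.abs_re_le_norm u]
    · rw [h2, Complex.add_conj]
  · refine Or.inl ⟨u⁻¹, ?_, ?_⟩
    · rw [norm_inv]
      exact inv_lt_one_of_one_lt₀ h
    · field_simp
      linear_combination hu1

lemma exists_scaled_root {q : ℝ} (hq : 0 < q) (z : ℂ) :
    (∃ T : ℂ, ‖T‖ * √q < 1 ∧ q * T ^ 2 - z * T + 1 = 0) ∨ ∃ x : ℝ, |x| ≤ 2 * √q ∧ z = x := by
  have hs : 0 < √q := Real.sqrt_pos.2 hq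
  have hs' : (√q : ℂ) ≠ 0 := Complex.ofReal_ne_zero.2 hs.ne'
  have hq' : (q : ℂ) = (√q : ℂ) ^ 2 := by
    rw [← Complex.ofReal_pow, Real.sq_sqrt hq.le]
  rcases exists_root_norm_lt_one (z / √q) with ⟨u, hu, h⟩ | ⟨x, hx, h⟩
  · refine Or.inl ⟨u / √q, ?_, ?_⟩
    · rw [norm_div, Complex.norm_real, Real.norm_of_nonneg hs.le, div_mul_cancel₀ _ hs.ne']
      exact hu
    · rw [hq', ← h]
      field_simp
  · refine Or.inr ⟨x * √q, ?_, ?_⟩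
    · rw [abs_mul, abs_of_pos hs]
      exact mul_le_mul_of_nonneg_right hx hs.le
    · rw [Complex.ofReal_mul, ← h, div_mul_cancel₀ _ hs']

/-- Serre's bound for the trace of a real quadratic polynomial with integral coefficients whose
roots are bounded. -/
lemma abs_le_two_mul_of_real_roots {x y : ℝ} {s m b : ℤ} {ρ : ℝ} (hb : ρ < b + 1) (hx : |x| ≤ ρ)
    (hy : |y| ≤ ρ) (hs : x + y = s) (hm : x * y = m) : |s| ≤ 2 * b := by
  rw [abs_le] at hx hy ⊢
  have h1 : 0 < (b + 1) ^ 2 - s * (b + 1) + m := by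
    have : (0 : ℝ) < (b + 1 - x) * (b + 1 - y) := mul_pos (by linarith) (by linarith)
    have h : ((0 : ℤ) : ℝ) < (((b + 1) ^ 2 - s * (b + 1) + m : ℤ) : ℝ) := by
      push_cast
      rw [← hs, ← hm]
      linarith
    exact_mod_cast h
  have h2 : 0 < (b + 1) ^ 2 + s * (b + 1) + m := by
    have : (0 : ℝ) < (b + 1 + x) * (b + 1 + y) := mul_pos (by linarith) (by linarith)
    have h : ((0 : ℤ) : ℝ) < (((b + 1) ^ 2 + s * (b + 1) + m : ℤ) : ℝ) := by
      push_cast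
      rw [← hs, ← hm]
      linarith
    exact_mod_cast h
  have h3 : 4 * m ≤ s ^ 2 := by
    have h : ((4 * m : ℤ) : ℝ) ≤ ((s ^ 2 : ℤ) : ℝ) := by
      push_cast
      rw [← hs, ← hm]
      nlinarith [sq_nonneg (x - y)]
    exact_mod_cast h
  have h4 : |(s : ℝ)| ≤ 2 * ρ := by
    rw [← hs, abs_le]
    constructor <;> linarith
  have h5 : (|s| : ℤ) < 2 * (b + 1) := by
    have : ((|s| : ℤ) : ℝ) < ((2 * (b + 1) : ℤ) : ℝ) := by
      push_cast
      linarith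
    exact_mod_cast this
  rw [abs_lt] at h5
  constructor
  · by_contra! h
    have : s = -(2 * b + 1) := by omega
    subst this
    nlinarith
  · by_contra! h
    have : s = 2 * b + 1 := by omega
    subst this
    nlinarith

end Analysis

section RootBounds

open Polynomial

variable {K : Type*} [Field K] [Fintype K] [Algebra (ZMod 2) K] [CharP K 2]

/-- The Riemann hypothesis for the `L`-function attached to `laurentSum`. -/
lemma sum_monicSum_polySign_ne_zero {μ : K} (hμ : μ ≠ 0) {t : ℕ} (ht : t ≤ 1) {T : ℂ}
    (hT : ‖T‖ * √(Fintype.card K) < 1) :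
    ∑ n ∈ Finset.range (2 * t + 3), (monicSum (polySign μ t) n : ℂ) * T ^ n ≠ 0 := by
  classical
  obtain ⟨p, hp⟩ : ∃ p : ℂ[X], p =
      ∑ n ∈ Finset.range (2 * t + 3), C (monicSum (polySign μ t) n : ℂ) * X ^ n := ⟨_, rfl⟩
  have hcoeff : ∀ n, p.coeff n = (monicSum (polySign μ t) n : ℂ) := fun n ↦ by
    rw [hp]
    simp only [finsetSum_coeff, coeff_C_mul_X_pow]
    rw [Finset.sum_ite_eq]
    split_ifs with h
    · rfl
    · rw [monicSum_polySign_eq_zero hμ ht (by simpa using h), Int.cast_zero]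
  have heval : p.eval T =
      ∑ n ∈ Finset.range (2 * t + 3), (monicSum (polySign μ t) n : ℂ) * T ^ n := by
    rw [hp]
    simp [eval_finsetSum]
  rw [← heval]
  refine eval_ne_zero_of_newton (M := 39) (r := √(Fintype.card K))
    (S := fun j ↦ ((laurentSum (algebraMap K (FiniteField.Extension K 2 (j + 1)) μ)
      (2 * t + 1) : ℤ) : ℂ)) ?_ ?_ (Real.sqrt_nonneg _) ?_ hT
  · rw [hcoeff, monicSum_zero (polySign_one μ t), Int.cast_one]
  · intro n
    have h := mul_monicSum 2 (polySign_mul μ t) n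
    simp only [sum_polySign_conjPoly μ ht] at h
    simp only [hcoeff]
    exact_mod_cast h
  · intro j
    have h := laurentSum_sq_le (k := FiniteField.Extension K 2 (j + 1))
      (μ := algebraMap K (FiniteField.Extension K 2 (j + 1)) μ)
      ((map_ne_zero_iff _ (algebraMap K _).injective).2 hμ) ht
    rw [← Nat.card_eq_fintype_card, FiniteField.natCard_extension,
      Nat.card_eq_fintype_card] at h
    rw [Complex.norm_intCast]
    refine abs_le_of_sq_le_sq ?_ (by positivity)
    rw [mul_pow, ← pow_mul, mul_comm (j + 1), pow_mul, Real.sq_sqrt (Nat.cast_nonneg _)]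
    norm_num
    exact_mod_cast h

variable [DecidableEq K]

/-- Hasse's bound for `laurentSum μ 1`. -/
theorem abs_laurentSum_one_le {μ : K} (hμ : μ ≠ 0) :
    |(laurentSum μ 1 : ℝ)| ≤ 2 * √(Fintype.card K) := by
  have hq : (0 : ℝ) < Fintype.card K := Nat.cast_pos.2 Fintype.card_pos
  rcases exists_scaled_root hq (-(laurentSum μ 1 : ℂ)) with ⟨T, hT, h⟩ | ⟨x, hx, h⟩
  · refine absurd ?_ (sum_monicSum_polySign_ne_zero hμ zero_le_one hT)
    simp only [Finset.sum_range_succ, Finset.sum_range_zero, mul_zero, zero_add,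
      monicSum_zero (polySign_one μ 0), monicSum_polySign_one μ zero_le_one,
      monicSum_polySign_zero_two hμ]
    push_cast at h ⊢
    linear_combination h
  · have h1 : (laurentSum μ 1 : ℝ) = -x := by
      rw [← Complex.ofReal_inj]
      push_cast
      linear_combination -h
    rwa [h1, abs_neg]

/-- Serre's bound for `laurentSum μ 3`. -/
theorem abs_laurentSum_three_le {μ : K} (hμ : μ ≠ 0) :
    |laurentSum μ 3| ≤ 2 * ⌊2 * √(Fintype.card K)⌋ := by
  have hq : (0 : ℝ) < Fintype.card K := Nat.cast_pos.2 Fintype.card_pos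
  have h3 : monicSum (polySign μ 1) 3 = Fintype.card K * laurentSum μ 3 := by
    convert monicSum_polySign_one_three hμ
  obtain ⟨c, hc⟩ : ∃ c, c = monicSum (polySign μ 1) 2 - 2 * Fintype.card K := ⟨_, rfl⟩
  have hL : ∀ T : ℂ, ‖T‖ * √(Fintype.card K) < 1 →
      1 + (laurentSum μ 3 : ℂ) * T + (c + 2 * Fintype.card K) * T ^ 2 +
        Fintype.card K * laurentSum μ 3 * T ^ 3 + Fintype.card K ^ 2 * T ^ 4 ≠ 0 := by
    intro T hT h
    refine absurd ?_ (sum_monicSum_polySign_ne_zero hμ le_rfl hT)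
    simp only [Finset.sum_range_succ, Finset.sum_range_zero, mul_one, zero_add, Nat.reduceAdd,
      monicSum_zero (polySign_one μ 1), monicSum_polySign_one μ le_rfl,
      h3, monicSum_polySign_one_four hμ]
    rw [hc] at h
    push_cast at h ⊢
    linear_combination h
  have hreal : ∀ z : ℂ, z ^ 2 + laurentSum μ 3 * z + c = 0 →
      ∃ x : ℝ, |x| ≤ 2 * √(Fintype.card K) ∧ z = x := by
    intro z hz
    refine (exists_scaled_root hq z).resolve_left ?_
    rintro ⟨T, hT, h⟩
    refine hL T hT ?_
    push_cast at h
    linear_combination T ^ 2 * hz +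
      (laurentSum μ 3 * T + Fintype.card K * T ^ 2 + 1 + z * T) * h
  obtain ⟨δ, hδ⟩ := IsAlgClosed.exists_pow_nat_eq ((laurentSum μ 3 : ℂ) ^ 2 - 4 * c) two_pos
  obtain ⟨x, hx, hx'⟩ := hreal ((-laurentSum μ 3 + δ) / 2) (by linear_combination hδ / 4)
  obtain ⟨y, hy, hy'⟩ := hreal ((-laurentSum μ 3 - δ) / 2) (by linear_combination hδ / 4)
  rw [← abs_neg]
  refine abs_le_two_mul_of_real_roots (Int.lt_floor_add_one _) hx hy (m := c) ?_ ?_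
  · rw [← Complex.ofReal_inj]
    push_cast
    rw [← hx', ← hy']
    ring
  · rw [← Complex.ofReal_inj]
    push_cast
    rw [← hx', ← hy']
    linear_combination -hδ / 4

end RootBounds

section Bounds

variable {F : Type*} [Field F] [Algebra (ZMod 2) F] [CharP F 2] [Fintype F] [DecidableEq F]

lemma sum_traceSign_add_div_eq {l w : F} (hl : l ≠ 0) (hw : w ^ 2 = l) :
    ∑ z : F with z ≠ 0, traceSign (z + l / z) = laurentSum w 1 := by
  have hw0 : w ≠ 0 := by
    rintro rfl
    exact hl (by simpa using hw.symm)
  rw [laurentSum, Finset.sum_filter, Finset.sum_filter,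
    ← Equiv.sum_comp (Equiv.mulLeft₀ w hw0)]
  refine Finset.sum_congr rfl fun v _ ↦ ?_
  change (if w * v ≠ 0 then traceSign (w * v + l / (w * v)) else 0) = _
  simp only [mul_ne_zero_iff, hw0, ne_eq, not_false_eq_true, true_and]
  split_ifs with h
  · rfl
  · rw [← hw, pow_one]
    congr 1
    field_simp

theorem quarticRoots_card_bounds (hodd : Odd (Module.finrank (ZMod 2) F)) (a : F) {l : F}
    (hl : l ≠ 0) :
    ((Fintype.card F : ℝ) - 11 - 2 * √(2 * Fintype.card F) - 8 * ⌊2 * √(Fintype.card F)⌋) / 24 ≤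
      (Finset.univ.filter fun s ↦ (quarticRoots a l s).card = 4).card ∧
    ((Finset.univ.filter fun s ↦ (quarticRoots a l s).card = 4).card : ℝ) ≤
      ((Fintype.card F : ℝ) + 1 + 2 * √(2 * Fintype.card F) +
        8 * ⌊2 * √(Fintype.card F)⌋) / 24 := by
  have hN := card_quarticRoots_formula hodd a hl
  obtain ⟨w, hw⟩ : ∃ w : F, w ^ 2 = l := (bijective_frobenius F 2).2 l
  have hw0 : w ≠ 0 := by
    rintro rfl
    exact hl (by simpa using hw.symm)
  rw [sum_traceSign_add_div_eq hl hw] at hN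
  change _ = _ + 3 * laurentSum l 3 + _ + _ at hN
  have hG : |(laurentSum l 3 : ℝ)| ≤ 2 * ⌊2 * √(Fintype.card F)⌋ := by
    exact_mod_cast abs_laurentSum_three_le hl
  have hK : |(laurentSum w 1 : ℝ)| ≤ ⌊2 * √(Fintype.card F)⌋ := by
    have h : |laurentSum w 1| ≤ ⌊2 * √(Fintype.card F)⌋ := by
      rw [Int.le_floor]
      push_cast
      exact abs_laurentSum_one_le hw0
    exact_mod_cast h
  have hH : |((∑ u : F, traceSign (l * (u ^ 3 + u)) : ℤ) : ℝ)| ≤ √(2 * Fintype.card F) := by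
    refine Real.abs_le_sqrt ?_
    exact_mod_cast sq_sum_traceSign_cubic_le hodd hl
  have hN' := congr_arg (Int.cast : ℤ → ℝ) hN
  generalize (∑ u : F, traceSign (l * (u ^ 3 + u))) = H at hH hN'
  rw [abs_le] at hG hK hH
  rcases traceSign_eq_one_or a with h | h <;> rw [h] at hN' <;> push_cast at hN' <;>
    constructor <;> linarith

end Bounds

/-- refined bounds for `N(A,B)` when `q = 2^m`, `m` odd and
`λ = B + A² + A + 1 ≠ 0`:
`(q − 11 − 2√(2q) − 8⌊2√q⌋)/24 ≤ N(A,B) ≤ (q + 1 + 2√(2q) + 8⌊2√q⌋)/24`. -/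
theorem N_bounds_refined
    (m : ℕ) (hm : Odd m) (A B : GaloisField 2 m)
    (hlam : B + A ^ 2 + A + 1 ≠ 0) :
    ((2 ^ m : ℝ) - 11 - 2 * Real.sqrt (2 * 2 ^ m) - 8 * ⌊2 * Real.sqrt (2 ^ m)⌋) / 24 ≤
      (Set.ncard {s : Finset (GaloisField 2 m) | s.card = 4 ∧
        (∑ x ∈ s, x) = 1 ∧ (∑ x ∈ s, x ^ 3) = A ∧ (∑ x ∈ s, x ^ 5) = B} : ℝ) ∧
    (Set.ncard {s : Finset (GaloisField 2 m) | s.card = 4 ∧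
        (∑ x ∈ s, x) = 1 ∧ (∑ x ∈ s, x ^ 3) = A ∧ (∑ x ∈ s, x ^ 5) = B} : ℝ) ≤
      ((2 ^ m : ℝ) + 1 + 2 * Real.sqrt (2 * 2 ^ m) + 8 * ⌊2 * Real.sqrt (2 ^ m)⌋) / 24 := by
  classical
  have hm0 : m ≠ 0 := hm.pos.ne'
  let _ : Fintype (GaloisField 2 m) := Fintype.ofFinite _
  have hodd : Odd (Module.finrank (ZMod 2) (GaloisField 2 m)) := by
    rwa [GaloisField.finrank 2 hm0]
  have hcard : (Fintype.card (GaloisField 2 m) : ℝ) = 2 ^ m := by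
    rw [← Nat.card_eq_fintype_card, GaloisField.card 2 m hm0]
    norm_cast
  have h := quarticRoots_card_bounds hodd (A + 1) hlam
  rwa [← ncard_powerSum_eq A B hlam, hcard] at h
end

section
/- Let q = 2^m with m odd, and let A, B ∈ F_q with λ := B + A² + A + 1 ≠ 0. Define f₁(x) = λx³ + λx + A + 1 and f₂(x) = λx⁻³ + λx⁻¹ + A + 1 for x ∈ F_q∖{0}, and set M = (1/2)·#{x ∈ F_q∖{0,1} : Tr(f₁(x)) = 0 and Tr(f₂(x)) = 0}. If Tr(A+1) = 0 then (q − 7 − 3⌊2√q⌋ − 2√(2q))/8 ≤ M ≤ (q − 7 + 3⌊2√q⌋ + 2√(2q))/8, and if Tr(A+1) = 1 then (q + 1 − 3⌊2√q⌋ − 2√(2q))/8 ≤ M ≤ (q + 1 + 3⌊2√q⌋ + 2√(2q))/8. -/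
open Polynomial in
/-- The coordinate ring `F[X][w]`, `w² = X w + g`, of an affine hyperelliptic curve. -/
abbrev HyperellipticRing {F : Type*} [Field F] (g : F[X]) : Type _ := QuadraticAlgebra F[X] g X

namespace HyperellipticRing

open Polynomial Finset

variable {F : Type*} [Field F] {g : F[X]}

/-- The functions whose pole order at infinity is smaller than `N`. -/
def poleLT (g : F[X]) (N : ℕ) : Submodule F (HyperellipticRing g) where
  carrier := {u | ∀ k, (N ≤ 2 * k → u.re.coeff k = 0) ∧ (N ≤ 2 * k + 5 → u.im.coeff k = 0)}
  add_mem' := fun {u v} hu hv k =>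
    ⟨fun h => by simp [(hu k).1 h, (hv k).1 h], fun h => by simp [(hu k).2 h, (hv k).2 h]⟩
  zero_mem' := fun k => by simp
  smul_mem' := fun c u hu k => ⟨fun h => by simp [(hu k).1 h], fun h => by simp [(hu k).2 h]⟩

theorem mem_poleLT {N : ℕ} {u : HyperellipticRing g} : u ∈ poleLT g N ↔
    ∀ k, (N ≤ 2 * k → u.re.coeff k = 0) ∧ (N ≤ 2 * k + 5 → u.im.coeff k = 0) := Iff.rfl

theorem mem_poleLT_iff_natDegree {N : ℕ} {u : HyperellipticRing g} : u ∈ poleLT g N ↔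
    (u.re ≠ 0 → 2 * u.re.natDegree < N) ∧ (u.im ≠ 0 → 2 * u.im.natDegree + 5 < N) := by
  rw [mem_poleLT]
  constructor
  · intro h
    refine ⟨fun h0 => ?_, fun h0 => ?_⟩
    · by_contra! hN
      exact h0 (leadingCoeff_eq_zero.1 ((h _).1 hN))
    · by_contra! hN
      exact h0 (leadingCoeff_eq_zero.1 ((h _).2 hN))
  · rintro ⟨h1, h2⟩ k
    refine ⟨fun hk => ?_, fun hk => ?_⟩
    · by_cases h0 : u.re = 0
      · simp [h0]
      · exact coeff_eq_zero_of_natDegree_lt (by have := h1 h0; omega)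
    · by_cases h0 : u.im = 0
      · simp [h0]
      · exact coeff_eq_zero_of_natDegree_lt (by have := h2 h0; omega)

theorem degree_norm_lt_iff (hg : g.natDegree = 5) {N : ℕ} {u : HyperellipticRing g} :
    u.norm.degree < N ↔ u ∈ poleLT g N := by
  rw [mem_poleLT_iff_natDegree, QuadraticAlgebra.norm_def]
  have hg0 : g ≠ 0 := by rintro rfl; simp at hg
  obtain ⟨a, b⟩ := u
  simp only
  by_cases ha : a = 0
  · by_cases hb : b = 0
    · simp [ha, hb]
    · simp only [ha, hb, degree_eq_natDegree, hg0, hg, mul_zero, zero_mul, add_zero, zero_sub, degree_neg,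
        degree_mul, ne_eq, not_true_eq_false, IsEmpty.forall_iff, not_false_eq_true,
        true_and, forall_const]
      norm_cast
      omega
  have ha2 : (a * a).degree = (2 * a.natDegree : ℕ) := by
    rw [degree_mul, degree_eq_natDegree ha]; norm_cast; omega
  by_cases hb : b = 0
  · simp only [hb, mul_zero, add_zero, sub_zero, ne_eq, not_true_eq_false, IsEmpty.forall_iff,
      and_true, ha, not_false_eq_true, forall_const, ha2]
    norm_cast
  have hb2 : (g * b * b).degree = (2 * b.natDegree + 5 : ℕ) := by
    rw [degree_mul, degree_mul, degree_eq_natDegree hb, degree_eq_natDegree hg0, hg]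
    norm_cast; omega
  have hab : (X * a * b).degree = ((1 + a.natDegree + b.natDegree : ℕ) : WithBot ℕ) := by
    rw [degree_mul, degree_mul, degree_eq_natDegree hb, degree_eq_natDegree ha, degree_X]
    norm_cast
  simp only [ne_eq, ha, hb, not_false_eq_true, forall_const]
  rcases lt_or_gt_of_ne (show 2 * a.natDegree ≠ 2 * b.natDegree + 5 by omega) with h | h
  · have h1 : (a * a + X * a * b).degree < (g * b * b).degree := by
      refine (degree_add_le _ _).trans_lt ?_
      rw [ha2, hb2, hab, max_lt_iff]
      norm_cast
      omega
    rw [show a * a + X * a * b - g * b * b = -(g * b * b) + (a * a + X * a * b) by ring,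
      degree_add_eq_left_of_degree_lt (by rwa [degree_neg]), degree_neg, hb2]
    norm_cast
    omega
  · have h1 : (X * a * b - g * b * b).degree < (a * a).degree := by
      refine (degree_sub_le _ _).trans_lt ?_
      rw [ha2, hb2, hab, max_lt_iff]
      norm_cast
      omega
    rw [add_sub_assoc, degree_add_eq_left_of_degree_lt h1, ha2]
    norm_cast
    omega

/-- A monomial with pole order `d` at infinity, for `d ≠ 1, 3`. -/
noncomputable def monomialOfOrder (g : F[X]) (d : ℕ) : HyperellipticRing g :=
  if Even d then ⟨X ^ (d / 2), 0⟩ else ⟨0, X ^ ((d - 5) / 2)⟩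

theorem degree_norm_monomialOfOrder (hg : g.natDegree = 5) {d : ℕ} (h1 : d ≠ 1) (h3 : d ≠ 3) :
    (monomialOfOrder g d).norm.degree = d := by
  have hg0 : g ≠ 0 := by rintro rfl; simp at hg
  rw [monomialOfOrder, QuadraticAlgebra.norm_def]
  split_ifs with h
  · obtain ⟨k, rfl⟩ := h
    simp only [degree_mul, mul_zero, add_zero, sub_zero, degree_X_pow]
    norm_cast
    omega
  · rw [Nat.not_even_iff_odd] at h
    obtain ⟨k, rfl⟩ := h
    simp only [degree_mul, mul_zero, zero_mul, add_zero, zero_sub, degree_neg, degree_X_pow,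
      degree_eq_natDegree hg0, hg]
    norm_cast
    omega

/-- The possible pole orders up to `n`. -/
def poleOrders (n : ℕ) : Finset ℕ := ((range (n + 1)).erase 1).erase 3

theorem mem_poleOrders {n d : ℕ} : d ∈ poleOrders n ↔ d ≠ 3 ∧ d ≠ 1 ∧ d ≤ n := by
  simp [poleOrders]

theorem card_poleOrders {n : ℕ} (hn : 3 ≤ n) : (poleOrders n).card = n - 1 := by
  rw [poleOrders, card_erase_of_mem, card_erase_of_mem, card_range]
  · omega
  · simp; omega
  · simp; omega

/-- Evaluation at an affine point of the curve. -/
noncomputable def evalPoint (t w : F) (h : w * w = g.eval t + t * w) :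
    HyperellipticRing g →+* F where
  toFun u := u.re.eval t + u.im.eval t * w
  map_one' := by simp [QuadraticAlgebra.re_one, QuadraticAlgebra.im_one]
  map_zero' := by simp
  map_add' u v := by simp; ring
  map_mul' u v := by
    simp
    linear_combination (-(u.im.eval t * v.im.eval t)) * h

theorem evalPoint_apply (t w : F) (h : w * w = g.eval t + t * w) (u : HyperellipticRing g) :
    evalPoint t w h u = u.re.eval t + u.im.eval t * w := rfl

/-- More than `N - 2` functions with pole order smaller than `N` are linearly dependent. -/
theorem exists_relation {N : ℕ} (hN : 4 ≤ N) {ι : Type*} [Fintype ι]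
    (v : ι → HyperellipticRing g) (hv : ∀ i, v i ∈ poleLT g N) (hcard : N - 2 < Fintype.card ι) :
    ∃ c : ι → F, c ≠ 0 ∧ ∑ i, c i • v i = 0 := by
  let T : (ι → F) →ₗ[F] HyperellipticRing g := Fintype.linearCombination F v
  let Φ : HyperellipticRing g →ₗ[F] (Fin ((N + 1) / 2) → F) × (Fin ((N - 4) / 2) → F) :=
    { toFun := fun u => (fun k => u.re.coeff k, fun k => u.im.coeff k)
      map_add' := fun u v => by ext <;> simp
      map_smul' := fun c u => by ext <;> simp }
  have hlt : Module.finrank F ((Fin ((N + 1) / 2) → F) × (Fin ((N - 4) / 2) → F)) <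
      Module.finrank F (ι → F) := by
    simp only [Module.finrank_prod, Module.finrank_pi, Fintype.card_fin]
    omega
  obtain ⟨c, hc, hc0⟩ := (Submodule.ne_bot_iff _).1 (LinearMap.ker_ne_bot_of_finrank_lt
    (f := Φ ∘ₗ T) hlt)
  refine ⟨c, hc0, ?_⟩
  have hmem : T c ∈ poleLT g N := by
    rw [Fintype.linearCombination_apply]
    exact Submodule.sum_mem _ fun i _ => Submodule.smul_mem _ _ (hv i)
  have hΦ : Φ (T c) = 0 := hc
  rw [← Fintype.linearCombination_apply F v c]
  change T c = 0
  rw [mem_poleLT] at hmem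
  have h1 := congrArg Prod.fst hΦ
  have h2 := congrArg Prod.snd hΦ
  ext k
  · by_cases hk : k < (N + 1) / 2
    · exact congrFun h1 ⟨k, hk⟩
    · exact (hmem k).1 (by omega)
  · by_cases hk : k < (N - 4) / 2
    · exact congrFun h2 ⟨k, hk⟩
    · exact (hmem k).2 (by omega)

/-- Functions with pairwise distinct pole orders are linearly independent. -/
theorem sum_ne_zero (hg : g.natDegree = 5) {ι : Type*} [Fintype ι] (v : ι → HyperellipticRing g)
    (d : ι → ℕ) (hd : Function.Injective d) (hv : ∀ i, (v i).norm.degree = d i)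
    (c : ι → F) (hc : c ≠ 0) : ∑ i, c i • v i ≠ 0 := by
  classical
  obtain ⟨i₁, hi₁⟩ := Function.ne_iff.1 hc
  obtain ⟨i, hi, hmax⟩ := exists_max_image (univ.filter fun i => c i ≠ 0) d
    ⟨i₁, by simpa using hi₁⟩
  simp only [mem_filter, mem_univ, true_and] at hi hmax
  intro h0
  rw [← add_sum_erase _ _ (mem_univ i)] at h0
  have hrest : ∑ j ∈ univ.erase i, c j • v j ∈ poleLT g (d i) := by
    refine Submodule.sum_mem _ fun j hj => ?_
    by_cases hcj : c j = 0
    · simp [hcj]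
    refine Submodule.smul_mem _ _ ?_
    rw [← degree_norm_lt_iff hg, hv]
    exact_mod_cast lt_of_le_of_ne (hmax j hcj) fun h => (ne_of_mem_erase hj) (hd h)
  have hmem : c i • v i ∈ poleLT g (d i) := by
    rw [eq_neg_of_add_eq_zero_left h0]
    exact Submodule.neg_mem _ hrest
  rw [Submodule.smul_mem_iff _ hi, ← degree_norm_lt_iff hg, hv] at hmem
  exact lt_irrefl _ hmem

/-- **Stepanov's bound** for the number of abscissas of rational points of `w² = t w + g(t)`. -/
theorem two_mul_card_le [Fintype F] [CharP F 2] (hg : g.natDegree = 5) {k q' l n : ℕ}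
    (hq : 2 ^ k * q' = Fintype.card F) (hl : 3 ≤ l) (hn : 3 ≤ n) (hlq : l < q')
    (hln : l * 2 ^ k + n - 1 < (l - 1) * (n - 1)) (G : Finset F)
    (hG : ∀ t ∈ G, t ≠ 0 ∧ ∃ w, w * w = g.eval t + t * w) :
    2 * G.card ≤ l + n * q' := by
  have hord {n : ℕ} (i : poleOrders n) : (monomialOfOrder g i).norm.degree = (i : ℕ) :=
    degree_norm_monomialOfOrder hg (mem_poleOrders.1 i.2).2.1 (mem_poleOrders.1 i.2).1
  have hle {n : ℕ} (i : poleOrders n) : (i : ℕ) ≤ n := (mem_poleOrders.1 i.2).2.2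
  obtain ⟨c, hc, hrel⟩ := exists_relation (g := g) (N := l * 2 ^ k + n + 1) (by omega)
    (fun p : poleOrders l × poleOrders n => monomialOfOrder g p.1 ^ 2 ^ k * monomialOfOrder g p.2)
    (fun p => by
      rw [← degree_norm_lt_iff hg, map_mul, map_pow, degree_mul, degree_pow, hord, hord,
        nsmul_eq_mul]
      norm_cast
      have := Nat.mul_le_mul_left (2 ^ k) (hle p.1)
      have := hle p.2
      rw [mul_comm l]
      omega)
    (by
      rw [Fintype.card_prod, Fintype.card_coe, Fintype.card_coe, card_poleOrders hl,
        card_poleOrders hn]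
      omega)
  have hroot (x : F) : ∃ y : F, y ^ 2 ^ k = x := by
    obtain ⟨y, hy⟩ := (bijective_iterateFrobenius F 2 k).2 x
    exact ⟨y, by rw [← hy, iterateFrobenius_def]⟩
  choose r hr using hroot
  set d : poleOrders l × poleOrders n → F := fun p => r (c p) with hd
  have hd0 : d ≠ 0 := by
    intro h
    apply hc
    ext p
    rw [← hr (c p), show r (c p) = 0 from congrFun h p]
    simp
  set h : HyperellipticRing g := ∑ p, d p • (monomialOfOrder g p.1 * monomialOfOrder g p.2 ^ q') with hh
  have hdeg (p : poleOrders l × poleOrders n) :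
      (monomialOfOrder g (p.1 : ℕ) * monomialOfOrder g (p.2 : ℕ) ^ q').norm.degree =
        ((p.1 + q' * p.2 : ℕ) : WithBot ℕ) := by
    rw [map_mul, map_pow, degree_mul, degree_pow, hord, hord, nsmul_eq_mul]
    norm_cast
  have hh0 : h ≠ 0 := by
    refine sum_ne_zero hg _ (fun p => (p.1 : ℕ) + q' * p.2) ?_ hdeg d hd0
    rintro ⟨i, j⟩ ⟨i', j'⟩ hij
    simp only at hij
    have hi := (hle i).trans_lt hlq
    have hi' := (hle i').trans_lt hlq
    have h1 := congrArg (· % q') hij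
    simp only [Nat.add_mul_mod_self_left, Nat.mod_eq_of_lt hi, Nat.mod_eq_of_lt hi'] at h1
    have h2 : (j : ℕ) = j' := by
      have : q' * (j : ℕ) = q' * j' := by omega
      exact Nat.eq_of_mul_eq_mul_left (by omega) this
    exact Prod.ext (Subtype.ext h1) (Subtype.ext h2)
  have hmem : h ∈ poleLT g (l + n * q' + 1) := by
    refine Submodule.sum_mem _ fun p _ => Submodule.smul_mem _ _ ?_
    rw [← degree_norm_lt_iff hg, hdeg]
    norm_cast
    have := Nat.mul_le_mul_left q' (hle p.2)
    have := hle p.1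
    rw [mul_comm n]
    omega
  have hsmul (t w : F) (e) (a : F) (u : HyperellipticRing g) :
      evalPoint t w e (a • u) = a * evalPoint t w e u := by
    simp [evalPoint_apply]; ring
  have hvanish (t w : F) (e : w * w = g.eval t + t * w) : evalPoint t w e h = 0 := by
    refine eq_zero_of_pow_eq_zero (n := 2 ^ k) ?_
    have h1 := congrArg (evalPoint t w e) hrel
    rw [map_sum, map_zero] at h1
    rw [hh, map_sum, sum_pow_char_pow, ← h1]
    refine sum_congr rfl fun p _ => ?_
    rw [hsmul, hsmul, map_mul, map_mul, map_pow, map_pow, mul_pow, mul_pow, hd, hr, ← pow_mul,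
      mul_comm q', hq, FiniteField.pow_card]
  have hzero (t : F) (ht : t ∈ G) : h.re.eval t = 0 ∧ h.im.eval t = 0 := by
    obtain ⟨ht0, w, hw⟩ := hG t ht
    have h1 := hvanish t w hw
    have h2 := hvanish t (t - w) (by linear_combination hw)
    have hch : (2 : F) = 0 := CharTwo.two_eq_zero
    rw [evalPoint_apply] at h1 h2
    have h3 : h.im.eval t = 0 := by
      refine (mul_eq_zero.1 (?_ : h.im.eval t * t = 0)).resolve_right ht0
      linear_combination h2 - h1 + h.im.eval t * w * hch
    exact ⟨by simpa [h3] using h1, h3⟩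
  rw [mem_poleLT_iff_natDegree] at hmem
  have hcard (p : F[X]) (hp : p ≠ 0) (hz : ∀ t ∈ G, p.eval t = 0) : G.card ≤ p.natDegree := by
    by_contra! hlt
    exact hp (eq_zero_of_natDegree_lt_card_of_eval_eq_zero' p G hz hlt)
  by_cases hre : h.re = 0
  · have him : h.im ≠ 0 := fun him => hh0 (QuadraticAlgebra.ext hre him)
    have := hcard _ him fun t ht => (hzero t ht).2
    have := hmem.2 him
    omega
  · have := hcard _ hre fun t ht => (hzero t ht).1
    have := hmem.1 hre
    omega

end HyperellipticRing

namespace BinaryField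

open Finset

variable {F : Type*} [Field F] [Algebra (ZMod 2) F]

/-- The canonical additive character `x ↦ (-1) ^ Tr x` of a finite field of characteristic two. -/
noncomputable def chi (x : F) : ℤ := if Algebra.trace (ZMod 2) F x = 0 then 1 else -1

theorem chi_eq_one_or (x : F) : chi x = 1 ∨ chi x = -1 := by
  rw [chi]; split_ifs <;> simp

theorem chi_add (x y : F) : chi (x + y) = chi x * chi y := by
  simp only [chi, map_add]
  generalize Algebra.trace (ZMod 2) F x = a
  generalize Algebra.trace (ZMod 2) F y = b
  revert a b
  decide

theorem chi_zero : chi (0 : F) = 1 := by simp [chi]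

theorem chi_mul_self (x : F) : chi x * chi x = 1 := by
  rcases chi_eq_one_or x with h | h <;> simp [h]

theorem sum_one_add_chi (s : Finset F) (f : F → F) :
    ∑ t ∈ s, (1 + chi (f t)) = 2 * (s.filter fun t => chi (f t) = 1).card := by
  rw [card_filter, Nat.cast_sum, mul_sum]
  refine sum_congr rfl fun t _ => ?_
  rcases chi_eq_one_or (f t) with h | h <;> simp [h]

theorem charTwo : CharP F 2 :=
  charP_of_injective_algebraMap (algebraMap (ZMod 2) F).injective 2

variable [Fintype F]

theorem chi_sq (x : F) : chi (x ^ 2) = chi x := by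
  have h := Algebra.trace_eq_of_algEquiv (FiniteField.frobeniusAlgEquivOfAlgebraic (ZMod 2) F) x
  rw [FiniteField.coe_frobeniusAlgEquivOfAlgebraic, ZMod.card] at h
  simp only [chi, h]

theorem chi_one (hm : Odd (Module.finrank (ZMod 2) F)) : chi (1 : F) = -1 := by
  have h : Algebra.trace (ZMod 2) F 1 = 1 := by
    rw [← map_one (algebraMap (ZMod 2) F), Algebra.trace_algebraMap, nsmul_eq_mul, mul_one]
    exact (ZMod.natCast_eq_one_iff_odd).2 hm
  simp [chi, h]

theorem sum_chi : ∑ x : F, chi x = 0 := by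
  obtain ⟨a, ha⟩ := Algebra.trace_surjective (ZMod 2) F 1
  have h : ∑ x : F, chi x = ∑ x : F, chi (x + a) := (Equiv.sum_comp (Equiv.addRight a) _).symm
  simp only [chi_add, ← sum_mul] at h
  have : chi a = -1 := by simp [chi, ha]
  rw [this] at h
  omega

variable [DecidableEq F]

theorem sum_chi_mul (a : F) : ∑ x : F, chi (a * x) = if a = 0 then (Fintype.card F : ℤ) else 0 := by
  split_ifs with h
  · simp [h, chi_zero]
  · rw [← sum_chi (F := F)]
    exact Equiv.sum_comp (Equiv.mulLeft₀ a h) chi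

/-- The number of solutions of an Artin–Schreier equation. -/
theorem card_artinSchreier (z : F) :
    ((univ.filter fun y : F => y ^ 2 + y = z).card : ℤ) = 1 + chi z := by
  have := charTwo (F := F)
  have hle (z : F) : ((univ.filter fun y : F => y ^ 2 + y = z).card : ℤ) ≤ 1 + chi z := by
    rcases (univ.filter fun y : F => y ^ 2 + y = z).eq_empty_or_nonempty with h | ⟨y, hy⟩
    · rw [h]
      rcases chi_eq_one_or z with h | h <;> simp [h]
    · simp only [mem_filter, mem_univ, true_and] at hy
      have h1 : chi z = 1 := by rw [← hy, chi_add, chi_sq, chi_mul_self]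
      have hsub : (univ.filter fun y : F => y ^ 2 + y = z) ⊆ {y, y + 1} := by
        intro x hx
        simp only [mem_filter, mem_univ, true_and, mem_insert, mem_singleton] at hx ⊢
        have : (x - y) * (x - (y + 1)) = 0 := by
          linear_combination hx - hy + (y ^ 2 + y - x * y - x) * CharTwo.two_eq_zero (R := F)
        rcases mul_eq_zero.1 this with h | h
        · exact Or.inl (sub_eq_zero.1 h)
        · exact Or.inr (sub_eq_zero.1 h)
      have := (card_le_card hsub).trans card_le_two
      rw [h1]
      exact_mod_cast this
  have hsum : ∑ z : F, ((univ.filter fun y : F => y ^ 2 + y = z).card : ℤ) =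
      ∑ z : F, (1 + chi z) := by
    rw [sum_add_distrib, sum_chi, ← Nat.cast_sum,
      ← card_eq_sum_card_fiberwise (fun _ _ => mem_coe.2 (mem_univ _))]
    simp
  exact (sum_eq_sum_iff_of_le fun z _ => hle z).1 hsum z (mem_univ z)

theorem exists_artinSchreier {z : F} (h : chi z = 1) : ∃ y : F, y ^ 2 + y = z := by
  have := card_artinSchreier z
  rw [h] at this
  have hpos : 0 < (univ.filter fun y : F => y ^ 2 + y = z).card := by omega
  obtain ⟨y, hy⟩ := card_pos.1 hpos
  exact ⟨y, by simpa using hy⟩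

theorem cube_bijective (hm : Odd (Module.finrank (ZMod 2) F)) :
    Function.Bijective fun x : F => x ^ 3 := by
  have := charTwo (F := F)
  refine Finite.injective_iff_bijective.1 fun x y hxy => ?_
  change x ^ 3 = y ^ 3 at hxy
  by_cases hy : y = 0
  · subst hy
    simpa using hxy
  have h : (x - y) * (x ^ 2 + x * y + y ^ 2) = 0 := by linear_combination hxy
  refine (mul_eq_zero.1 h).elim sub_eq_zero.1 fun h => ?_
  have h1 : (x / y) ^ 2 + x / y = 1 := by
    field_simp
    linear_combination h - y ^ 2 * CharTwo.two_eq_zero (R := F)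
  have h2 : chi (1 : F) = 1 := by rw [← h1, chi_add, chi_sq, chi_mul_self]
  rw [chi_one hm] at h2
  omega

/-- The cubic exponential sum `∑ χ(λ x³ + λ x)`. -/
noncomputable def cubicSum (l : F) : ℤ := ∑ x : F, chi (l * x ^ 3 + l * x)

theorem cubicSum_sq_le (hm : Odd (Module.finrank (ZMod 2) F)) {l : F} (hl : l ≠ 0) :
    cubicSum l ^ 2 ≤ 2 * Fintype.card F := by
  have := charTwo (F := F)
  have h2 := CharTwo.two_eq_zero (R := F)
  have hkey (z : F) : ∑ x : F, chi (l * x ^ 3 + l * x) * chi (l * (x + z) ^ 3 + l * (x + z)) =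
      chi (l * z ^ 3 + l * z) * if l * z + l ^ 2 * z ^ 4 = 0 then (Fintype.card F : ℤ) else 0 := by
    rw [← sum_chi_mul, ← Equiv.sum_comp (frobeniusEquiv F 2).toEquiv fun x => chi (_ * x), mul_sum]
    refine sum_congr rfl fun x _ => ?_
    have e1 : l * (x + z) ^ 3 + l * (x + z) =
        (l * x ^ 3 + l * x) + (l * z ^ 3 + l * z) + (l * z * x ^ 2 + l * z ^ 2 * x) := by
      linear_combination (l * x ^ 2 * z + l * x * z ^ 2) * h2
    have e2 : (l * z + l ^ 2 * z ^ 4) * x ^ 2 = l * z * x ^ 2 + (l * z ^ 2 * x) ^ 2 := by ring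
    have e3 : (frobeniusEquiv F 2).toEquiv x = x ^ 2 := rfl
    rw [e3, e1, e2, chi_add (_ + _) (l * z * x ^ 2 + _), chi_add (_ + _) (l * z ^ 3 + _),
      chi_add (l * z * x ^ 2), chi_add (l * z * x ^ 2), chi_sq]
    linear_combination (chi (l * z ^ 3 + l * z) * (chi (l * z * x ^ 2) * chi (l * z ^ 2 * x))) *
      chi_mul_self (l * x ^ 3 + l * x)
  have hsq : cubicSum l ^ 2 = ∑ z : F, chi (l * z ^ 3 + l * z) *
      if l * z + l ^ 2 * z ^ 4 = 0 then (Fintype.card F : ℤ) else 0 := by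
    simp only [← hkey]
    rw [sum_comm, cubicSum, sq, sum_mul]
    refine sum_congr rfl fun x _ => ?_
    rw [← mul_sum]
    congr 1
    exact (Equiv.sum_comp (Equiv.addLeft x) fun y => chi (l * y ^ 3 + l * y)).symm
  obtain ⟨r, hr⟩ := (cube_bijective hm).2 l⁻¹
  have hsub : (univ.filter fun z : F => l * z + l ^ 2 * z ^ 4 = 0) ⊆ {0, r} := by
    intro z hz
    simp only [mem_filter, mem_univ, true_and, mem_insert, mem_singleton] at hz ⊢
    by_cases hz0 : z = 0
    · exact Or.inl hz0
    right
    apply (cube_bijective hm).1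
    simp only at hr ⊢
    rw [hr]
    have : (l * z) * (1 + l * z ^ 3) = 0 := by linear_combination hz
    have := (mul_eq_zero.1 this).resolve_left (mul_ne_zero hl hz0)
    refine eq_inv_of_mul_eq_one_left ?_
    linear_combination this - h2
  rw [hsq]
  calc _ ≤ ∑ z : F, if l * z + l ^ 2 * z ^ 4 = 0 then (Fintype.card F : ℤ) else 0 := by
        refine sum_le_sum fun z _ => ?_
        split_ifs
        · rcases chi_eq_one_or (l * z ^ 3 + l * z) with h | h <;> rw [h] <;> omega
        · simp
    _ = (univ.filter fun z : F => l * z + l ^ 2 * z ^ 4 = 0).card * (Fintype.card F : ℤ) := by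
        rw [← sum_filter, sum_const, nsmul_eq_mul]
    _ ≤ 2 * Fintype.card F := by
        have := (card_le_card hsub).trans card_le_two
        gcongr
        exact_mod_cast this

/-- The inverse cubic exponential sum `∑ χ(λ t³ + t⁻¹)` over `t ≠ 0`. -/
noncomputable def inverseCubicSum (l : F) : ℤ := ∑ t ∈ univ.erase (0 : F), chi (l * t ^ 3 + t⁻¹)

theorem chi_mul_inverseCubicSum_le {l : F} (hl : l ≠ 0) (c : F) {k : ℕ} (hk : 2 ≤ k)
    (hq : Fintype.card F = 2 ^ (2 * k + 1)) :
    chi c * inverseCubicSum l ≤ 7 * 2 ^ k + 4 := by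
  have := charTwo (F := F)
  have h2 := CharTwo.two_eq_zero (R := F)
  set Q := 2 ^ k with hQ
  have hQ4 : 4 ≤ Q := by
    calc 4 = 2 ^ 2 := rfl
      _ ≤ 2 ^ k := Nat.pow_le_pow_right (by norm_num) hk
  have hcard : Fintype.card F = Q * (2 * Q) := by rw [hq, hQ]; ring
  set s := (univ.erase (0 : F)).filter fun t => chi (l * t ^ 3 + t⁻¹ + c) = 1 with hs
  have hsum := sum_one_add_chi (univ.erase (0 : F)) fun t => l * t ^ 3 + t⁻¹ + c
  rw [← hs, sum_add_distrib, sum_const, card_erase_of_mem (mem_univ _), card_univ] at hsum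
  simp only [chi_add _ c] at hsum
  rw [← sum_mul, ← inverseCubicSum] at hsum
  have hdeg : (Polynomial.C l * Polynomial.X ^ 5 + Polynomial.C c * Polynomial.X ^ 2 +
      Polynomial.X).natDegree = 5 := by compute_degree!
  have hbound := HyperellipticRing.two_mul_card_le hdeg (k := k) (q' := 2 * Q) (l := Q + 3)
    (n := Q + 3) hcard.symm (by omega) (by omega) (by omega)
    (by
      rw [← hQ]
      rw [show Q + 3 - 1 = Q + 2 by omega, show (Q + 3) * Q + (Q + 3) - 1 = (Q + 3) * Q + (Q + 2) by omega]
      nlinarith) s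
    (by
      intro t ht
      simp only [hs, mem_filter, mem_erase, mem_univ, and_true] at ht
      obtain ⟨y, hy⟩ := exists_artinSchreier ht.2
      refine ⟨ht.1, t * y, ?_⟩
      simp only [Polynomial.eval_add, Polynomial.eval_mul, Polynomial.eval_C, Polynomial.eval_pow,
        Polynomial.eval_X]
      have e : t ^ 2 * t⁻¹ = t := by have := ht.1; field_simp
      linear_combination t ^ 2 * hy + e - t ^ 2 * y * h2)
  have hq1 : 1 ≤ Fintype.card F := Fintype.card_pos
  rw [nsmul_eq_mul, Nat.cast_sub hq1, hcard] at hsum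
  zify at hbound
  push_cast at hsum
  have e : ((2 : ℤ) ^ k) = Q := by rw [hQ]; push_cast; rfl
  rw [e]
  nlinarith

theorem abs_inverseCubicSum_le {l : F} (hl : l ≠ 0) {k : ℕ} (hk : 2 ≤ k)
    (hq : Fintype.card F = 2 ^ (2 * k + 1)) : |inverseCubicSum l| ≤ 7 * 2 ^ k + 4 := by
  obtain ⟨a, ha⟩ := Algebra.trace_surjective (ZMod 2) F 1
  have h0 := chi_mul_inverseCubicSum_le hl 0 hk hq
  have h1 := chi_mul_inverseCubicSum_le hl a hk hq
  rw [chi_zero] at h0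
  rw [show chi a = -1 by simp [chi, ha]] at h1
  rw [abs_le]
  constructor <;> linarith

theorem abs_inverseCubicSum_le_card (l : F) : |inverseCubicSum l| ≤ Fintype.card F - 1 := by
  refine (abs_sum_le_sum_abs _ _).trans ?_
  have (t : F) : |chi (l * t ^ 3 + t⁻¹)| = 1 := by
    rcases chi_eq_one_or (l * t ^ 3 + t⁻¹) with h | h <;> simp [h]
  simp only [this, sum_const, card_erase_of_mem (mem_univ _), card_univ, nsmul_eq_mul, mul_one]
  rw [Nat.cast_sub Fintype.card_pos]
  simp

theorem sum_chi_cube (hm : Odd (Module.finrank (ZMod 2) F)) {l : F} (hl : l ≠ 0) :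
    ∑ t ∈ univ.erase (0 : F), chi (l * t ^ 3) = -1 := by
  have h : ∑ t : F, chi (l * t ^ 3) = 0 := by
    rw [Function.Bijective.sum_comp (cube_bijective hm) fun t => chi (l * t), sum_chi_mul,
      if_neg hl]
  rw [← add_sum_erase _ _ (mem_univ (0 : F))] at h
  simp only [ne_eq, OfNat.ofNat_ne_zero, not_false_eq_true, zero_pow, mul_zero, chi_zero] at h
  omega

theorem card_add_inv_eq {t : F} (ht : t ≠ 0) :
    ((((univ.erase (0 : F)).erase 1).filter fun x => x + x⁻¹ = t).card : ℤ) = 1 + chi t⁻¹ := by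
  have := charTwo (F := F)
  have h2 := CharTwo.two_eq_zero (R := F)
  rw [← chi_sq, ← card_artinSchreier]
  congr 1
  symm
  refine card_bij (fun y _ => t * y) ?_ (fun a _ b _ h => mul_left_cancel₀ ht h) ?_
  · intro y hy
    simp only [mem_filter, mem_univ, true_and, mem_erase, and_true] at hy ⊢
    have e : (t * y) ^ 2 + t * (t * y) = 1 := by
      have : t ^ 2 * t⁻¹ ^ 2 = 1 := by field_simp
      linear_combination t ^ 2 * hy + this
    have hy0 : t * y ≠ 0 := by
      intro h0
      rw [h0] at e
      simp at e
    refine ⟨⟨fun h1 => ht ?_, hy0⟩, ?_⟩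
    · rw [h1] at e
      linear_combination e
    · have : (t * y) * (t * y + (t * y)⁻¹) = (t * y) * t := by
        rw [mul_add, mul_inv_cancel₀ hy0]
        linear_combination e - (t * y) * t * h2 + h2
      exact mul_left_cancel₀ hy0 this
  · intro x hx
    simp only [mem_filter, mem_univ, mem_erase, and_true] at hx
    refine ⟨x / t, ?_, by field_simp⟩
    simp only [mem_filter, mem_univ, true_and]
    obtain ⟨⟨-, hx0⟩, hx⟩ := hx
    have e : x ^ 2 + x * t = 1 := by
      have : x * x⁻¹ = 1 := mul_inv_cancel₀ hx0
      linear_combination (-x) * hx + this - h2 + x ^ 2 * h2 + h2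
    field_simp
    linear_combination e

theorem sum_chi_add_inv_cube (hm : Odd (Module.finrank (ZMod 2) F)) {l : F} (hl : l ≠ 0) :
    ∑ x ∈ (univ.erase (0 : F)).erase 1, chi (l * (x + x⁻¹) ^ 3) = inverseCubicSum l - 1 := by
  have := charTwo (F := F)
  have h2 := CharTwo.two_eq_zero (R := F)
  have hmaps : ∀ x ∈ (univ.erase (0 : F)).erase 1, x + x⁻¹ ∈ univ.erase (0 : F) := by
    intro x hx
    simp only [mem_univ, mem_erase, and_true] at hx ⊢
    intro h
    have h1 : x * x⁻¹ = 1 := mul_inv_cancel₀ hx.2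
    have : (x - 1) ^ 2 = 0 := by linear_combination x * h - h1 - x * h2
    exact hx.1 (sub_eq_zero.1 (eq_zero_of_pow_eq_zero this))
  rw [← sum_fiberwise_of_maps_to hmaps]
  have (t : F) (ht : t ∈ univ.erase (0 : F)) :
      ∑ x ∈ ((univ.erase (0 : F)).erase 1).filter (fun x => x + x⁻¹ = t),
        chi (l * (x + x⁻¹) ^ 3) = chi (l * t ^ 3) + chi (l * t ^ 3 + t⁻¹) := by
    rw [sum_congr rfl fun x hx => by rw [(mem_filter.1 hx).2], sum_const, nsmul_eq_mul,
      card_add_inv_eq (ne_of_mem_erase ht), chi_add]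
    ring
  rw [sum_congr rfl this, sum_add_distrib, sum_chi_cube hm hl, inverseCubicSum]
  ring

theorem four_mul_card_eq (hm : Odd (Module.finrank (ZMod 2) F)) {l : F} (hl : l ≠ 0) (e : F) :
    4 * ((((univ.erase (0 : F)).erase 1).filter fun x => chi (l * x ^ 3 + l * x + e) = 1 ∧
      chi (l * (x ^ 3)⁻¹ + l * x⁻¹ + e) = 1).card : ℤ) =
      Fintype.card F - 3 + 2 * chi e * (cubicSum l - 2) + inverseCubicSum l := by
  have := charTwo (F := F)
  have h2 := CharTwo.two_eq_zero (R := F)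
  set s := (univ.erase (0 : F)).erase 1 with hs
  have hs1 : (1 : F) ∈ univ.erase (0 : F) := by simp
  have hcard : (s.card : ℤ) = Fintype.card F - 2 := by
    have h1 := card_erase_add_one hs1
    have h3 := card_erase_add_one (mem_univ (0 : F))
    rw [card_univ] at h3
    rw [← hs] at h1
    omega
  have hone : l * 1 ^ 3 + l * 1 = 0 := by linear_combination l * h2
  have hS : ∑ x ∈ s, chi (l * x ^ 3 + l * x) = cubicSum l - 2 := by
    rw [cubicSum, ← add_sum_erase _ _ (mem_univ (0 : F)), ← add_sum_erase _ _ hs1, hone, ← hs]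
    simp only [ne_eq, OfNat.ofNat_ne_zero, not_false_eq_true, zero_pow, mul_zero, add_zero,
      chi_zero]
    ring
  have hS' : ∑ x ∈ s, chi (l * (x ^ 3)⁻¹ + l * x⁻¹) = cubicSum l - 2 := by
    rw [← hS]
    refine sum_nbij' (fun x => x⁻¹) (fun x => x⁻¹) ?_ ?_ ?_ ?_ ?_ <;> simp [hs]
  have hterm (x : F) : (if chi (l * x ^ 3 + l * x + e) = 1 ∧
      chi (l * (x ^ 3)⁻¹ + l * x⁻¹ + e) = 1 then 4 else 0 : ℤ) =
      (1 + chi (l * x ^ 3 + l * x + e)) * (1 + chi (l * (x ^ 3)⁻¹ + l * x⁻¹ + e)) := by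
    rcases chi_eq_one_or (l * x ^ 3 + l * x + e) with h | h <;>
    rcases chi_eq_one_or (l * (x ^ 3)⁻¹ + l * x⁻¹ + e) with h' | h' <;> simp [h, h']
  have hprod (x : F) (hx : x ∈ s) :
      (1 + chi (l * x ^ 3 + l * x + e)) * (1 + chi (l * (x ^ 3)⁻¹ + l * x⁻¹ + e)) =
      1 + chi e * chi (l * x ^ 3 + l * x) + chi e * chi (l * (x ^ 3)⁻¹ + l * x⁻¹) +
        chi (l * (x + x⁻¹) ^ 3) := by
    have hx0 : x ≠ 0 := by
      rintro rfl
      simp [hs] at hx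
    have e1 : l * (x + x⁻¹) ^ 3 = (l * x ^ 3 + l * x) + (l * (x ^ 3)⁻¹ + l * x⁻¹) := by
      have hxx : x * x⁻¹ = 1 := mul_inv_cancel₀ hx0
      rw [← inv_pow]
      linear_combination (3 * l * x + 3 * l * x⁻¹) * hxx + (l * x + l * x⁻¹) * h2
    rw [e1, chi_add _ e, chi_add _ e, chi_add (_ + _) (_ + _)]
    linear_combination (chi (l * x ^ 3 + l * x) * chi (l * (x ^ 3)⁻¹ + l * x⁻¹)) * chi_mul_self e
  have hsum : 4 * ((s.filter fun x => chi (l * x ^ 3 + l * x + e) = 1 ∧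
      chi (l * (x ^ 3)⁻¹ + l * x⁻¹ + e) = 1).card : ℤ) =
      ∑ x ∈ s, (1 + chi (l * x ^ 3 + l * x + e)) * (1 + chi (l * (x ^ 3)⁻¹ + l * x⁻¹ + e)) := by
    rw [card_filter, Nat.cast_sum, mul_sum]
    refine sum_congr rfl fun x _ => ?_
    rw [← hterm]
    split_ifs <;> simp
  rw [hsum, sum_congr rfl hprod, sum_add_distrib, sum_add_distrib, sum_add_distrib, ← mul_sum,
    ← mul_sum, hS, hS', sum_chi_add_inv_cube hm hl, sum_const, nsmul_eq_mul, hcard]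
  ring

theorem abs_cubicSum_le (hm : Odd (Module.finrank (ZMod 2) F)) {l : F} (hl : l ≠ 0) :
    |(cubicSum l : ℝ)| ≤ Real.sqrt (2 * Fintype.card F) := by
  refine Real.abs_le_sqrt ?_
  exact_mod_cast cubicSum_sq_le hm hl

theorem abs_inverseCubicSum_le_floor {l : F} (hl : l ≠ 0) {m : ℕ} (hm : Odd m)
    (hq : Fintype.card F = 2 ^ m) :
    |inverseCubicSum l| ≤ 3 * ⌊2 * Real.sqrt (2 ^ m)⌋ := by
  obtain ⟨k, rfl⟩ := hm
  have htriv := abs_inverseCubicSum_le_card l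
  rw [hq] at htriv
  push_cast at htriv
  have hfloor (z : ℤ) (hz : (0 : ℝ) ≤ z) (h : (z / 2 : ℝ) ^ 2 ≤ 2 ^ (2 * k + 1)) :
      z ≤ ⌊2 * Real.sqrt (2 ^ (2 * k + 1))⌋ := by
    rw [Int.le_floor]
    have := Real.le_sqrt_of_sq_le h
    linarith
  rcases Nat.lt_or_ge k 3 with hk | hk
  · interval_cases k
    · have := hfloor 2 (by norm_num) (by norm_num)
      omega
    · have := hfloor 5 (by norm_num) (by norm_num)
      omega
    · have := hfloor 11 (by norm_num) (by norm_num)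
      omega
  · have hbound := abs_inverseCubicSum_le hl (by omega) hq
    have hQ : (8 : ℝ) ≤ 2 ^ k := by
      calc (8 : ℝ) = 2 ^ 3 := by norm_num
        _ ≤ 2 ^ k := pow_le_pow_right₀ (by norm_num) hk
    have hsqrt : (1.4 * 2 ^ k : ℝ) ≤ Real.sqrt (2 ^ (2 * k + 1)) := by
      refine Real.le_sqrt_of_sq_le ?_
      rw [pow_succ _ (2 * k), pow_mul']
      nlinarith [sq_nonneg ((2 : ℝ) ^ k)]
    have hlt := Int.lt_floor_add_one (2 * Real.sqrt (2 ^ (2 * k + 1)))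
    refine hbound.trans ?_
    have : (7 * 2 ^ k + 4 : ℝ) ≤ 3 * (⌊2 * Real.sqrt (2 ^ (2 * k + 1))⌋ : ℤ) := by linarith
    exact_mod_cast this

end BinaryField


/-- for `q = 2^m` with `m` odd and `λ = B + A² + A + 1 ≠ 0`, the
number `M = M(f₁,f₂)` of pairs of completely splitting points of the fibre
product of `y²+y = f₁` and `y²+y = f₂`, with `f₁ = λx³+λx+A+1` and
`f₂ = λx⁻³+λx⁻¹+A+1`, satisfies
`(q−7−3⌊2√q⌋−2√(2q))/8 ≤ M ≤ (q−7+3⌊2√q⌋+2√(2q))/8` if `Tr(A+1) = 0`, and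
`(q+1−3⌊2√q⌋−2√(2q))/8 ≤ M ≤ (q+1+3⌊2√q⌋+2√(2q))/8` if `Tr(A+1) = 1`. -/
theorem M_f1_f2_bounds
    (m : ℕ) (hm : Odd m) (A B : GaloisField 2 m)
    (hlam : B + A ^ 2 + A + 1 ≠ 0)
    (M : ℝ)
    (hM : M = (Set.ncard {x : GaloisField 2 m | x ≠ 0 ∧ x ≠ 1 ∧
        Algebra.trace (ZMod 2) (GaloisField 2 m)
          ((B + A ^ 2 + A + 1) * x ^ 3 + (B + A ^ 2 + A + 1) * x + A + 1) = 0 ∧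
        Algebra.trace (ZMod 2) (GaloisField 2 m)
          ((B + A ^ 2 + A + 1) * (x ^ 3)⁻¹ + (B + A ^ 2 + A + 1) * x⁻¹ + A + 1)
          = 0} : ℝ) / 2) :
    (Algebra.trace (ZMod 2) (GaloisField 2 m) (A + 1) = 0 →
      ((2 ^ m : ℝ) - 7 - 3 * ⌊2 * Real.sqrt (2 ^ m)⌋ - 2 * Real.sqrt (2 * 2 ^ m)) / 8 ≤ M ∧
      M ≤ ((2 ^ m : ℝ) - 7 + 3 * ⌊2 * Real.sqrt (2 ^ m)⌋ + 2 * Real.sqrt (2 * 2 ^ m)) / 8) ∧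
    (Algebra.trace (ZMod 2) (GaloisField 2 m) (A + 1) = 1 →
      ((2 ^ m : ℝ) + 1 - 3 * ⌊2 * Real.sqrt (2 ^ m)⌋ - 2 * Real.sqrt (2 * 2 ^ m)) / 8 ≤ M ∧
      M ≤ ((2 ^ m : ℝ) + 1 + 3 * ⌊2 * Real.sqrt (2 ^ m)⌋ + 2 * Real.sqrt (2 * 2 ^ m)) / 8) := by
  classical
  have hm0 : m ≠ 0 := by
    rintro rfl
    simp at hm
  let _ : Fintype (GaloisField 2 m) := Fintype.ofFinite _
  have hcard : Fintype.card (GaloisField 2 m) = 2 ^ m := by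
    rw [Fintype.card_eq_nat_card, GaloisField.card 2 m hm0]
  have hodd : Odd (Module.finrank (ZMod 2) (GaloisField 2 m)) := by
    rwa [GaloisField.finrank 2 hm0]
  set l := B + A ^ 2 + A + 1
  have hchi (x : GaloisField 2 m) :
      BinaryField.chi x = 1 ↔ Algebra.trace (ZMod 2) (GaloisField 2 m) x = 0 := by
    rw [BinaryField.chi]
    split_ifs with h <;> simp [h]
  have hcount := BinaryField.four_mul_card_eq hodd hlam (A + 1)
  rw [← Set.ncard_coe_finset, hcard] at hcount
  have hset : (((Finset.univ.erase (0 : GaloisField 2 m)).erase 1).filter fun x =>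
      BinaryField.chi (l * x ^ 3 + l * x + (A + 1)) = 1 ∧
      BinaryField.chi (l * (x ^ 3)⁻¹ + l * x⁻¹ + (A + 1)) = 1 : Set (GaloisField 2 m)) =
      {x : GaloisField 2 m | x ≠ 0 ∧ x ≠ 1 ∧
        Algebra.trace (ZMod 2) (GaloisField 2 m) (l * x ^ 3 + l * x + A + 1) = 0 ∧
        Algebra.trace (ZMod 2) (GaloisField 2 m) (l * (x ^ 3)⁻¹ + l * x⁻¹ + A + 1) = 0} := by
    ext x
    simp only [Finset.coe_filter, Finset.mem_erase, Finset.mem_univ, and_true, hchi,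
      Set.mem_ofPred_eq, ← add_assoc]
    tauto
  rw [hset] at hcount
  have hM8 := congrArg (Int.cast : ℤ → ℝ) hcount
  push_cast at hM8
  have hS := abs_le.1 (BinaryField.abs_cubicSum_le hodd hlam)
  have hK := BinaryField.abs_inverseCubicSum_le_floor hlam hm hcard
  rw [hcard] at hS
  push_cast at hS
  have hK' : |(BinaryField.inverseCubicSum l : ℝ)| ≤ 3 * (⌊2 * Real.sqrt (2 ^ m)⌋ : ℤ) := by
    exact_mod_cast hK
  rw [abs_le] at hK'
  refine ⟨fun hA => ?_, fun hA => ?_⟩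
  · rw [(hchi _).2 hA] at hM8
    push_cast at hM8
    constructor <;> linarith [hS.1, hS.2, hK'.1, hK'.2]
  · rw [show BinaryField.chi (A + 1) = -1 by simp [BinaryField.chi, hA]] at hM8
    push_cast at hM8
    constructor <;> linarith [hS.1, hS.2, hK'.1, hK'.2]
end
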